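/- Let A_{n,(n_0,n_1,…,n_r)}^{(l_0,l_1,…,l_r)} be a linear Nakayama algebra with almost separate relations. Then it is derived equivalent to the path algebra of the quipu quiver D_{(n_0, n_1+1−n_0−l_0, n_2+1−n_1−l_1, …, n_r+1−n_{r−1}−l_{r−1}, n+1−n_r−l_r)}^{(l_0−2, l_1−2, …, l_r−2)}. -/

import Mathlib

open CategoryTheory

/-- A finite quiver: a finite vertex type, an arrow type, and source/target maps. -/
structure PreQuiver where
  V : Type
  A : Type
  [fintV : Fintype V]
  s : A → V
  t : A → V

attribute [instance] PreQuiver.fintV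

/-- The defining relations presenting the path algebra of the quiver `Q` over `k`, together
with the zero relations given by the paths (lists of composable arrows) in `R`.  The
generators are the trivial paths `Sum.inl v` (one for each vertex) and the arrows
`Sum.inr a`; multiplication of generators corresponds to concatenation of paths, so that the
resulting algebra has as a basis the paths of `Q` (not passing through a relation of `R`). -/
inductive PathAlgRel (k : Type) [Field k] (Q : PreQuiver) (R : Set (List Q.A)) :
    FreeAlgebra k (Q.V ⊕ Q.A) → FreeAlgebra k (Q.V ⊕ Q.A) → Prop
  | idem (v : Q.V) :
      PathAlgRel k Q R (FreeAlgebra.ι k (Sum.inl v) * FreeAlgebra.ι k (Sum.inl v))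
        (FreeAlgebra.ι k (Sum.inl v))
  | orth (v w : Q.V) (h : v ≠ w) :
      PathAlgRel k Q R (FreeAlgebra.ι k (Sum.inl v) * FreeAlgebra.ι k (Sum.inl w)) 0
  | unit :
      PathAlgRel k Q R (∑ v : Q.V, FreeAlgebra.ι k (Sum.inl v)) 1
  | source (a : Q.A) :
      PathAlgRel k Q R (FreeAlgebra.ι k (Sum.inl (Q.s a)) * FreeAlgebra.ι k (Sum.inr a))
        (FreeAlgebra.ι k (Sum.inr a))
  | target (a : Q.A) :
      PathAlgRel k Q R (FreeAlgebra.ι k (Sum.inr a) * FreeAlgebra.ι k (Sum.inl (Q.t a)))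
        (FreeAlgebra.ι k (Sum.inr a))
  | zeroRel (p : List Q.A) (hp : p ∈ R) :
      PathAlgRel k Q R ((p.map fun a => FreeAlgebra.ι k (Sum.inr a)).prod) 0

/-- The path algebra of the quiver `Q` over the field `k`, modulo the two-sided ideal
generated by the zero relations in `R`. -/
abbrev PathAlgebraRel (k : Type) [Field k] (Q : PreQuiver) (R : Set (List Q.A)) : Type :=
  RingQuot (PathAlgRel k Q R)

/-- The path algebra of the quiver `Q` over the field `k`. -/
abbrev PathAlgebra (k : Type) [Field k] (Q : PreQuiver) : Type :=
  PathAlgebraRel k Q ∅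

noncomputable instance (C : Type*) [Category C] [Abelian C] : HasDerivedCategory C :=
  HasDerivedCategory.standard C

/-- Two `k`-algebras are *derived equivalent* if there is a triangulated equivalence between
the derived categories of their categories of right modules (i.e. of left modules over the
opposite rings). -/
def DerivedEquivalent (k : Type) [Field k] (A : Type) [Ring A] [Algebra k A]
    (B : Type) [Ring B] [Algebra k B] : Prop :=
  ∃ (F : DerivedCategory (ModuleCat.{0} Aᵐᵒᵖ) ⥤ DerivedCategory (ModuleCat.{0} Bᵐᵒᵖ))
    (c : F.CommShift ℤ), haveI := c; (F.IsTriangulated ∧ F.IsEquivalence)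

/-- The linearly ordered quiver `A_n` of Dynkin type `A`, with vertices `1, …, n`
(realized as `Fin n`) and an arrow from each vertex to the next one. -/
def linQuiver (n : ℕ) : PreQuiver where
  V := Fin n
  A := Fin (n - 1)
  s := fun a => ⟨a.1, by have := a.2; omega⟩
  t := fun a => ⟨a.1 + 1, by have := a.2; omega⟩

/-- The path of length `l` in the quiver `A_n` starting at the (1-indexed) vertex `v`. -/
def linPath (n : ℕ) (v l : ℕ) : List (linQuiver n).A :=
  (List.range l).filterMap fun j =>
    if h : v - 1 + j < n - 1 then some ⟨v - 1 + j, h⟩ else none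

/-- The linear Nakayama algebra `A_{n,(n_0,…,n_{t-1})}^{(l_0,…,l_{t-1})}`: the quotient of
the path algebra of `A_n` over `k` by the two-sided ideal generated, for each `i`, by the
path of length `ls i` starting at the vertex `ns i`. -/
abbrev NakayamaAlgebra (k : Type) [Field k] (n t : ℕ) (ns ls : Fin t → ℕ) : Type :=
  PathAlgebraRel k (linQuiver n) {p | ∃ i : Fin t, p = linPath n (ns i) (ls i)}

/-- The hypotheses on the data of a linear Nakayama algebra
`A_{n,(n_0,…,n_{t-1})}^{(l_0,…,l_{t-1})}` with almost separate relations: each relation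
starts at a vertex `ns i ≥ 1` and has length `ls i ≥ 2`, the start vertices are strictly
increasing, the end vertices `ns i + ls i` are strictly increasing and at most `n`, and the
overlap of two relations is at most one arrow (`ns j ≥ ns i + ls i - 1` for `i < j`). -/
structure IsASNakayama (n t : ℕ) (ns ls : Fin t → ℕ) : Prop where
  one_le : ∀ i, 1 ≤ ns i
  two_le : ∀ i, 2 ≤ ls i
  start_lt : ∀ i j, i < j → ns i < ns j
  end_lt : ∀ i j, i < j → ns i + ls i < ns j + ls j
  end_le : ∀ i, ns i + ls i ≤ n
  almost_separate : ∀ i j, i < j → ns i + ls i ≤ ns j + 1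

/-- The position on the main string (`0`-indexed) of the vertex `b i` of a quipu: there are
`k 0` vertices before `b 0`, then `k 1` vertices between `b 0` and `b 1`, and so on. -/
def bpos (r : ℕ) (kk : Fin (r + 2) → ℕ) (i : Fin (r + 1)) : ℕ :=
  i.1 + ∑ j : Fin (r + 2), if j.1 ≤ i.1 then kk j else 0

/-- The quipu quiver with main string `0 → 1 → ⋯ → (L-1)` (linearly oriented from left to
right) and, at each main-string vertex `v`, a cord with `c v` vertices, linearly oriented
away from the main string. -/
def quipuQuiver (L : ℕ) (c : Fin L → ℕ) : PreQuiver where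
  V := Fin L ⊕ Σ v : Fin L, Fin (c v)
  A := Fin (L - 1) ⊕ Σ v : Fin L, Fin (c v)
  s := fun a =>
    match a with
    | Sum.inl i => Sum.inl ⟨i.1, by have := i.2; omega⟩
    | Sum.inr ⟨v, j⟩ =>
        if h : j.1 = 0 then Sum.inl v else Sum.inr ⟨v, ⟨j.1 - 1, by have := j.2; omega⟩⟩
  t := fun a =>
    match a with
    | Sum.inl i => Sum.inl ⟨i.1 + 1, by have := i.2; omega⟩
    | Sum.inr x => Sum.inr x

/-- The path of length `l` along the main string of a quipu quiver, starting at the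
main-string vertex `s`: it consists of the main-string arrows `s, s + 1, …, s + l - 1`. -/
def mainPath (L : ℕ) (c : Fin L → ℕ) (s l : ℕ) : List (quipuQuiver L c).A :=
  (List.range l).filterMap fun j =>
    if h : s + j < L - 1 then some (Sum.inl ⟨s + j, h⟩) else none

/-- The quipu quiver `D_{(k_0,…,k_{r+1})}^{(m_0,…,m_r)}`: the orientation of the quipu
`P_{(k_0,…,k_{r+1})}^{(m_0,…,m_r)}` in which the main string is linearly oriented from left
to right and each cord is linearly oriented away from the main string. -/
def kmQuiver (r : ℕ) (kk : Fin (r + 2) → ℕ) (mm : Fin (r + 1) → ℕ) : PreQuiver :=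
  quipuQuiver (r + 1 + ∑ i, kk i)
    (fun v => ∑ i : Fin (r + 1), if bpos r kk i = v.1 then mm i else 0)

/-- The quipu parameters `(k_0, …, k_{t+1})` associated to the data of a linear Nakayama
algebra `A_{n,(n_0,…,n_t)}^{(l_0,…,l_t)}`: `k_0 = n_0`, `k_i = n_i + 1 - n_{i-1} - l_{i-1}`
for `1 ≤ i ≤ t`, and `k_{t+1} = n + 1 - n_t - l_t`. -/
def nakK (n t : ℕ) (ns ls : Fin (t + 1) → ℕ) : Fin (t + 2) → ℕ := fun i =>
  if h0 : i.1 = 0 then ns 0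
  else if ht : i.1 ≤ t then
    ns ⟨i.1, by omega⟩ + 1 - ns ⟨i.1 - 1, by omega⟩ - ls ⟨i.1 - 1, by omega⟩
  else n + 1 - ns (Fin.last t) - ls (Fin.last t)


open CategoryTheory

section CommaAbelian
open Limits
universe v₁ v₂ v₃ u₁ u₂ u₃
variable {A : Type u₁} [Category.{v₁} A] [Abelian A]
  {B : Type u₂} [Category.{v₂} B] [Abelian B]
  {T : Type u₃} [Category.{v₃} T] [Abelian T]
  (L : A ⥤ T) (R : B ⥤ T) [L.Additive] [R.Additive]
  [PreservesFiniteColimits L] [PreservesFiniteLimits R]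

theorem comma_isIso_of {X Y : Comma L R} (f : X ⟶ Y)
    (h₁ : IsIso ((Comma.fst L R).map f)) (h₂ : IsIso ((Comma.snd L R).map f)) : IsIso f := by
  have h₁' : IsIso f.left := h₁
  have h₂' : IsIso f.right := h₂
  exact (Comma.isoMk (asIso f.left) (asIso f.right) (by simp)).isIso_hom

instance comma_fst_lim : PreservesFiniteLimits (Comma.fst L R) where
  preservesFiniteLimits J _ _ := ⟨fun {F} => 
    preservesLimit_of_preserves_limit_cone
      (Comma.coneOfPreservesIsLimit F (limit.isLimit _) (limit.isLimit _))
      (limit.isLimit (F ⋙ Comma.fst L R))⟩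

instance comma_snd_lim : PreservesFiniteLimits (Comma.snd L R) where
  preservesFiniteLimits J _ _ := ⟨fun {F} => 
    preservesLimit_of_preserves_limit_cone
      (Comma.coneOfPreservesIsLimit F (limit.isLimit _) (limit.isLimit _))
      (limit.isLimit (F ⋙ Comma.snd L R))⟩

instance comma_fst_colim : PreservesFiniteColimits (Comma.fst L R) where
  preservesFiniteColimits J _ _ := inferInstance

instance comma_snd_colim : PreservesFiniteColimits (Comma.snd L R) where
  preservesFiniteColimits J _ _ := inferInstance

theorem comma_coim {X Y : Comma L R} (f : X ⟶ Y) :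
    IsIso (Abelian.coimageImageComparison f) := by
  apply comma_isIso_of
  · have e := Abelian.PreservesCoimageImageComparison.iso (Comma.fst L R) f
    exact ((MorphismProperty.isomorphisms _).arrow_mk_iso_iff e).2 (by
      simp only [MorphismProperty.isomorphisms.iff]; infer_instance)
  · have e := Abelian.PreservesCoimageImageComparison.iso (Comma.snd L R) f
    exact ((MorphismProperty.isomorphisms _).arrow_mk_iso_iff e).2 (by
      simp only [MorphismProperty.isomorphisms.iff]; infer_instance)

noncomputable instance commaAbelian : Abelian (Comma L R) :=
  haveI : ∀ {X Y : Comma L R} (f : X ⟶ Y), IsIso (Abelian.coimageImageComparison f) :=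
    fun f => comma_coim L R f
  Abelian.ofCoimageImageComparisonIsIso


end CommaAbelian

set_option linter.unusedSectionVars false
set_option linter.unusedVariables false
open CategoryTheory

section CommaExact
open Limits ZeroObject
universe v₁ v₂ v₃ v₄ u₁ u₂ u₃ u₄
variable {A : Type u₁} [Category.{v₁} A] [Abelian A]
  {B : Type u₂} [Category.{v₂} B] [Abelian B]
  {T : Type u₃} [Category.{v₃} T] [Abelian T]
  {C : Type u₄} [Category.{v₄} C] [Abelian C]

/-- Exact additive functor. -/
class Ex (F : A ⥤ B) : Prop where
  add : F.Additive
  lim : PreservesFiniteLimits F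
  colim : PreservesFiniteColimits F

instance (F : A ⥤ B) [h : Ex F] : F.Additive := h.add
instance (F : A ⥤ B) [h : Ex F] : PreservesFiniteLimits F := h.lim
instance (F : A ⥤ B) [h : Ex F] : PreservesFiniteColimits F := h.colim

theorem Ex.mk' (F : A ⥤ B) [h₁ : F.Additive] [h₂ : PreservesFiniteLimits F]
    [h₃ : PreservesFiniteColimits F] : Ex F := ⟨h₁, h₂, h₃⟩

instance : Ex (𝟭 A) := ⟨inferInstance, inferInstance, inferInstance⟩
instance (F : A ⥤ B) (G : B ⥤ T) [Ex F] [Ex G] : Ex (F ⋙ G) :=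
  ⟨inferInstance, comp_preservesFiniteLimits _ _, comp_preservesFiniteColimits _ _⟩

theorem Ex.of_iso {F G : A ⥤ B} (e : F ≅ G) [h : Ex F] : Ex G :=
  ⟨Functor.additive_of_iso e,
    ⟨fun _ _ _ => preservesLimitsOfShape_of_natIso e⟩,
    ⟨fun _ _ _ => preservesColimitsOfShape_of_natIso e⟩⟩

variable (L : A ⥤ T) (R : B ⥤ T) [Ex L] [Ex R]

instance : Ex (Comma.fst L R) := Ex.mk' _
instance : Ex (Comma.snd L R) := Ex.mk' _

theorem Ex.comma {L : A ⥤ T} {R : B ⥤ T} [Ex L] [Ex R] (F : C ⥤ Comma L R)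
    (h₁ : Ex (F ⋙ Comma.fst L R)) (h₂ : Ex (F ⋙ Comma.snd L R)) : Ex F where
  add := ⟨fun {X Y f g} => by
    ext
    · exact (F ⋙ Comma.fst L R).map_add
    · exact (F ⋙ Comma.snd L R).map_add⟩
  lim := ⟨fun J _ _ => ⟨fun {K} => ⟨fun {c} hc => ⟨Comma.fstSndJointlyReflectLimit
    (isLimitOfPreserves (F ⋙ Comma.fst L R) hc)
    (isLimitOfPreserves (F ⋙ Comma.snd L R) hc)⟩⟩⟩⟩
  colim := ⟨fun J _ _ => ⟨fun {K} => ⟨fun {c} hc => ⟨Comma.fstSndJointlyReflectColimit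
    (isColimitOfPreserves (F ⋙ Comma.fst L R) hc)
    (isColimitOfPreserves (F ⋙ Comma.snd L R) hc)⟩⟩⟩⟩

/-- the zero functor is exact -/
noncomputable def zeroF (A : Type u₁) [Category.{v₁} A] [Abelian A] (B : Type u₂) [Category.{v₂} B]
    [Abelian B] : A ⥤ B := (Functor.const A).obj (0 : B)

theorem zeroF_isZero (X : A) : IsZero ((zeroF A B).obj X) := isZero_zero B

theorem Ex.zero (F : A ⥤ B) (h : ∀ X, IsZero (F.obj X)) : Ex F := by
  have e : ∀ (G : A ⥤ B) (hG : ∀ X, IsZero (G.obj X)), G.Additive := fun G hG =>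
    ⟨fun {X Y f g} => (hG X).eq_of_src _ _⟩
  have := e F h
  refine ⟨inferInstance, ?_, ?_⟩
  · refine ⟨fun J _ _ => ⟨fun {K} => ⟨fun {c} hc => ⟨?_⟩⟩⟩⟩
    exact { lift := fun s => 0
            fac := fun s j => (h _).eq_of_tgt _ _
            uniq := fun s m hm => (h _).eq_of_tgt _ _ }
  · refine ⟨fun J _ _ => ⟨fun {K} => ⟨fun {c} hc => ⟨?_⟩⟩⟩⟩
    exact { desc := fun s => 0
            fac := fun s j => (h _).eq_of_src _ _
            uniq := fun s m hm => (h _).eq_of_src _ _ }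
end CommaExact

section Recoll
open Limits ZeroObject
universe v₁ v₂ u₁ u₂
variable {X : Type u₁} [Category.{v₁} X] [Abelian X]
  {Y : Type u₂} [Category.{v₂} Y] [Abelian Y] (H : Y ⥤ X) [Ex H]

/-! Functors for `Comma (𝟭 X) H` (objects `M ⟶ H R`). -/

noncomputable def cI : X ⥤ Comma (𝟭 X) H where
  obj M := { left := M, right := 0, hom := 0 }
  map f := { left := f, right := 0, w := by simp }

noncomputable def cJ : Y ⥤ Comma (𝟭 X) H where
  obj R := { left := (0 : X), right := R, hom := 0 }
  map f := { left := (0 : (0 : X) ⟶ 0), right := f, w := by simp }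

def cJ' : Y ⥤ Comma (𝟭 X) H where
  obj R := { left := H.obj R, right := R, hom := 𝟙 _ }
  map f := { left := H.map f, right := f, w := by simp }

instance : Ex (cI H) := Ex.comma _ (inferInstanceAs (Ex (𝟭 X)))
  (Ex.zero _ fun _ => isZero_zero Y)
instance : Ex (cJ H) := Ex.comma _ (Ex.zero _ fun _ => isZero_zero X) (inferInstanceAs (Ex (𝟭 Y)))
instance : Ex (cJ' H) := Ex.comma _ (inferInstanceAs (Ex H)) (inferInstanceAs (Ex (𝟭 Y)))

noncomputable def adjPI : Comma.fst (𝟭 X) H ⊣ cI H := Adjunction.mkOfHomEquiv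
  { homEquiv := fun Z M =>
      { toFun := fun f => { left := f, right := 0, w := (H.map_isZero (isZero_zero Y)).eq_of_tgt _ _ }
        invFun := fun g => g.left
        left_inv := fun f => rfl
        right_inv := fun g => by
          ext
          · rfl
          · exact (isZero_zero Y).eq_of_tgt _ _ }
    homEquiv_naturality_left_symm := fun _ _ => rfl
    homEquiv_naturality_right := fun _ _ => by
      ext
      · rfl
      · exact (isZero_zero Y).eq_of_tgt _ _ }

noncomputable def adjJQ : cJ H ⊣ Comma.snd (𝟭 X) H := Adjunction.mkOfHomEquiv
  { homEquiv := fun R Z =>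
      { toFun := fun f => f.right
        invFun := fun g => { left := (0 : (0 : X) ⟶ _), right := g, w := by simp [cJ] }
        left_inv := fun g => by
          ext
          · exact (isZero_zero X).eq_of_src _ _
          · rfl
        right_inv := fun f => rfl }
    homEquiv_naturality_left_symm := fun _ _ => by
      ext
      · exact (isZero_zero X).eq_of_src _ _
      · rfl
    homEquiv_naturality_right := fun _ _ => rfl }

def adjQJ' : Comma.snd (𝟭 X) H ⊣ cJ' H := Adjunction.mkOfHomEquiv
  { homEquiv := fun Z R =>
      { toFun := fun f => { left := Z.hom ≫ H.map f, right := f, w := by simp [cJ'] }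
        invFun := fun g => g.right
        left_inv := fun f => rfl
        right_inv := fun g => by
          ext
          · have := g.w
            simp [cJ'] at this ⊢
            exact this.symm
          · rfl }
    homEquiv_naturality_left_symm := fun _ _ => rfl
    homEquiv_naturality_right := fun _ _ => by
      ext
      · exact ((congrArg _ (H.map_comp _ _)).trans (Category.assoc _ _ _).symm)
      · rfl }

/-! Functors for `Comma H (𝟭 X)` (objects `H R ⟶ N`). -/

noncomputable def dI : X ⥤ Comma H (𝟭 X) where
  obj M := { left := 0, right := M, hom := 0 }
  map f := { left := 0, right := f, w := by simp }

def dJ : Y ⥤ Comma H (𝟭 X) where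
  obj R := { left := R, right := H.obj R, hom := 𝟙 _ }
  map f := { left := f, right := H.map f, w := by simp }

instance : Ex (dI H) := Ex.comma _ 
  (Ex.zero _ fun _ => isZero_zero Y) (inferInstanceAs (Ex (𝟭 X)))
instance : Ex (dJ H) := Ex.comma _ (inferInstanceAs (Ex (𝟭 Y))) (inferInstanceAs (Ex H))

theorem isZero_H {R : Y} (h : IsZero R) : IsZero (H.obj R) := H.map_isZero h

noncomputable def adjdIP : dI H ⊣ Comma.snd H (𝟭 X) := Adjunction.mkOfHomEquiv
  { homEquiv := fun M Z =>
      { toFun := fun g => g.right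
        invFun := fun f => { left := (0 : (0 : Y) ⟶ _), right := f, w := by simp [dI] }
        left_inv := fun g => by
          ext
          · exact (isZero_zero Y).eq_of_src _ _
          · rfl
        right_inv := fun f => rfl }
    homEquiv_naturality_left_symm := fun _ _ => by
      ext
      · exact (isZero_zero Y).eq_of_src _ _
      · rfl
    homEquiv_naturality_right := fun _ _ => rfl }

def adjdJQ : dJ H ⊣ Comma.fst H (𝟭 X) := Adjunction.mkOfHomEquiv
  { homEquiv := fun R Z =>
      { toFun := fun f => f.left
        invFun := fun g => { left := g, right := H.map g ≫ Z.hom, w := by simp [dJ] }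
        left_inv := fun g => by
          ext
          · rfl
          · have := g.w
            simp [dJ] at this ⊢
            exact this
        right_inv := fun f => rfl }
    homEquiv_naturality_left_symm := fun _ _ => by
      ext
      · rfl
      · exact ((congrArg (· ≫ _) (H.map_comp _ _)).trans (Category.assoc _ _ _))
    homEquiv_naturality_right := fun _ _ => rfl }

/-- `M ↦ (M = M, (0, M))` in `Comma (𝟭 X) (Comma.snd H (𝟭 X))`, the left adjoint of the first
projection. -/
noncomputable def adjL : (dI H ⋙ cJ' (Comma.snd H (𝟭 X))) ⊣ Comma.fst (𝟭 X) (Comma.snd H (𝟭 X)) :=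
  Adjunction.mkOfHomEquiv
  { homEquiv := fun M Z =>
      { toFun := fun g => g.left
        invFun := fun f => 
          { left := f
            right := { left := (0 : (0 : Y) ⟶ _), right := f ≫ Z.hom, w := (H.map_isZero (isZero_zero Y)).eq_of_src _ _ }
            w := by simp [dI, cJ'] }
        left_inv := fun g => by
          ext
          · rfl
          · exact (isZero_zero Y).eq_of_src _ _
          · have := g.w
            simp [dI, cJ'] at this ⊢
            exact this
        right_inv := fun f => rfl }
    homEquiv_naturality_left_symm := fun _ _ => by
      ext
      · rfl
      · exact (isZero_zero Y).eq_of_src _ _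
      · exact Category.assoc _ _ _
    homEquiv_naturality_right := fun _ _ => rfl }

/-- `(M ⟶ H R) ↦ (M ⟶ H R, (R, H R = H R))` -/
def cT : Comma (𝟭 X) H ⥤ Comma (𝟭 X) (Comma.snd H (𝟭 X)) where
  obj Z := { left := Z.left, right := (dJ H).obj Z.right, hom := Z.hom }
  map f := { left := f.left, right := (dJ H).map f.right, w := f.w }

instance : Ex (cT H) := Ex.comma _ (inferInstanceAs (Ex (Comma.fst (𝟭 X) H)))
  (inferInstanceAs (Ex (Comma.snd (𝟭 X) H ⋙ dJ H)))

noncomputable def cTI : cI H ⋙ cT H ≅ cI (Comma.snd H (𝟭 X)) :=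
  NatIso.ofComponents (fun M => Comma.isoMk (Iso.refl _)
    (((dJ H).map_isZero (isZero_zero Y)).iso (isZero_zero _)) (by
      exact (Functor.map_isZero _ (isZero_zero _)).eq_of_tgt _ _))
    (fun f => by
      ext : 1
      · simp [cI, cT]
      · exact (isZero_zero _).eq_of_tgt _ _)

noncomputable def cTJ : cJ H ⋙ cT H ≅ dJ H ⋙ cJ (Comma.snd H (𝟭 X)) :=
  NatIso.ofComponents (fun M => Iso.refl _) (fun f => (Category.comp_id _).trans (Category.id_comp _).symm)

noncomputable def cTJ' : cJ' H ⋙ cT H ≅ dJ H ⋙ cJ' (Comma.snd H (𝟭 X)) :=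
  NatIso.ofComponents (fun M => Iso.refl _) (fun f => (Category.comp_id _).trans (Category.id_comp _).symm)

end Recoll

set_option linter.unusedSectionVars false
set_option linter.unusedVariables false
open CategoryTheory

section Derived
open Limits ZeroObject
universe v₁ v₂ v₃ u₁ u₂ u₃
variable {A : Type u₁} [Category.{v₁} A] [Abelian A]
  {B : Type u₂} [Category.{v₂} B] [Abelian B]
  {T : Type u₃} [Category.{v₃} T] [Abelian T]

noncomputable abbrev Dm (F : A ⥤ B) [Ex F] : DerivedCategory A ⥤ DerivedCategory B :=
  F.mapDerivedCategory

noncomputable abbrev Cm (F : A ⥤ B) [Ex F] : CochainComplex A ℤ ⥤ CochainComplex B ℤ :=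
  F.mapHomologicalComplex (ComplexShape.up ℤ)

noncomputable def DmIso {F G : A ⥤ B} [Ex F] [Ex G] (e : F ≅ G) : Dm F ≅ Dm G :=
  Localization.liftNatIso DerivedCategory.Q (HomologicalComplex.quasiIso A (ComplexShape.up ℤ))
    (Cm F ⋙ DerivedCategory.Q) (Cm G ⋙ DerivedCategory.Q) _ _
    (Functor.isoWhiskerRight (NatIso.mapHomologicalComplex e _) _)

noncomputable def DmId : Dm (𝟭 A) ≅ 𝟭 _ :=
  Localization.liftNatIso DerivedCategory.Q (HomologicalComplex.quasiIso A (ComplexShape.up ℤ))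
    (Cm (𝟭 A) ⋙ DerivedCategory.Q) (DerivedCategory.Q) _ _
    (Functor.isoWhiskerRight (Functor.mapHomologicalComplexIdIso A _) _ ≪≫
      Functor.leftUnitor _)

noncomputable def DmComp (F : A ⥤ B) (G : B ⥤ T) [Ex F] [Ex G] : Dm (F ⋙ G) ≅ Dm F ⋙ Dm G :=
  letI : Localization.Lifting DerivedCategory.Q
      (HomologicalComplex.quasiIso A (ComplexShape.up ℤ)) (Cm F ⋙ Cm G ⋙ DerivedCategory.Q)
      (Dm F ⋙ Dm G) := ⟨(Functor.associator _ _ _).symm ≪≫ 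
        Functor.isoWhiskerRight F.mapDerivedCategoryFactors _ ≪≫ Functor.associator _ _ _ ≪≫
        Functor.isoWhiskerLeft _ G.mapDerivedCategoryFactors⟩
  Localization.liftNatIso DerivedCategory.Q (HomologicalComplex.quasiIso A (ComplexShape.up ℤ))
    (Cm (F ⋙ G) ⋙ DerivedCategory.Q) (Cm F ⋙ Cm G ⋙ DerivedCategory.Q) _ _
    (Functor.isoWhiskerRight (Functor.mapHomologicalComplexCompIso (Iso.refl (F ⋙ G)) _).symm _ ≪≫
      Functor.associator _ _ _)

noncomputable def CmAdj {F : A ⥤ B} {G : B ⥤ A} [Ex F] [Ex G] (adj : F ⊣ G) : Cm F ⊣ Cm G :=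
  Adjunction.mkOfUnitCounit
  { unit := 
      { app := fun K => 
          { f := fun n => adj.unit.app _
            comm' := fun i j _ => (adj.unit.naturality _).symm }
        naturality := fun K L f => by ext n; exact adj.unit.naturality _ }
    counit :=
      { app := fun K => 
          { f := fun n => adj.counit.app _
            comm' := fun i j _ => (adj.counit.naturality _).symm }
        naturality := fun K L f => by ext n; exact adj.counit.naturality _ }
    left_triangle := by ext K n; simp; exact adj.left_triangle_components (K.X n)
    right_triangle := by ext K n; simp; exact adj.right_triangle_components (K.X n) }

noncomputable def DmAdj {F : A ⥤ B} {G : B ⥤ A} [Ex F] [Ex G] (adj : F ⊣ G) : Dm F ⊣ Dm G :=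
  letI : CatCommSq (Cm F) DerivedCategory.Q DerivedCategory.Q (Dm F) :=
    ⟨F.mapDerivedCategoryFactors.symm⟩
  letI : CatCommSq (Cm G) DerivedCategory.Q DerivedCategory.Q (Dm G) :=
    ⟨G.mapDerivedCategoryFactors.symm⟩
  (CmAdj adj).localization DerivedCategory.Q
    (HomologicalComplex.quasiIso A (ComplexShape.up ℤ)) DerivedCategory.Q
    (HomologicalComplex.quasiIso B (ComplexShape.up ℤ)) (Dm F) (Dm G)

theorem isZero_Q_iff (K : CochainComplex A ℤ) :
    IsZero (DerivedCategory.Q.obj K) ↔ ∀ n : ℤ, IsZero (K.homology n) := by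
  constructor
  · intro h n
    exact ((DerivedCategory.homologyFunctorFactors A n).symm.app K).isZero_iff.2
      (Functor.map_isZero (DerivedCategory.homologyFunctor A n) h)
  · intro h
    have : QuasiIso (0 : (0 : CochainComplex A ℤ) ⟶ K) := ⟨fun n => by
      rw [quasiIsoAt_iff_isIso_homologyMap]
      have h0 : IsZero ((0 : CochainComplex A ℤ).homology n) :=
        (HomologicalComplex.homologyFunctor A (ComplexShape.up ℤ) n).map_isZero (isZero_zero _)
      exact ⟨0, h0.eq_of_src _ _, (h n).eq_of_src _ _⟩⟩
    have : IsIso (DerivedCategory.Q.map (0 : (0 : CochainComplex A ℤ) ⟶ K)) := inferInstance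
    exact (asIso (DerivedCategory.Q.map (0 : (0 : CochainComplex A ℤ) ⟶ K))).isZero_iff.1
      (Functor.map_isZero _ (isZero_zero _))

noncomputable def CmHom (F : A ⥤ B) [Ex F] (K : CochainComplex A ℤ) (n : ℤ) :
    ((Cm F).obj K).homology n ≅ F.obj (K.homology n) :=
  (K.sc n).mapHomologyIso F

theorem isZero_Dm_iff (F : A ⥤ B) [Ex F] (K : CochainComplex A ℤ) :
    IsZero ((Dm F).obj (DerivedCategory.Q.obj K)) ↔ ∀ n : ℤ, IsZero (F.obj (K.homology n)) := by
  refine (F.mapDerivedCategoryFactors.app K).isZero_iff.trans ?_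
  refine (isZero_Q_iff _).trans (forall_congr' fun n => (CmHom F K n).isZero_iff)

theorem exists_Q (Z : DerivedCategory A) : ∃ K : CochainComplex A ℤ, 
    Nonempty (DerivedCategory.Q.obj K ≅ Z) :=
  ⟨_, ⟨DerivedCategory.Q.objObjPreimageIso Z⟩⟩

theorem Dm_zero (F : A ⥤ B) [Ex F] (h : ∀ X, IsZero (F.obj X)) (Z : DerivedCategory A) :
    IsZero ((Dm F).obj Z) := by
  obtain ⟨K, ⟨e⟩⟩ := exists_Q Z
  rw [← ((Dm F).mapIso e).isZero_iff, isZero_Dm_iff]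
  exact fun n => h _

theorem Dm_conserv (F : A ⥤ B) [Ex F] (G : A ⥤ T) [Ex G]
    (h : ∀ X, IsZero (F.obj X) → IsZero (G.obj X) → IsZero X) (Z : DerivedCategory A)
    (h₁ : IsZero ((Dm F).obj Z)) (h₂ : IsZero ((Dm G).obj Z)) : IsZero Z := by
  obtain ⟨K, ⟨e⟩⟩ := exists_Q Z
  rw [← ((Dm F).mapIso e).isZero_iff, isZero_Dm_iff] at h₁
  rw [← ((Dm G).mapIso e).isZero_iff, isZero_Dm_iff] at h₂
  rw [← e.isZero_iff, isZero_Q_iff]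
  exact fun n => h _ (h₁ n) (h₂ n)
end Derived

set_option linter.unusedSectionVars false
set_option linter.unusedVariables false
open CategoryTheory

section Tri
open Limits ZeroObject Pretriangulated
universe v₁ v₂ v₃ u₁ u₂ u₃
variable {C : Type u₁} [Category.{v₁} C] [HasZeroObject C] [Preadditive C]
  [HasShift C ℤ] [∀ n : ℤ, (shiftFunctor C n).Additive] [Pretriangulated C]
  {D : Type u₂} [Category.{v₂} D] [HasZeroObject D] [Preadditive D]
  [HasShift D ℤ] [∀ n : ℤ, (shiftFunctor D n).Additive] [Pretriangulated D]
  {E : Type u₃} [Category.{v₃} E] [HasZeroObject E] [Preadditive E]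
  [HasShift E ℤ] [∀ n : ℤ, (shiftFunctor E n).Additive] [Pretriangulated E]

/-- `F` is bijective on morphisms from `X` to `Y`. -/
def FF {C : Type u₁} [Category.{v₁} C] {D : Type u₂} [Category.{v₂} D] (F : C ⥤ D) (X Y : C) :
    Prop := Function.Bijective (F.map : (X ⟶ Y) → (F.obj X ⟶ F.obj Y))

theorem FF.of_iso_left {F : C ⥤ D} {X X' Y : C} (h : FF F X Y) (e : X ≅ X') : FF F X' Y := by
  constructor
  · intro f g hfg
    rw [← cancel_epi e.hom]
    apply h.1
    simp [hfg]
  · intro f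
    obtain ⟨g, hg⟩ := h.2 (F.map e.hom ≫ f)
    exact ⟨e.inv ≫ g, by simp [hg, ← F.map_comp_assoc]⟩

theorem FF.of_iso_right {F : C ⥤ D} {X Y Y' : C} (h : FF F X Y) (e : Y ≅ Y') : FF F X Y' := by
  constructor
  · intro f g hfg
    rw [← cancel_mono e.inv]
    apply h.1
    simp [hfg]
  · intro f
    obtain ⟨g, hg⟩ := h.2 (f ≫ F.map e.inv)
    exact ⟨g ≫ e.hom, by simp [hg, ← F.map_comp]⟩

theorem FF.of_natIso {F G : C ⥤ D} (e : F ≅ G) {X Y : C} (h : FF F X Y) : FF G X Y := by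
  constructor
  · intro f g hfg
    apply h.1
    rw [← cancel_mono (e.hom.app Y)]
    simp [hfg]
  · intro f
    obtain ⟨g, hg⟩ := h.2 (e.hom.app X ≫ f ≫ e.inv.app Y)
    refine ⟨g, ?_⟩
    rw [← cancel_epi (e.hom.app X)]
    simp [← NatTrans.naturality, hg]

theorem FF.comp {F : C ⥤ D} {G : D ⥤ E} {X Y : C} (h : FF F X Y)
    (h' : FF G (F.obj X) (F.obj Y)) : FF (F ⋙ G) X Y := by
  have := Function.Bijective.comp (g := (G.map : (F.obj X ⟶ F.obj Y) → _)) h' h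
  exact this

theorem FF.of_comp_right {F : C ⥤ D} {G : D ⥤ E} {X Y : C} (h : FF (F ⋙ G) X Y)
    (h' : FF G (F.obj X) (F.obj Y)) : FF F X Y :=
  (Function.Bijective.of_comp_iff' h' (F.map : (X ⟶ Y) → _)).1 h

theorem FF.of_comp_left {F : C ⥤ D} {G : D ⥤ E} {X Y : C} (h : FF (F ⋙ G) X Y)
    (h' : FF F X Y) : FF G (F.obj X) (F.obj Y) :=
  (Function.Bijective.of_comp_iff G.map h').1 h

theorem FF.of_subsingleton {F : C ⥤ D} [F.PreservesZeroMorphisms] {X Y : C}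
    (h : ∀ f : X ⟶ Y, f = 0)
    (h' : ∀ f : F.obj X ⟶ F.obj Y, f = 0) : FF F X Y :=
  ⟨fun f g _ => (h f).trans (h g).symm, fun f => ⟨0, by simp [h' f]⟩⟩

theorem FF.tri_left (F : C ⥤ D) [F.CommShift ℤ] [F.IsTriangulated] (T : Triangle C)
    (hT : T ∈ distTriang C) {Y : C} (h₁ : FF F T.obj₁ Y) (h₃ : FF F T.obj₃ Y)
    (h₁' : FF F (T.obj₁⟦(1 : ℤ)⟧) Y) (h₃' : FF F (T.obj₃⟦(-1 : ℤ)⟧) Y) : FF F T.obj₂ Y := by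
  constructor
  · refine (injective_iff_map_eq_zero (F.mapAddHom (X := T.obj₂) (Y := Y))).2 ?_
    intro α hα
    have hα : F.map α = 0 := hα
    have e₁ : T.mor₁ ≫ α = 0 := h₁.1 (by simp [hα])
    obtain ⟨β, hβ⟩ := Triangle.yoneda_exact₂ _ hT α e₁
    have h5 : F.map T.mor₂ ≫ F.map β = 0 := by rw [← F.map_comp, ← hβ, hα]
    obtain ⟨γ, hγ⟩ : ∃ γ : F.obj (T.obj₁⟦(1 : ℤ)⟧) ⟶ F.obj Y, F.map β = F.map T.mor₃ ≫ γ :=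
      Triangle.yoneda_exact₂ _ 
      (F.map_distinguished _ (rot_of_distTriang _ hT)) (F.map β) h5
    obtain ⟨δ, hδ⟩ := h₁'.2 γ
    have : β = T.mor₃ ≫ δ := h₃.1 (by
      rw [F.map_comp, hδ]; exact hγ)
    rw [hβ, this, comp_distTriang_mor_zero₂₃_assoc _ hT, zero_comp]
  · intro φ
    obtain ⟨ψ, hψ⟩ := h₁.2 (F.map T.mor₁ ≫ φ)
    let m : T.obj₃⟦(-1 : ℤ)⟧ ⟶ T.obj₁ := T.invRotate.mor₁
    have hz : m ≫ T.mor₁ = 0 := comp_distTriang_mor_zero₁₂ _ (inv_rot_of_distTriang _ hT)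
    have hz' : m ≫ ψ = 0 := h₃'.1 (by 
      rw [F.map_comp, hψ, ← Category.assoc, ← F.map_comp, hz]; simp)
    obtain ⟨χ, hχ⟩ : ∃ χ : T.obj₂ ⟶ Y, ψ = T.mor₁ ≫ χ := 
      Triangle.yoneda_exact₂ _ (inv_rot_of_distTriang _ hT) ψ hz'
    have h6 : F.map T.mor₁ ≫ (φ - F.map χ) = 0 := by
      rw [Preadditive.comp_sub, ← hψ, hχ, F.map_comp, sub_self]
    obtain ⟨ω, hω⟩ : ∃ ω : F.obj T.obj₃ ⟶ F.obj Y, φ - F.map χ = F.map T.mor₂ ≫ ω := 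
      Triangle.yoneda_exact₂ _ (F.map_distinguished _ hT) (φ - F.map χ) h6
    obtain ⟨ω', hω'⟩ := h₃.2 ω
    refine ⟨χ + T.mor₂ ≫ ω', ?_⟩
    rw [F.map_add, F.map_comp, hω', ← hω]; abel

theorem FF.tri_right (F : C ⥤ D) [F.CommShift ℤ] [F.IsTriangulated] (T : Triangle C)
    (hT : T ∈ distTriang C) {X : C} (h₁ : FF F X T.obj₁) (h₃ : FF F X T.obj₃)
    (h₁' : FF F X (T.obj₁⟦(1 : ℤ)⟧)) (h₃' : FF F X (T.obj₃⟦(-1 : ℤ)⟧)) : FF F X T.obj₂ := by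
  constructor
  · refine (injective_iff_map_eq_zero (F.mapAddHom (X := X) (Y := T.obj₂))).2 ?_
    intro α hα
    have hα : F.map α = 0 := hα
    have e₁ : α ≫ T.mor₂ = 0 := h₃.1 (by simp [hα])
    obtain ⟨β, hβ⟩ := Triangle.coyoneda_exact₂ _ hT α e₁
    let m : T.obj₃⟦(-1 : ℤ)⟧ ⟶ T.obj₁ := T.invRotate.mor₁
    have hz : m ≫ T.mor₁ = 0 := comp_distTriang_mor_zero₁₂ _ (inv_rot_of_distTriang _ hT)
    have h5 : F.map β ≫ F.map T.mor₁ = 0 := by rw [← F.map_comp, ← hβ, hα]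
    obtain ⟨γ, hγ⟩ : ∃ γ : F.obj X ⟶ F.obj (T.obj₃⟦(-1 : ℤ)⟧), F.map β = γ ≫ F.map m :=
      Triangle.coyoneda_exact₂ _ 
      (F.map_distinguished _ (inv_rot_of_distTriang _ hT)) (F.map β) h5
    obtain ⟨δ, hδ⟩ := h₃'.2 γ
    have : β = δ ≫ m := h₁.1 (by
      rw [F.map_comp, hδ]; exact hγ)
    rw [hβ, this, Category.assoc, hz, comp_zero]
  · intro φ
    obtain ⟨ψ, hψ⟩ := h₃.2 (φ ≫ F.map T.mor₂)
    have h7 : ψ ≫ T.mor₃ = 0 := h₁'.1 (by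
      rw [F.map_comp, hψ, Category.assoc, ← F.map_comp, comp_distTriang_mor_zero₂₃ _ hT]
      simp)
    obtain ⟨χ, hχ⟩ := Triangle.coyoneda_exact₃ _ hT ψ h7
    have h6 : (φ - F.map χ) ≫ F.map T.mor₂ = 0 := by
      rw [Preadditive.sub_comp, ← hψ, hχ, F.map_comp, sub_self]
    obtain ⟨ω, hω⟩ : ∃ ω : F.obj X ⟶ F.obj T.obj₁, φ - F.map χ = ω ≫ F.map T.mor₁ := 
      Triangle.coyoneda_exact₂ _ (F.map_distinguished _ hT) (φ - F.map χ) h6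
    obtain ⟨ω', hω'⟩ := h₁.2 ω
    refine ⟨χ + ω' ≫ T.mor₁, ?_⟩
    rw [F.map_add, F.map_comp, hω', ← hω]; abel

end Tri

set_option linter.unusedSectionVars false
set_option linter.unusedVariables false
open CategoryTheory

section Tri2
open Limits ZeroObject Pretriangulated
universe v₁ v₂ v₃ u₁ u₂ u₃
variable {C : Type u₁} [Category.{v₁} C] [HasZeroObject C] [Preadditive C]
  [HasShift C ℤ] [∀ n : ℤ, (shiftFunctor C n).Additive] [Pretriangulated C]
  {B : Type u₂} [Category.{v₂} B] [HasZeroObject B] [Preadditive B]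
  [HasShift B ℤ] [∀ n : ℤ, (shiftFunctor B n).Additive] [Pretriangulated B]
  {X : Type u₃} [Category.{v₃} X] [HasZeroObject X] [Preadditive X]
  [HasShift X ℤ] [∀ n : ℤ, (shiftFunctor X n).Additive] [Pretriangulated X]

theorem isIso_of_zeros {Z W : C} (f : Z ⟶ W) (hZ : IsZero Z) (hW : IsZero W) : IsIso f :=
  ⟨0, hZ.eq_of_src _ _, hW.eq_of_src _ _⟩

theorem isZero_map₃ (P : C ⥤ X) [P.CommShift ℤ] [P.IsTriangulated] (T : Triangle C)
    (hT : T ∈ distTriang C) (h : IsIso (P.map T.mor₁)) : IsZero (P.obj T.obj₃) :=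
  (Triangle.isZero₃_iff_isIso₁ _ (P.map_distinguished _ hT)).2 h

theorem isZero_map₁ (P : C ⥤ X) [P.CommShift ℤ] [P.IsTriangulated] (T : Triangle C)
    (hT : T ∈ distTriang C) (h : IsIso (P.map T.mor₂)) : IsZero (P.obj T.obj₁) :=
  (Triangle.isZero₁_iff_isIso₂ _ (P.map_distinguished _ hT)).2 h

theorem isIso_map₂ (P : C ⥤ X) [P.CommShift ℤ] [P.IsTriangulated] (T : Triangle C)
    (hT : T ∈ distTriang C) (h : IsZero (P.obj T.obj₁)) : IsIso (P.map T.mor₂) :=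
  (Triangle.isZero₁_iff_isIso₂ _ (P.map_distinguished _ hT)).1 h

theorem joint_iso (P : C ⥤ X) [P.CommShift ℤ] [P.IsTriangulated]
    (Q : C ⥤ B) [Q.CommShift ℤ] [Q.IsTriangulated]
    (hc : ∀ Z, IsZero (P.obj Z) → IsZero (Q.obj Z) → IsZero Z) {Z W : C} (f : Z ⟶ W)
    (h₁ : IsIso (P.map f)) (h₂ : IsIso (Q.map f)) : IsIso f := by
  obtain ⟨V, g, h, hT⟩ := distinguished_cocone_triangle f
  exact (Triangle.isZero₃_iff_isIso₁ _ hT).1 (hc _ (isZero_map₃ P _ hT h₁) (isZero_map₃ Q _ hT h₂))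

theorem FF.of_adj {L : B ⥤ C} {G : C ⥤ B} (adj : L ⊣ G) (e : L ⋙ G ≅ 𝟭 B) (R : B) (Z : C) :
    FF G (L.obj R) Z := by
  have := adj.isIso_unit_of_iso e
  have h1 : Function.Bijective (fun f : L.obj R ⟶ Z => adj.unit.app R ≫ G.map f) := by
    have h0 : (fun f : L.obj R ⟶ Z => adj.unit.app R ≫ G.map f) = adj.homEquiv R Z := by
      funext f
      exact (adj.homEquiv_unit _ _ _).symm
    rw [h0]
    exact (adj.homEquiv R Z).bijective
  have h2 : Function.Bijective (fun f : G.obj (L.obj R) ⟶ G.obj Z => adj.unit.app R ≫ f) :=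
    ⟨fun f g h => (cancel_epi _).1 h, fun f => ⟨inv (adj.unit.app R) ≫ f, by simp⟩⟩
  exact (Function.Bijective.of_comp_iff' h2 (G.map : (L.obj R ⟶ Z) → _)).1 h1

theorem FF.of_adjR {L : B ⥤ C} {G : C ⥤ B} (adj : L ⊣ G) (e : G ⋙ L ≅ 𝟭 C) (Z W : C) :
    FF G Z W := by
  have := adj.isIso_counit_of_iso e
  exact adj.fullyFaithfulROfIsIsoCounit.map_bijective Z W

theorem map_unit_iso {L : B ⥤ C} {G : C ⥤ B} (adj : L ⊣ G) (e : G ⋙ L ≅ 𝟭 C) (R : B) :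
    IsIso (L.map (adj.unit.app R)) := by
  have := adj.isIso_counit_of_iso e
  have h := adj.left_triangle_components R
  exact ⟨adj.counit.app (L.obj R), h, by
    rw [← cancel_mono (adj.counit.app (L.obj R)), Category.assoc, h]; simp⟩

theorem map_counit_iso {L : B ⥤ C} {G : C ⥤ B} (adj : L ⊣ G) (e : L ⋙ G ≅ 𝟭 B) (R : C) :
    IsIso (G.map (adj.counit.app R)) := by
  have := adj.isIso_unit_of_iso e
  have h := adj.right_triangle_components R
  exact ⟨adj.unit.app (G.obj R), by
    rw [← cancel_epi (adj.unit.app (G.obj R)), ← Category.assoc, h]; simp, h⟩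

theorem counit_left_iso {L : B ⥤ C} {G : C ⥤ B} (adj : L ⊣ G) (e : L ⋙ G ≅ 𝟭 B) (R : B) :
    IsIso (adj.counit.app (L.obj R)) := by
  have := adj.isIso_unit_of_iso e
  have h := adj.left_triangle_components R
  exact ⟨L.map (adj.unit.app R), by
    rw [← cancel_epi (L.map (adj.unit.app R)), ← Category.assoc, h]; simp, h⟩

theorem adj_zero {L : B ⥤ C} {G : C ⥤ B} (adj : L ⊣ G) {Z : B} {W : C} (h : IsZero (L.obj Z))
    (f : Z ⟶ G.obj W) : f = 0 := by
  apply (adj.homEquiv _ _).symm.injective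
  exact h.eq_of_src _ _

theorem adj_zero' {L : B ⥤ C} {G : C ⥤ B} (adj : L ⊣ G) {Z : B} {W : C} (h : IsZero (G.obj W))
    (f : L.obj Z ⟶ W) : f = 0 := by
  apply (adj.homEquiv _ _).injective
  exact h.eq_of_tgt _ _

theorem tri_iso₃ {U V W W' : C} (f : U ⟶ V) (g : V ⟶ W) (h : W ⟶ U⟦(1 : ℤ)⟧)
    (hT : Triangle.mk f g h ∈ distTriang C) (e : W' ≅ W) :
    Triangle.mk f (g ≫ e.inv) (e.hom ≫ h) ∈ distTriang C :=
  isomorphic_distinguished _ hT _ (Triangle.isoMk _ _ (Iso.refl U) (Iso.refl V) e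
      (by show f ≫ 𝟙 V = 𝟙 U ≫ f; simp) (by show (g ≫ e.inv) ≫ e.hom = 𝟙 V ≫ g; simp)
      (by show (e.hom ≫ h) ≫ (shiftFunctor C (1 : ℤ)).map (𝟙 U) = e.hom ≫ h; simp))

/-- Existence of a left adjoint `K` of `j`, computed as a cone. -/
theorem exists_cone (j : B ⥤ C) (q : C ⥤ B) (p : C ⥤ X) (l : X ⥤ C)
    [q.CommShift ℤ] [q.IsTriangulated] [p.CommShift ℤ] [p.IsTriangulated]
    [l.CommShift ℤ] [l.IsTriangulated]
    (adj : j ⊣ q) (e : j ⋙ q ≅ 𝟭 B) (adj' : l ⊣ p) (e' : l ⋙ p ≅ 𝟭 X)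
    (hpj : ∀ V, IsZero (p.obj (j.obj V)))
    (hc : ∀ Z, IsZero (p.obj Z) → IsZero (q.obj Z) → IsZero Z) :
    ∃ (K : C ⥤ B) (adjK : K ⊣ j), ∀ Z : C, ∃ h : j.obj (K.obj Z) ⟶ (l.obj (p.obj Z))⟦(1 : ℤ)⟧,
      Triangle.mk (adj'.counit.app Z) (adjK.unit.app Z) h ∈ distTriang C := by
  have key : ∀ Z : C, ∃ (V : B) (g : Z ⟶ j.obj V) (h : j.obj V ⟶ (l.obj (p.obj Z))⟦(1 : ℤ)⟧),
      Triangle.mk (adj'.counit.app Z) g h ∈ distTriang C := by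
    intro Z
    obtain ⟨W, g, h, hT⟩ := distinguished_cocone_triangle (adj'.counit.app Z)
    have hW : IsZero (p.obj W) := isZero_map₃ p _ hT (map_counit_iso adj' e' Z)
    have : IsIso (adj.counit.app W) := joint_iso p q hc _
      (isIso_of_zeros _ (hpj _) hW) (map_counit_iso adj e W)
    exact ⟨q.obj W, _, _, tri_iso₃ _ _ _ hT (asIso (adj.counit.app W))⟩
  choose V g h hT using key
  have ff := FF.of_adj adj e
  have bij : ∀ (Z : C) (U : B), Function.Bijective (fun f : V Z ⟶ U => g Z ≫ j.map f) := by
    intro Z U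
    have := adj.isIso_unit_of_iso e
    have h1 : Function.Bijective (j.map : (V Z ⟶ U) → _) :=
      adj.fullyFaithfulLOfIsIsoUnit.map_bijective _ _
    have hz : ∀ f : l.obj (p.obj Z) ⟶ j.obj U, f = 0 := fun f => adj_zero' adj' (hpj U) f
    have hz' : ∀ f : (l.obj (p.obj Z))⟦(1 : ℤ)⟧ ⟶ j.obj U, f = 0 := fun f => by
      rw [← cancel_epi ((l.commShiftIso (1 : ℤ)).hom.app (p.obj Z)), comp_zero]
      exact adj_zero' adj' (hpj U) _
    have h2 : Function.Bijective (fun f : j.obj (V Z) ⟶ j.obj U => g Z ≫ f) := by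
      constructor
      · intro a b hab
        have hab : g Z ≫ (a - b) = 0 := by
          rw [Preadditive.comp_sub, sub_eq_zero]; exact hab
        obtain ⟨c, hc⟩ : ∃ c : (l.obj (p.obj Z))⟦(1 : ℤ)⟧ ⟶ j.obj U, a - b = h Z ≫ c := 
          Triangle.yoneda_exact₃ _ (hT Z) (a - b) hab
        rw [hz' c, comp_zero, sub_eq_zero] at hc
        exact hc
      · intro a
        obtain ⟨c, hc⟩ := Triangle.yoneda_exact₂ _ (hT Z) a (hz _)
        exact ⟨c, hc.symm⟩
    exact h2.comp h1
  let E : ∀ Z U, (V Z ⟶ U) ≃ (Z ⟶ j.obj U) := fun Z U => Equiv.ofBijective _ (bij Z U)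
  refine ⟨Adjunction.leftAdjointOfEquiv E (fun Z U U' a b => by simp [E]),
    Adjunction.adjunctionOfEquivLeft E (fun Z U U' a b => by simp [E]), fun Z => ⟨h Z, ?_⟩⟩
  have : (Adjunction.adjunctionOfEquivLeft E (fun Z U U' a b => by simp [E])).unit.app Z = g Z := by
    refine (Adjunction.homEquiv_id _ _).symm.trans ?_
    simp only [Adjunction.adjunctionOfEquivLeft, Adjunction.mkOfHomEquiv_homEquiv]
    exact (congrArg (g Z ≫ ·) (j.map_id _)).trans (Category.comp_id _)
  rw [this]
  exact hT Z

end Tri2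

set_option linter.unusedSectionVars false
set_option linter.unusedVariables false
open CategoryTheory

section Tri3
open Limits ZeroObject Pretriangulated
universe v₁ v₂ v₃ v₄ v₅ u₁ u₂ u₃ u₄ u₅
variable {C : Type u₁} [Category.{v₁} C] [HasZeroObject C] [Preadditive C]
  [HasShift C ℤ] [∀ n : ℤ, (shiftFunctor C n).Additive] [Pretriangulated C]
  {B : Type u₂} [Category.{v₂} B] [HasZeroObject B] [Preadditive B]
  [HasShift B ℤ] [∀ n : ℤ, (shiftFunctor B n).Additive] [Pretriangulated B]
  {X : Type u₃} [Category.{v₃} X] [HasZeroObject X] [Preadditive X]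
  [HasShift X ℤ] [∀ n : ℤ, (shiftFunctor X n).Additive] [Pretriangulated X]
  {A : Type u₄} [Category.{v₄} A] [HasZeroObject A] [Preadditive A]
  [HasShift A ℤ] [∀ n : ℤ, (shiftFunctor A n).Additive] [Pretriangulated A]
  {R : Type u₅} [Category.{v₅} R] [HasZeroObject R] [Preadditive R]
  [HasShift R ℤ] [∀ n : ℤ, (shiftFunctor R n).Additive] [Pretriangulated R]

theorem FF.cone {j : B ⥤ C} {q : C ⥤ B} {p : C ⥤ X} {l : X ⥤ C} {i' : X ⥤ B} {j3 : B ⥤ C}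
    [l.CommShift ℤ] {K : C ⥤ B} (adjK : K ⊣ j) (adj' : l ⊣ p)
    (tri : ∀ Z : C, ∃ h : j.obj (K.obj Z) ⟶ (l.obj (p.obj Z))⟦(1 : ℤ)⟧,
      Triangle.mk (adj'.counit.app Z) (adjK.unit.app Z) h ∈ distTriang C)
    (adj3 : q ⊣ j3) (el : l ≅ i' ⋙ j3) (Z W : C) (hZ : IsZero (q.obj Z)) : FF K Z W := by
  obtain ⟨h, hT⟩ := tri W
  have v : ∀ (Y : X) (f : Z ⟶ l.obj Y), f = 0 := fun Y f => by
    rw [← cancel_mono (el.hom.app Y), zero_comp]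
    exact adj_zero adj3 hZ _
  have v' : ∀ (Y : X) (f : Z ⟶ (l.obj Y)⟦(1 : ℤ)⟧), f = 0 := fun Y f => by
    rw [← cancel_mono ((l.commShiftIso (1 : ℤ)).inv.app Y), zero_comp]
    exact v _ _
  have h2 : Function.Bijective (fun f : Z ⟶ W => f ≫ adjK.unit.app W) := by
    constructor
    · intro a b hab
      have hab : (a - b) ≫ adjK.unit.app W = 0 := by
        rw [Preadditive.sub_comp, sub_eq_zero]; exact hab
      obtain ⟨c, hc⟩ := Triangle.coyoneda_exact₂ _ hT (a - b) hab
      rw [v _ c] at hc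
      exact sub_eq_zero.1 (hc.trans zero_comp)
    · intro a
      obtain ⟨c, hc⟩ := Triangle.coyoneda_exact₃ _ hT a (v' _ _)
      exact ⟨c, hc.symm⟩
  have h3 : (fun f : Z ⟶ W => f ≫ adjK.unit.app W) = 
      (adjK.homEquiv Z (K.obj W)) ∘ (K.map : (Z ⟶ W) → _) := by
    funext f
    simp [Adjunction.homEquiv_unit]
  rw [h3] at h2
  exact (Function.Bijective.of_comp_iff' (Equiv.bijective _) (K.map : (Z ⟶ W) → _)).1 h2

variable
  (i : X ⥤ A) (p : A ⥤ X) (q : A ⥤ R) (j j' : R ⥤ A)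
  (i2 : X ⥤ C) (p2 : C ⥤ X) (q2 : C ⥤ B) (j2 j3 : B ⥤ C) (l : X ⥤ C)
  (i1 : X ⥤ B) (p1 : B ⥤ X) (q1 : B ⥤ R) (j1 : R ⥤ B) (T : A ⥤ C)
  [i.CommShift ℤ] [i.IsTriangulated] [p.CommShift ℤ] [p.IsTriangulated]
  [q.CommShift ℤ] [q.IsTriangulated] [j.CommShift ℤ] [j.IsTriangulated]
  [j'.CommShift ℤ] [j'.IsTriangulated]
  [i2.CommShift ℤ] [i2.IsTriangulated] [p2.CommShift ℤ] [p2.IsTriangulated]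
  [q2.CommShift ℤ] [q2.IsTriangulated] [j2.CommShift ℤ] [j2.IsTriangulated]
  [j3.CommShift ℤ] [j3.IsTriangulated] [l.CommShift ℤ] [l.IsTriangulated]
  [i1.CommShift ℤ] [i1.IsTriangulated] [p1.CommShift ℤ] [p1.IsTriangulated]
  [q1.CommShift ℤ] [q1.IsTriangulated] [j1.CommShift ℤ] [j1.IsTriangulated]
  [T.CommShift ℤ] [T.IsTriangulated]

theorem flip_abstract 
    (pi : p ⊣ i) (jq : j ⊣ q) (qj : q ⊣ j') (eip : i ⋙ p ≅ 𝟭 X) (ejq : j ⋙ q ≅ 𝟭 R)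
    (ejq' : j' ⋙ q ≅ 𝟭 R) (hqi : ∀ M, IsZero (q.obj (i.obj M)))
    (hcA : ∀ Z, IsZero (p.obj Z) → IsZero (q.obj Z) → IsZero Z)
    (pi2 : p2 ⊣ i2) (jq2 : j2 ⊣ q2) (qj2 : q2 ⊣ j3) (eip2 : i2 ⋙ p2 ≅ 𝟭 X)
    (ejq2 : j2 ⋙ q2 ≅ 𝟭 B) (ejq3 : j3 ⋙ q2 ≅ 𝟭 B) (hqi2 : ∀ M, IsZero (q2.obj (i2.obj M)))
    (hpj2 : ∀ V, IsZero (p2.obj (j2.obj V)))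
    (hcC : ∀ Z, IsZero (p2.obj Z) → IsZero (q2.obj Z) → IsZero Z)
    (lp : l ⊣ p2) (elp : l ⋙ p2 ≅ 𝟭 X) (el : l ≅ i1 ⋙ j3)
    (ip1 : i1 ⊣ p1) (eip1 : i1 ⋙ p1 ≅ 𝟭 X) (jq1 : j1 ⊣ q1) (ejq1 : j1 ⋙ q1 ≅ 𝟭 R)
    (hqi1 : ∀ M, IsZero (q1.obj (i1.obj M)))
    (hcB : ∀ Z, IsZero (p1.obj Z) → IsZero (q1.obj Z) → IsZero Z)
    (eTi : i ⋙ T ≅ i2) (eTj : j ⋙ T ≅ j1 ⋙ j2) (eTj' : j' ⋙ T ≅ j1 ⋙ j3)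
    (eTq : T ⋙ q2 ≅ q ⋙ j1) :
    ∃ (F : A ⥤ B) (c : F.CommShift ℤ), F.IsTriangulated ∧ F.IsEquivalence := by
  obtain ⟨K, adjK, tri⟩ := exists_cone j2 q2 p2 l jq2 ejq2 lp elp hpj2 hcC
  let _ : K.CommShift ℤ := adjK.leftAdjointCommShift ℤ
  have : adjK.CommShift ℤ := adjK.commShift_of_rightAdjoint ℤ
  have : K.IsTriangulated := adjK.isTriangulated_leftAdjoint
  have := adjK
  have hj2ff : ∀ V W, FF j2 V W := fun V W => by
    have := jq2.isIso_unit_of_iso ejq2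
    exact jq2.fullyFaithfulLOfIsIsoUnit.map_bijective _ _
  have : j2.Full := ⟨fun f => (hj2ff _ _).2 f⟩
  have : j2.Faithful := ⟨fun h => (hj2ff _ _).1 h⟩
  have eK : j2 ⋙ K ≅ 𝟭 B := asIso adjK.counit
  -- zero statements
  have hql : ∀ Y, IsZero (q1.obj (q2.obj (l.obj Y))) := fun Y =>
    (q1.mapIso ((q2.mapIso (el.app Y)) ≪≫ ejq3.app _)).isZero_iff.2 (hqi1 Y)
  -- q1 K = q1 q2
  have eKq : K ⋙ q1 ≅ q2 ⋙ q1 := by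
    have : IsIso (Functor.whiskerRight adjK.unit (q2 ⋙ q1)) := by
      rw [NatTrans.isIso_iff_isIso_app]
      intro Z
      obtain ⟨h, hT⟩ := tri Z
      exact isIso_map₂ (q2 ⋙ q1) _ hT (hql _)
    exact (Functor.isoWhiskerLeft K (Functor.leftUnitor _).symm ≪≫ 
      Functor.isoWhiskerLeft K (Functor.isoWhiskerRight ejq2.symm q1)) ≪≫ 
      (asIso (Functor.whiskerRight adjK.unit (q2 ⋙ q1))).symm
  have eFq : (T ⋙ K) ⋙ q1 ≅ q :=
    Functor.associator _ _ _ ≪≫ Functor.isoWhiskerLeft T eKq ≪≫ (Functor.associator _ _ _).symm ≪≫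
      Functor.isoWhiskerRight eTq q1 ≪≫ Functor.associator _ _ _ ≪≫ Functor.isoWhiskerLeft q ejq1 ≪≫
      Functor.rightUnitor _
  have Kff : ∀ Z W, IsZero (q2.obj Z) → FF K Z W := fun Z W hZ =>
    FF.cone adjK lp tri qj2 el Z W hZ
  have hTi : ∀ M, IsZero (q2.obj (T.obj (i.obj M))) := fun M =>
    (q2.mapIso (eTi.app M)).isZero_iff.2 (hqi2 M)
  -- resolutions in A
  have resA : ∀ Z, IsZero (q.obj Z) → IsIso (pi.unit.app Z) := fun Z hZ =>
    joint_iso p q hcA _ (map_unit_iso pi eip Z) (isIso_of_zeros _ hZ (hqi _))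
  have resC : ∀ Z, IsZero (q2.obj Z) → IsIso (pi2.unit.app Z) := fun Z hZ =>
    joint_iso p2 q2 hcC _ (map_unit_iso pi2 eip2 Z) (isIso_of_zeros _ hZ (hqi2 _))
  have resB : ∀ Z, IsZero (q1.obj Z) → IsIso (ip1.counit.app Z) := fun Z hZ =>
    joint_iso p1 q1 hcB _ (map_counit_iso ip1 eip1 Z) (isIso_of_zeros _ (hqi1 _) hZ)
  -- fully faithful on the pieces
  have f1 : ∀ S Z, FF (T ⋙ K) (j.obj S) Z := fun S Z => by
    have a : FF ((T ⋙ K) ⋙ q1) (j.obj S) Z := FF.of_natIso eFq.symm (FF.of_adj jq ejq S Z)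
    refine FF.of_comp_right a ?_
    refine FF.of_iso_left (FF.of_adj jq1 ejq1 S _) ?_
    exact (eK.app (j1.obj S)).symm ≪≫ K.mapIso (eTj.app S).symm
  have f2 : ∀ M N, FF T (i.obj M) (i.obj N) := fun M N =>
    FF.of_comp_left (FF.of_natIso eTi.symm (FF.of_adjR pi2 eip2 M N)) (FF.of_adjR pi eip M N)
  have f3 : ∀ M S, FF T (i.obj M) (j'.obj S) := fun M S =>
    FF.of_subsingleton (fun f => adj_zero qj (hqi M) f) (fun f => by
      rw [← cancel_mono (eTj'.hom.app S), zero_comp]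
      exact adj_zero qj2 (hTi M) _)
  have f4 : ∀ M Z, FF T (i.obj M) Z := fun M Z => by
    obtain ⟨W, f, h, hT⟩ := distinguished_cocone_triangle₁ (qj.unit.app Z)
    have hW : IsZero (q.obj W) := isZero_map₁ q _ hT (map_unit_iso qj ejq' Z)
    have := resA W hW
    have eW : W ≅ i.obj (p.obj W) := asIso (pi.unit.app W)
    refine FF.tri_right T _ hT (FF.of_iso_right (f2 M _) eW.symm) (f3 M _) 
      (FF.of_iso_right (f2 M _) ((i.commShiftIso (1 : ℤ)).app (p.obj W) ≪≫ 
        (shiftFunctor A (1 : ℤ)).mapIso eW.symm))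
      (FF.of_iso_right (f3 M _) ((j'.commShiftIso (-1 : ℤ)).app (q.obj Z)))
  have f5 : ∀ M Z, FF (T ⋙ K) (i.obj M) Z := fun M Z => FF.comp (f4 M Z) (Kff _ _ (hTi M))
  have f6 : ∀ Y Z, FF (T ⋙ K) Y Z := fun Y Z => by
    obtain ⟨W, g, h, hT⟩ := distinguished_cocone_triangle (jq.counit.app Y)
    have hW : IsZero (q.obj W) := isZero_map₃ q _ hT (map_counit_iso jq ejq Y)
    have := resA W hW
    have eW : W ≅ i.obj (p.obj W) := asIso (pi.unit.app W)
    refine FF.tri_left (T ⋙ K) _ hT (f1 _ Z) (FF.of_iso_left (f5 _ Z) eW.symm)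
      (FF.of_iso_left (f1 _ Z) ((j.commShiftIso (1 : ℤ)).app (q.obj Y)))
      (FF.of_iso_left (f5 _ Z) ((i.commShiftIso (-1 : ℤ)).app (p.obj W) ≪≫ 
        (shiftFunctor A (-1 : ℤ)).mapIso eW.symm))
  have : (T ⋙ K).Full := ⟨fun f => (f6 _ _).2 f⟩
  have : (T ⋙ K).Faithful := ⟨fun h => (f6 _ _).1 h⟩
  have s1 : ∀ S, (T ⋙ K).essImage (j1.obj S) := fun S => 
    ⟨j.obj S, ⟨K.mapIso (eTj.app S) ≪≫ eK.app (j1.obj S)⟩⟩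
  have s2 : ∀ N, (T ⋙ K).essImage (i1.obj N) := fun N => by
    obtain ⟨h, hT⟩ := tri (l.obj N)
    have z1 : IsZero (j2.obj (K.obj (l.obj N))) := 
      (Triangle.isZero₃_iff_isIso₁ _ hT).2 (counit_left_iso lp elp N)
    have z2 : IsZero (K.obj (l.obj N)) := 
      (ejq2.app _).isZero_iff.1 (q2.map_isZero z1)
    obtain ⟨W, g, h, hT⟩ := distinguished_cocone_triangle (jq2.counit.app (l.obj N))
    have hW : IsZero (q2.obj W) := isZero_map₃ q2 _ hT (map_counit_iso jq2 ejq2 _)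
    have := resC W hW
    have eW : W ≅ i2.obj (p2.obj W) := asIso (pi2.unit.app W)
    have m3 : (T ⋙ K).essImage (K.obj W) := ⟨i.obj (p2.obj W), 
      ⟨K.mapIso (eTi.app _ ≪≫ eW.symm)⟩⟩
    have m2 : (T ⋙ K).essImage (K.obj (l.obj N)) :=
      ⟨0, ⟨((T ⋙ K).map_isZero (isZero_zero _)).iso z2⟩⟩
    have m1 : (T ⋙ K).essImage (K.obj (j2.obj (q2.obj (l.obj N)))) := 
      ObjectProperty.ext_of_isTriangulatedClosed₁ _ _ (K.map_distinguished _ hT) m2 m3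
    refine Functor.essImage.ofIso ?_ m1
    exact eK.app _ ≪≫ q2.mapIso (el.app N) ≪≫ ejq3.app _
  have : (T ⋙ K).EssSurj := ⟨fun Z => by
    obtain ⟨W, g, h, hT⟩ := distinguished_cocone_triangle (jq1.counit.app Z)
    have hW : IsZero (q1.obj W) := isZero_map₃ q1 _ hT (map_counit_iso jq1 ejq1 _)
    have := resB W hW
    have m3 : (T ⋙ K).essImage W := 
      Functor.essImage.ofIso (asIso (ip1.counit.app W)) (s2 (p1.obj W))
    exact ObjectProperty.ext_of_isTriangulatedClosed₂ _ _ hT (s1 (q1.obj Z)) m3⟩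
  exact ⟨T ⋙ K, inferInstance, inferInstance, {}⟩

end Tri3

set_option linter.unusedSectionVars false
set_option linter.unusedVariables false
open CategoryTheory

section FlipThm
open Limits ZeroObject
universe v₁ v₂ v₃ u₁ u₂ u₃

/-- Triangulated equivalence of derived categories. -/
def DEq (A : Type u₁) [Category.{v₁} A] [Abelian A] (B : Type u₂) [Category.{v₂} B] [Abelian B] :
    Prop := ∃ (F : DerivedCategory A ⥤ DerivedCategory B) (c : F.CommShift ℤ),
      F.IsTriangulated ∧ F.IsEquivalence

variable {A : Type u₁} [Category.{v₁} A] [Abelian A]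
  {B : Type u₂} [Category.{v₂} B] [Abelian B]
  {T : Type u₃} [Category.{v₃} T] [Abelian T]

theorem DEq.trans (h₁ : DEq A B) (h₂ : DEq B T) : DEq A T := by
  obtain ⟨F, c, hF, hF'⟩ := h₁
  obtain ⟨G, d, hG, hG'⟩ := h₂
  exact ⟨F ⋙ G, inferInstance, inferInstance, inferInstance⟩

theorem DEq.symm (h₁ : DEq A B) : DEq B A := by
  obtain ⟨F, c, hF, hF'⟩ := h₁
  let E := F.asEquivalence
  let _ : E.functor.CommShift ℤ := c
  have hE : E.functor.IsTriangulated := hF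
  let _ : E.inverse.CommShift ℤ := E.commShiftInverse ℤ
  have : E.CommShift ℤ := E.commShift_of_functor ℤ
  have : E.IsTriangulated := Equivalence.IsTriangulated.mk' E hE
  exact ⟨E.inverse, inferInstance, inferInstance, inferInstance⟩

theorem DEq.of_equiv (F : A ⥤ B) [F.IsEquivalence] : DEq A B := by
  let E := F.asEquivalence
  have : F.Additive := Functor.additive_of_preserves_binary_products _
  have : Ex F := Ex.mk' _
  have : E.inverse.Additive := Functor.additive_of_preserves_binary_products _
  have : Ex E.inverse := Ex.mk' _
  have e1 : Dm F ⋙ Dm E.inverse ≅ 𝟭 _ := (DmComp _ _).symm ≪≫ DmIso E.unitIso.symm ≪≫ DmId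
  have e2 : Dm E.inverse ⋙ Dm F ≅ 𝟭 _ := (DmComp _ _).symm ≪≫ DmIso E.counitIso ≪≫ DmId
  exact ⟨Dm F, inferInstance, inferInstance, (CategoryTheory.Equivalence.mk (Dm F) (Dm E.inverse) e1.symm e2).isEquivalence_functor⟩

theorem DEq.refl : DEq A A := DEq.of_equiv (𝟭 A)

variable (G : B ⥤ A) [Ex G]

noncomputable def DmTo1 {F : A ⥤ B} {G : B ⥤ A} [Ex F] [Ex G] (e : F ⋙ G ≅ 𝟭 A) : Dm F ⋙ Dm G ≅ 𝟭 _ :=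
  (DmComp _ _).symm ≪≫ DmIso e ≪≫ DmId

theorem Dm_comp_zero (F : A ⥤ B) (G : B ⥤ T) [Ex F] [Ex G] (h : ∀ Z, IsZero (G.obj (F.obj Z)))
    (Z : DerivedCategory A) : IsZero ((Dm G).obj ((Dm F).obj Z)) :=
  ((DmComp F G).app Z).isZero_iff.1 (Dm_zero (F ⋙ G) h Z)

theorem comma_zero {L : A ⥤ T} {R : B ⥤ T} [Ex L] [Ex R] (Z : Comma L R) (h₁ : IsZero Z.left)
    (h₂ : IsZero Z.right) : IsZero Z := by
  rw [IsZero.iff_id_eq_zero]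
  ext
  · exact h₁.eq_of_src _ _
  · exact h₂.eq_of_src _ _

theorem flip_thm : DEq (Comma (𝟭 A) G) (Comma G (𝟭 A)) := by
  refine flip_abstract (X := DerivedCategory A) (R := DerivedCategory B)
    (C := DerivedCategory (Comma (𝟭 A) (Comma.snd G (𝟭 A))))
    (Dm (cI G)) (Dm (Comma.fst (𝟭 A) G)) (Dm (Comma.snd (𝟭 A) G)) (Dm (cJ G)) (Dm (cJ' G))
    (Dm (cI (Comma.snd G (𝟭 A)))) (Dm (Comma.fst (𝟭 A) (Comma.snd G (𝟭 A))))
    (Dm (Comma.snd (𝟭 A) (Comma.snd G (𝟭 A)))) (Dm (cJ (Comma.snd G (𝟭 A))))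
    (Dm (cJ' (Comma.snd G (𝟭 A)))) (Dm (dI G ⋙ cJ' (Comma.snd G (𝟭 A))))
    (Dm (dI G)) (Dm (Comma.snd G (𝟭 A))) (Dm (Comma.fst G (𝟭 A))) (Dm (dJ G)) (Dm (cT G))
    (DmAdj (adjPI G)) (DmAdj (adjJQ G)) (DmAdj (adjQJ' G))
    (DmTo1 (Iso.refl _))
    (DmTo1 (Iso.refl _))
    (DmTo1 (Iso.refl _))
    (Dm_comp_zero _ _ fun _ => isZero_zero _)
    (Dm_conserv _ _ comma_zero)
    (DmAdj (adjPI _)) (DmAdj (adjJQ _)) (DmAdj (adjQJ' _))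
    (DmTo1 (Iso.refl _))
    (DmTo1 (Iso.refl _))
    (DmTo1 (Iso.refl _))
    (Dm_comp_zero _ _ fun _ => isZero_zero _)
    (Dm_comp_zero _ _ fun _ => isZero_zero _)
    (Dm_conserv _ _ comma_zero)
    (DmAdj (adjL G)) (DmTo1 (Iso.refl _))
    (DmComp _ _)
    (DmAdj (adjdIP G)) (DmTo1 (Iso.refl _))
    (DmAdj (adjdJQ G)) (DmTo1 (Iso.refl _))
    (Dm_comp_zero _ _ fun _ => isZero_zero _)
    (Dm_conserv _ _ fun Z h₁ h₂ => comma_zero Z h₂ h₁)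
    ((DmComp _ _).symm ≪≫ DmIso (cTI G))
    ((DmComp _ _).symm ≪≫ DmIso (cTJ G) ≪≫ DmComp _ _)
    ((DmComp _ _).symm ≪≫ DmIso (cTJ' G) ≪≫ DmComp _ _)
    ((DmComp _ _).symm ≪≫ DmIso (Iso.refl (Comma.snd (𝟭 A) G ⋙ dJ G)) ≪≫ DmComp _ _)

end FlipThm

set_option linter.unusedSectionVars false
set_option linter.unusedVariables false
open CategoryTheory

/-- Combinatorial data of a quiver with zero relations on natural numbers. -/
structure QD where
  L : Finset ℕ
  s : ℕ → ℕ
  t : ℕ → ℕ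
  Rel : Set (List ℕ)

/-- Action of a word by successive application. -/
def act {N : Type} (F : ℕ → N → N) (p : List ℕ) (n : N) : N := p.foldl (fun n y => F y n) n

theorem act_nil {N : Type} (F : ℕ → N → N) (n : N) : act F [] n = n := rfl
theorem act_cons {N : Type} (F : ℕ → N → N) (y : ℕ) (p : List ℕ) (n : N) :
    act F (y :: p) n = act F p (F y n) := rfl
theorem act_append {N : Type} (F : ℕ → N → N) (p q : List ℕ) (n : N) :
    act F (p ++ q) n = act F q (act F p n) := List.foldl_append

theorem act_zero_of_mem {N : Type} [AddCommGroup N] (F : ℕ → N → N) (h0 : ∀ y, F y 0 = 0)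
    (p : List ℕ) (y : ℕ) (hy : y ∈ p) (hF : ∀ n, F y n = 0) (n : N) : act F p n = 0 := by
  have key : ∀ p : List ℕ, act F p 0 = 0 := by
    intro p
    induction p with
    | nil => rfl
    | cons z p ih => rw [act_cons, h0, ih]
  induction p generalizing n with
  | nil => simp at hy
  | cons z p ih =>
    rw [act_cons]
    rcases List.mem_cons.1 hy with rfl | h
    · rw [hF, key]
    · exact ih h _

theorem act_map {N N' : Type} (F : ℕ → N → N) (F' : ℕ → N' → N') (φ : N → N') (p : List ℕ)
    (h : ∀ y ∈ p, ∀ n, φ (F y n) = F' y (φ n)) (n : N) : φ (act F p n) = act F' p (φ n) := by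
  induction p generalizing n with
  | nil => rfl
  | cons z p ih =>
    rw [act_cons, act_cons, ih (fun y hy => h y (List.mem_cons_of_mem _ hy)),
      h z List.mem_cons_self]

section
variable (k : Type) [Field k] (D : QD)

inductive ARel : FreeAlgebra k (ℕ ⊕ ℕ) → FreeAlgebra k (ℕ ⊕ ℕ) → Prop
  | idem (y : ℕ) : ARel (FreeAlgebra.ι k (Sum.inl y) * FreeAlgebra.ι k (Sum.inl y))
      (FreeAlgebra.ι k (Sum.inl y))
  | orth (x y : ℕ) (h : x ≠ y) :
      ARel (FreeAlgebra.ι k (Sum.inl x) * FreeAlgebra.ι k (Sum.inl y)) 0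
  | out (y : ℕ) (h : y ∉ D.L) : ARel (FreeAlgebra.ι k (Sum.inl y)) 0
  | unit : ARel (∑ y ∈ D.L, FreeAlgebra.ι k (Sum.inl y)) 1
  | src (y : ℕ) : ARel (FreeAlgebra.ι k (Sum.inr y) * FreeAlgebra.ι k (Sum.inl (D.s y)))
      (FreeAlgebra.ι k (Sum.inr y))
  | tgt (y : ℕ) : ARel (FreeAlgebra.ι k (Sum.inl (D.t y)) * FreeAlgebra.ι k (Sum.inr y))
      (FreeAlgebra.ι k (Sum.inr y))
  | rel (p : List ℕ) (h : p ∈ D.Rel) :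
      ARel ((p.map (fun y => FreeAlgebra.ι k (Sum.inr y))).reverse.prod) 0

/-- The algebra whose left modules are representations. -/
def Alg : Type := RingQuot (ARel k D)

instance : Ring (Alg k D) := inferInstanceAs (Ring (RingQuot (ARel k D)))
instance : Algebra k (Alg k D) := inferInstanceAs (Algebra k (RingQuot (ARel k D)))

namespace Alg

def mk : FreeAlgebra k (ℕ ⊕ ℕ) →ₐ[k] Alg k D := RingQuot.mkAlgHom k (ARel k D)

theorem mk_rel {x y : FreeAlgebra k (ℕ ⊕ ℕ)} (h : ARel k D x y) : mk k D x = mk k D y :=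
  RingQuot.mkAlgHom_rel k h

theorem mk_surj : Function.Surjective (mk k D) := RingQuot.mkAlgHom_surjective k _

def e (y : ℕ) : Alg k D := mk k D (FreeAlgebra.ι k (Sum.inl y))
def f (y : ℕ) : Alg k D := mk k D (FreeAlgebra.ι k (Sum.inr y))

theorem e_idem (y : ℕ) : e k D y * e k D y = e k D y := by
  have := mk_rel k D (ARel.idem y); rwa [map_mul] at this
theorem e_orth (x y : ℕ) (h : x ≠ y) : e k D x * e k D y = 0 := by
  have := mk_rel k D (ARel.orth x y h); rwa [map_mul, map_zero] at this
theorem e_out (y : ℕ) (h : y ∉ D.L) : e k D y = 0 := by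
  have := mk_rel k D (ARel.out y h); rwa [map_zero] at this
theorem e_unit : ∑ y ∈ D.L, e k D y = 1 := by
  have := mk_rel k D ARel.unit; rwa [map_sum, map_one] at this
theorem f_src (y : ℕ) : f k D y * e k D (D.s y) = f k D y := by
  have := mk_rel k D (ARel.src y); rwa [map_mul] at this
theorem f_tgt (y : ℕ) : e k D (D.t y) * f k D y = f k D y := by
  have := mk_rel k D (ARel.tgt y); rwa [map_mul] at this
theorem f_dead (y : ℕ) (h : D.s y ∉ D.L ∨ D.t y ∉ D.L) : f k D y = 0 := by
  rcases h with h | h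
  · rw [← f_src, e_out k D _ h, mul_zero]
  · rw [← f_tgt, e_out k D _ h, zero_mul]
theorem f_rel (p : List ℕ) (h : p ∈ D.Rel) : (p.map (f k D)).reverse.prod = 0 := by
  have := mk_rel k D (ARel.rel p h)
  rw [map_list_prod, map_zero, List.map_reverse, List.map_map] at this
  exact this

section mods
variable {k D} {M : Type} [AddCommGroup M] [Module (Alg k D) M]

theorem e_e (y : ℕ) (m : M) : e k D y • e k D y • m = e k D y • m := by
  rw [← mul_smul, e_idem]
theorem e_ne {x y : ℕ} (h : x ≠ y) (m : M) : e k D x • e k D y • m = 0 := by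
  rw [← mul_smul, e_orth k D x y h, zero_smul]
theorem e_o {y : ℕ} (h : y ∉ D.L) (m : M) : e k D y • m = 0 := by
  rw [e_out k D y h, zero_smul]
theorem f_s (y : ℕ) (m : M) : f k D y • e k D (D.s y) • m = f k D y • m := by
  rw [← mul_smul, f_src]
theorem f_t (y : ℕ) (m : M) : e k D (D.t y) • f k D y • m = f k D y • m := by
  rw [← mul_smul, f_tgt]
theorem f_d {y : ℕ} (h : D.s y ∉ D.L ∨ D.t y ∉ D.L) (m : M) : f k D y • m = 0 := by
  rw [f_dead k D y h, zero_smul]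
theorem e_sum (m : M) : ∑ y ∈ D.L, e k D y • m = m := by
  rw [← Finset.sum_smul, e_unit, one_smul]
theorem act_f (p : List ℕ) (m : M) :
    act (fun y (n : M) => f k D y • n) p m = (p.map (f k D)).reverse.prod • m := by
  induction p generalizing m with
  | nil => simp [act_nil]
  | cons y p ih => rw [act_cons, ih]; simp [mul_smul]
theorem f_r {p : List ℕ} (h : p ∈ D.Rel) (m : M) :
    act (fun y (n : M) => f k D y • n) p m = 0 := by
  rw [act_f, f_rel k D p h, zero_smul]
theorem f_e_ne {x y : ℕ} (h : x ≠ D.s y) (m : M) : f k D y • e k D x • m = 0 := by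
  rw [← f_s, e_ne h.symm, smul_zero]
theorem e_f_ne {x y : ℕ} (h : x ≠ D.t y) (m : M) : e k D x • f k D y • m = 0 := by
  rw [← f_t, e_ne h]

/-- Constructor of linear maps. -/
def hom {M N : Type} [AddCommGroup M] [Module (Alg k D) M] [AddCommGroup N] [Module (Alg k D) N]
    (φ : M →+ N) (hk : ∀ (c : k) m, φ (algebraMap k (Alg k D) c • m) = algebraMap k (Alg k D) c • φ m)
    (he : ∀ y m, φ (e k D y • m) = e k D y • φ m)
    (hf : ∀ y m, φ (f k D y • m) = f k D y • φ m) : M →ₗ[Alg k D] N where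
  toFun := φ
  map_add' := φ.map_add
  map_smul' := by
    intro a m
    obtain ⟨a, rfl⟩ := mk_surj k D a
    simp only [RingHom.id_apply]
    induction a using FreeAlgebra.induction generalizing m with
    | grade0 c => rw [AlgHom.commutes]; exact hk c m
    | grade1 x => rcases x with y | y; exacts [he y m, hf y m]
    | mul a b ha hb => rw [map_mul, mul_smul, mul_smul, ha, hb]
    | add a b ha hb => rw [map_add, add_smul, add_smul, map_add, ha, hb]

end mods
end Alg

variable {k D}

structure IsRep (k : Type) [Field k] (D : QD) {N : Type} [AddCommGroup N] [Module k N]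
    (E F : ℕ → Module.End k N) : Prop where
  idem : ∀ y n, E y (E y n) = E y n
  orth : ∀ x y, x ≠ y → ∀ n, E x (E y n) = 0
  out : ∀ y, y ∉ D.L → ∀ n, E y n = 0
  unit : ∀ n, ∑ y ∈ D.L, E y n = n
  src : ∀ y n, F y (E (D.s y) n) = F y n
  tgt : ∀ y n, E (D.t y) (F y n) = F y n
  rel : ∀ p ∈ D.Rel, ∀ n, act (fun y => F y) p n = 0

namespace IsRep
variable {N : Type} [AddCommGroup N] [Module k N] {E F : ℕ → Module.End k N}

theorem act_prod (p : List ℕ) (n : N) :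
    act (fun y => F y) p n = (p.map F).reverse.prod n := by
  induction p generalizing n with
  | nil => simp [act_nil]
  | cons y p ih => rw [act_cons, ih]; simp

def toHom (h : IsRep k D E F) : Alg k D →ₐ[k] Module.End k N :=
  RingQuot.liftAlgHom k ⟨FreeAlgebra.lift k (Sum.elim E F), by
    intro x y hxy
    induction hxy with
    | idem y => ext n; simp [h.idem]
    | orth x y hxy => ext n; simp [h.orth x y hxy]
    | out y hy => ext n; simp [h.out y hy]
    | unit => ext n; simp [h.unit]
    | src y => ext n; simp [h.src]
    | tgt y => ext n; simp [h.tgt]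
    | rel p hp =>
      ext n
      rw [map_list_prod, List.map_reverse, List.map_map, map_zero, LinearMap.zero_apply,
        ← h.rel p hp n, act_prod]
      congr 3
      apply List.map_congr_left
      intro y hy
      simp⟩

theorem toHom_e (h : IsRep k D E F) (y : ℕ) : h.toHom (Alg.e k D y) = E y := by
  unfold Alg.e Alg.mk toHom
  erw [RingQuot.liftAlgHom_mkAlgHom_apply]
  simp
theorem toHom_f (h : IsRep k D E F) (y : ℕ) : h.toHom (Alg.f k D y) = F y := by
  unfold Alg.f Alg.mk toHom
  erw [RingQuot.liftAlgHom_mkAlgHom_apply]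
  simp

end IsRep

/-- Module attached to a representation. -/
def RepMod {N : Type} [AddCommGroup N] [Module k N] {E F : ℕ → Module.End k N}
    (h : IsRep k D E F) : Type := N

namespace RepMod
variable {N : Type} [AddCommGroup N] [Module k N] {E F : ℕ → Module.End k N} (h : IsRep k D E F)

instance : AddCommGroup (RepMod h) := inferInstanceAs (AddCommGroup N)
instance : Module (Alg k D) (RepMod h) :=
  letI : Module (Module.End k N) (RepMod h) := inferInstanceAs (Module (Module.End k N) N)
  Module.compHom (RepMod h) h.toHom.toRingHom

def inj : N ≃+ RepMod h := AddEquiv.refl N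

theorem smul_def (a : Alg k D) (n : N) : a • inj h n = inj h (h.toHom a n) := rfl
theorem e_smul (y : ℕ) (n : N) : Alg.e k D y • inj h n = inj h (E y n) := by
  rw [smul_def, h.toHom_e]
theorem f_smul (y : ℕ) (n : N) : Alg.f k D y • inj h n = inj h (F y n) := by
  rw [smul_def, h.toHom_f]
theorem k_smul (c : k) (n : N) : algebraMap k (Alg k D) c • inj h n = inj h (c • n) := by
  rw [smul_def, AlgHom.commutes]; rfl

theorem e_smul' (y : ℕ) (n : RepMod h) : Alg.e k D y • n = inj h (E y ((inj h).symm n)) :=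
  e_smul h y n
theorem f_smul' (y : ℕ) (n : RepMod h) : Alg.f k D y • n = inj h (F y ((inj h).symm n)) :=
  f_smul h y n
theorem k_smul' (c : k) (n : RepMod h) :
    algebraMap k (Alg k D) c • n = inj h (c • ((inj h).symm n)) := k_smul h c n

end RepMod
end

set_option linter.unusedSectionVars false
set_option linter.unusedVariables false
open CategoryTheory
open scoped ModuleCat

structure Half (D T : QD) (Br : Finset ℕ) : Prop where
  sub : T.L ⊆ D.L
  s_eq : ∀ y, y ∉ Br → T.s y = D.s y
  t_eq : ∀ y, y ∉ Br → T.t y = D.t y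
  dead : ∀ y ∈ Br, T.s y ∉ T.L ∨ T.t y ∉ T.L
  st : ∀ y, y ∉ Br → D.s y ∈ T.L → D.t y ∈ D.L → D.t y ∈ T.L
  ts : ∀ y, y ∉ Br → D.t y ∈ T.L → D.s y ∈ D.L → D.s y ∈ T.L
  br : ∀ y ∈ Br, D.s y ∉ T.L ∨ D.t y ∉ T.L
  rel : ∀ p ∈ T.Rel, p ∈ D.Rel
  rel_br : ∀ p ∈ T.Rel, ∀ y ∈ p, y ∉ Br

structure Split (D DS DR : QD) (Br : Finset ℕ) : Prop where
  h1 : Half D DS Br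
  h2 : Half D DR Br
  cov : ∀ x ∈ D.L, x ∈ DS.L ∨ x ∈ DR.L
  disj : ∀ x ∈ DS.L, x ∉ DR.L

namespace Split
open Alg
variable {k : Type} [Field k] {D DS DR : QD} {Br : Finset ℕ} 

section Tw
variable (hs : Split D DS DR Br)
variable {M : ModuleCat.{0} (Alg k DS)} {R : ModuleCat.{0} (Alg k DR)}
variable (A : ℕ → M →ₗ[k] R) (B : ℕ → R →ₗ[k] M)

theorem k_smul_M {A' : Type} [Ring A'] [Algebra k A'] {M : ModuleCat.{0} A'} (c : k) (m : M) :
    c • m = algebraMap k A' c • m := rfl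

variable (M R) in
def twE (y : ℕ) : Module.End k (M × R) where
  toFun x := (e k DS y • x.1, e k DR y • x.2)
  map_add' := by intros; simp
  map_smul' := by intro c x; ext <;> simp [smul_comm c]

def twF (y : ℕ) : Module.End k (M × R) where
  toFun x := (f k DS y • x.1 + B y x.2, f k DR y • x.2 + A y x.1)
  map_add' := by intros; ext <;> simp <;> abel
  map_smul' := by intro c x; ext <;> simp [smul_comm c]

theorem twE_apply (y : ℕ) (m : M) (r : R) : twE M R y (m, r) = (e k DS y • m, e k DR y • r) := rfl
theorem twF_apply (y : ℕ) (m : M) (r : R) :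
    twF A B y (m, r) = (f k DS y • m + B y r, f k DR y • r + A y m) := rfl

variable (D Br) in
structure TwD : Prop where
  A0 : ∀ y, y ∉ Br → ∀ m, A y m = 0
  B0 : ∀ y, y ∉ Br → ∀ r, B y r = 0
  As : ∀ y ∈ Br, ∀ m, A y (e k DS (D.s y) • m) = A y m
  At : ∀ y ∈ Br, ∀ m, e k DR (D.t y) • A y m = A y m
  Bs : ∀ y ∈ Br, ∀ r, B y (e k DR (D.s y) • r) = B y r
  Bt : ∀ y ∈ Br, ∀ r, e k DS (D.t y) • B y r = B y r
  rel : ∀ p ∈ D.Rel, ∀ x, act (fun y => twF A B y) p x = 0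

theorem e_sum_sup {T D : QD} (h : T.L ⊆ D.L) {M : Type} [AddCommGroup M] [Module (Alg k T) M]
    (m : M) : ∑ y ∈ D.L, e k T y • m = m := by
  rw [← Finset.sum_subset h, e_sum]
  intro x _ hx
  exact e_o hx m

include hs in
theorem TwD.isRep {A : ℕ → M →ₗ[k] R} {B : ℕ → R →ₗ[k] M} (h : TwD D Br A B) :
    IsRep k D (twE M R) (twF A B) where
  idem y n := by ext <;> simp [twE, e_e]
  orth x y hxy n := by ext <;> simp [twE, e_ne hxy]
  out y hy n := by
    ext <;> simp [twE]
    · exact e_o (fun h => hy (hs.h1.sub h)) _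
    · exact e_o (fun h => hy (hs.h2.sub h)) _
  unit n := by
    have h1 := e_sum_sup (k := k) hs.h1.sub n.1
    have h2 := e_sum_sup (k := k) hs.h2.sub n.2
    ext
    · rw [Prod.fst_sum]; exact h1
    · rw [Prod.snd_sum]; exact h2
  src y n := by
    obtain ⟨m, r⟩ := n
    rw [twE_apply, twF_apply, twF_apply]
    by_cases hy : y ∈ Br
    · rw [h.As y hy, h.Bs y hy, f_d (hs.h1.dead y hy), f_d (hs.h1.dead y hy),
        f_d (hs.h2.dead y hy), f_d (hs.h2.dead y hy)]
    · rw [h.A0 y hy, h.A0 y hy, h.B0 y hy, h.B0 y hy]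
      conv_lhs => rw [← hs.h1.s_eq y hy, f_s, hs.h1.s_eq y hy, ← hs.h2.s_eq y hy, f_s]
  tgt y n := by
    obtain ⟨m, r⟩ := n
    rw [twF_apply, twE_apply, smul_add, smul_add]
    by_cases hy : y ∈ Br
    · rw [h.At y hy, h.Bt y hy, f_d (hs.h1.dead y hy), f_d (hs.h2.dead y hy), smul_zero, smul_zero]
    · rw [h.A0 y hy, h.B0 y hy, smul_zero, smul_zero]
      conv_lhs => rw [← hs.h1.t_eq y hy, f_t, hs.h1.t_eq y hy, ← hs.h2.t_eq y hy, f_t]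
  rel := h.rel

/-- the twisted module -/
def Tw {A : ℕ → M →ₗ[k] R} {B : ℕ → R →ₗ[k] M} (h : TwD D Br A B) : ModuleCat.{0} (Alg k D) :=
  ModuleCat.of (Alg k D) (RepMod (h.isRep hs))

def twInj {A : ℕ → M →ₗ[k] R} {B : ℕ → R →ₗ[k] M} (h : TwD D Br A B) : M × R ≃+ Tw hs h :=
  RepMod.inj (h.isRep hs)

theorem tw_e {A : ℕ → M →ₗ[k] R} {B : ℕ → R →ₗ[k] M} (h : TwD D Br A B) (y : ℕ) (m : M) (r : R) :
    e k D y • twInj hs h (m, r) = twInj hs h (e k DS y • m, e k DR y • r) :=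
  RepMod.e_smul (h.isRep hs) y (m, r)
theorem tw_f {A : ℕ → M →ₗ[k] R} {B : ℕ → R →ₗ[k] M} (h : TwD D Br A B) (y : ℕ) (m : M) (r : R) :
    f k D y • twInj hs h (m, r) =
      twInj hs h (f k DS y • m + B y r, f k DR y • r + A y m) :=
  RepMod.f_smul (h.isRep hs) y (m, r)
theorem tw_k {A : ℕ → M →ₗ[k] R} {B : ℕ → R →ₗ[k] M} (h : TwD D Br A B) (c : k) (m : M) (r : R) :
    algebraMap k (Alg k D) c • twInj hs h (m, r) = twInj hs h (c • m, c • r) :=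
  RepMod.k_smul (h.isRep hs) c (m, r)

theorem hom_k {A' : Type} [Ring A'] [Algebra k A'] {M M' : ModuleCat.{0} A'} (h : M →ₗ[A'] M')
    (c : k) (m : M) : h (c • m) = c • h m := by
  rw [k_smul_M, k_smul_M, map_smul]

variable {M' : ModuleCat.{0} (Alg k DS)} {R' : ModuleCat.{0} (Alg k DR)}
variable {A} {B} {A' : ℕ → M' →ₗ[k] R'} {B' : ℕ → R' →ₗ[k] M'}

def twMap (h : TwD D Br A B) (h' : TwD D Br A' B') (u : M →ₗ[Alg k DS] M') (v : R →ₗ[Alg k DR] R')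
    (hA : ∀ y m, v (A y m) = A' y (u m)) (hB : ∀ y r, u (B y r) = B' y (v r)) :
    Tw hs h →ₗ[Alg k D] Tw hs h' :=
  Alg.hom ((twInj hs h').toAddMonoidHom.comp
      ((AddMonoidHom.prodMap u.toAddMonoidHom v.toAddMonoidHom).comp
        (twInj hs h).symm.toAddMonoidHom))
    (by
      intro c x
      obtain ⟨⟨m, r⟩, rfl⟩ := (twInj hs h).surjective x
      rw [tw_k]
      simp only [AddMonoidHom.comp_apply, AddEquiv.coe_toAddMonoidHom, AddEquiv.symm_apply_apply]
      exact (congrArg _ (Prod.ext (hom_k u c m) (hom_k v c r))).trans (tw_k hs h' c (u m) (v r)).symm)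
    (by
      intro c x
      obtain ⟨⟨m, r⟩, rfl⟩ := (twInj hs h).surjective x
      rw [tw_e]
      simp [tw_e])
    (by
      intro c x
      obtain ⟨⟨m, r⟩, rfl⟩ := (twInj hs h).surjective x
      rw [tw_f]
      simp [tw_f, hA, hB])

theorem twMap_apply (h : TwD D Br A B) (h' : TwD D Br A' B') (u : M →ₗ[Alg k DS] M')
    (v : R →ₗ[Alg k DR] R')
    (hA : ∀ y m, v (A y m) = A' y (u m)) (hB : ∀ y r, u (B y r) = B' y (v r)) (m : M) (r : R) :
    twMap hs h h' u v hA hB (twInj hs h (m, r)) = twInj hs h' (u m, v r) := by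
  change twInj hs h' (AddMonoidHom.prodMap u.toAddMonoidHom v.toAddMonoidHom
    ((twInj hs h).symm (twInj hs h (m, r)))) = _
  rw [AddEquiv.symm_apply_apply]; rfl

theorem tw_full (h : TwD D Br A B) (h' : TwD D Br A' B') (φ : Tw hs h →ₗ[Alg k D] Tw hs h') :
    ∃ (u : M →ₗ[Alg k DS] M') (v : R →ₗ[Alg k DR] R'),
      (∀ m r, φ (twInj hs h (m, r)) = twInj hs h' (u m, v r)) ∧
      (∀ y m, v (A y m) = A' y (u m)) ∧ (∀ y r, u (B y r) = B' y (v r)) := by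
  let ψ : M × R →+ M' × R' := (twInj hs h').symm.toAddMonoidHom.comp
    (φ.toAddMonoidHom.comp (twInj hs h).toAddMonoidHom)
  have hψ : ∀ x, φ (twInj hs h x) = twInj hs h' (ψ x) := by intro x; simp [ψ]
  have he : ∀ y m r, ψ (e k DS y • m, e k DR y • r) =
      (e k DS y • (ψ (m, r)).1, e k DR y • (ψ (m, r)).2) := by
    intro y m r
    apply (twInj hs h').injective
    rw [← hψ, ← tw_e, ← tw_e, map_smul, hψ]
  have hf : ∀ y m r, ψ (f k DS y • m + B y r, f k DR y • r + A y m) =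
      (f k DS y • (ψ (m, r)).1 + B' y (ψ (m, r)).2,
        f k DR y • (ψ (m, r)).2 + A' y (ψ (m, r)).1) := by
    intro y m r
    apply (twInj hs h').injective
    rw [← hψ, ← tw_f, ← tw_f, map_smul, hψ]
  have hk : ∀ (c : k) m r, ψ (c • m, c • r) = (c • (ψ (m, r)).1, c • (ψ (m, r)).2) := by
    intro y m r
    apply (twInj hs h').injective
    rw [← hψ, ← tw_k, ← tw_k, map_smul, hψ]
  have h1 : ∀ m, (ψ (m, 0)).2 = 0 := by
    intro m
    rw [← e_sum (D := DR) (k := k) (ψ (m, 0)).2]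
    refine Finset.sum_eq_zero fun y hy => ?_
    have := he y m 0
    rw [e_o (fun h => hs.disj _ h hy), smul_zero] at this
    have h2 := congrArg Prod.snd this
    rw [Prod.mk_zero_zero, map_zero] at h2
    exact h2.symm
  have h2 : ∀ r, (ψ (0, r)).1 = 0 := by
    intro r
    rw [← e_sum (D := DS) (k := k) (ψ (0, r)).1]
    refine Finset.sum_eq_zero fun y hy => ?_
    have := he y 0 r
    rw [e_o (hs.disj _ hy), smul_zero] at this
    have h2 := congrArg Prod.fst this
    rw [Prod.mk_zero_zero, map_zero] at h2
    exact h2.symm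
  have h3 : ∀ m r, ψ (m, r) = ((ψ (m, 0)).1, (ψ (0, r)).2) := by
    intro m r
    have : (m, r) = (m, 0) + ((0, r) : M × R) := by simp
    rw [this, map_add]
    ext
    · simp [h2]
    · simp [h1]
  let u0 : M →+ M' := (AddMonoidHom.fst _ _).comp (ψ.comp (AddMonoidHom.inl _ _))
  let v0 : R →+ R' := (AddMonoidHom.snd _ _).comp (ψ.comp (AddMonoidHom.inr _ _))
  have h4 : ∀ m r, ψ (m, r) = (u0 m, v0 r) := h3
  have hu0 : u0 0 = 0 := map_zero _
  have hv0 : v0 0 = 0 := map_zero _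
  simp only [h4, Prod.mk.injEq] at he hf hk
  refine ⟨Alg.hom u0 (fun c m => (hk c m 0).1) (fun y m => (he y m 0).1) ?_,
    Alg.hom v0 (fun c m => (hk c 0 m).2) (fun y m => (he y 0 m).2) ?_, ?_, ?_, ?_⟩
  · intro y m
    simpa using (hf y m 0).1
  · intro y m
    simpa using (hf y 0 m).2
  · intro m r
    rw [hψ, h4]; rfl
  · intro y m
    have := (hf y m 0).2
    simp only [smul_zero, zero_add, hv0] at this
    exact this
  · intro y m
    have := (hf y 0 m).1
    simp only [smul_zero, zero_add, hu0] at this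
    exact this

end Tw
end Split

set_option linter.unusedSectionVars false
set_option linter.unusedVariables false
open CategoryTheory
open scoped ModuleCat

namespace Half
open Alg
variable {k : Type} [Field k] {D T : QD} {Br : Finset ℕ}

variable (k D T) in
def P : Alg k D := ∑ y ∈ T.L, e k D y

theorem P_e {y : ℕ} (hy : y ∈ T.L) : P k D T * e k D y = e k D y := by
  unfold P
  rw [Finset.sum_mul, Finset.sum_eq_single y, e_idem]
  · intro b _ hb; exact e_orth k D _ _ hb
  · intro h; exact absurd hy h
theorem P_e' {y : ℕ} (hy : y ∉ T.L) : P k D T * e k D y = 0 := by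
  unfold P
  rw [Finset.sum_mul]
  apply Finset.sum_eq_zero
  intro x hx; exact e_orth k D _ _ (fun h => hy (h ▸ hx))
theorem e_P {y : ℕ} (hy : y ∈ T.L) : e k D y * P k D T = e k D y := by
  unfold P
  rw [Finset.mul_sum, Finset.sum_eq_single y, e_idem]
  · intro b _ hb; exact e_orth k D _ _ hb.symm
  · intro h; exact absurd hy h
theorem e_P' {y : ℕ} (hy : y ∉ T.L) : e k D y * P k D T = 0 := by
  unfold P
  rw [Finset.mul_sum]
  apply Finset.sum_eq_zero
  intro x hx; exact e_orth k D _ _ (fun h => hy (h ▸ hx))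

theorem P_P : P k D T * P k D T = P k D T := by
  conv_lhs => enter [2]; unfold P
  rw [Finset.mul_sum]
  exact Finset.sum_congr rfl fun y hy => P_e hy

section
variable (h : Half D T Br)
include h

theorem f_P {y : ℕ} (hy : y ∉ Br) : f k D y * P k D T = P k D T * f k D y := by
  by_cases hs : D.s y ∈ D.L
  · by_cases ht : D.t y ∈ D.L
    · by_cases h1 : D.s y ∈ T.L
      · have h2 := h.st y hy h1 ht
        rw [← f_src, mul_assoc, e_P h1, f_src, ← f_tgt, ← mul_assoc, P_e h2]
      · have h2 : D.t y ∉ T.L := fun h3 => h1 (h.ts y hy h3 hs)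
        rw [← f_src, mul_assoc, e_P' h1, f_src, ← f_tgt, ← mul_assoc, P_e' h2]; simp
    · rw [f_dead k D y (Or.inr ht)]; simp
  · rw [f_dead k D y (Or.inl hs)]; simp

theorem P_f_P {y : ℕ} (hy : y ∈ Br) : P k D T * f k D y * P k D T = 0 := by
  rcases h.br y hy with h1 | h1
  · rw [← f_src, mul_assoc, mul_assoc, e_P' h1]; simp
  · rw [← f_tgt, ← mul_assoc, P_e' h1]; simp
end

section
variable (N : ModuleCat.{0} (Alg k D))

variable (k D T) in
def psub : Submodule k N where
  carrier := {n | P k D T • n = n}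
  add_mem' := by intro a b ha hb; simp only [Set.mem_ofPred_eq] at *; rw [smul_add, ha, hb]
  zero_mem' := by simp
  smul_mem' := by intro c a ha; simp only [Set.mem_ofPred_eq] at *; rw [smul_comm, ha]

theorem mem_sub (n : N) : n ∈ psub k D T N ↔ P k D T • n = n := Iff.rfl

theorem P_mem (n : N) : P k D T • n ∈ psub k D T N := by
  rw [mem_sub, ← mul_smul, P_P]

theorem e_mem (y : ℕ) (n : N) (hn : n ∈ psub k D T N) : e k D y • n ∈ psub k D T N := by
  rw [mem_sub] at *
  by_cases hy : y ∈ T.L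
  · rw [← mul_smul, P_e hy]
  · rw [← hn, ← mul_smul (e k D y), e_P' hy]; simp

variable (k D T) in
def sE (y : ℕ) : Module.End k (psub k D T N) where
  toFun n := ⟨e k D y • n.1, e_mem N y n.1 n.2⟩
  map_add' := by intro a b; ext; simp
  map_smul' := by intro c a; ext; simp [smul_comm c]

variable (k D T) in
def sF (y : ℕ) : Module.End k (psub k D T N) where
  toFun n := ⟨P k D T • f k D y • n.1, P_mem N _⟩
  map_add' := by intro a b; ext; simp
  map_smul' := by intro c a; ext; simp [smul_comm c]

theorem e_out_sub {y : ℕ} (hy : y ∉ T.L) (n : N) (hn : n ∈ psub k D T N) : e k D y • n = 0 := by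
  rw [mem_sub] at hn
  rw [← hn, ← mul_smul, e_P' hy, zero_smul]

end
section
variable (h : Half D T Br)
include h
variable (N : ModuleCat.{0} (Alg k D))

theorem sF_br {y : ℕ} (hy : y ∈ Br) (n : psub k D T N) : sF k D T N y n = 0 := by
  ext
  change P k D T • f k D y • n.1 = 0
  have hn := (mem_sub N n.1).1 n.2
  rw [← hn, ← mul_smul, ← mul_smul, P_f_P h hy, zero_smul]

theorem sF_nbr {y : ℕ} (hy : y ∉ Br) (n : psub k D T N) : (sF k D T N y n).1 = f k D y • n.1 := by
  change P k D T • f k D y • n.1 = _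
  rw [← mul_smul, ← f_P h hy, mul_smul, (mem_sub N n.1).1 n.2]

theorem sub_isRep : IsRep k T (sE k D T N) (sF k D T N) where
  idem y n := by ext; exact e_e y n.1
  orth x y hxy n := by ext; exact e_ne hxy n.1
  out y hy n := by ext; exact e_out_sub N hy n.1 n.2
  unit n := by
    ext
    rw [AddSubmonoidClass.coe_finsetSum]
    refine Eq.trans ?_ ((mem_sub N n.1).1 n.2)
    unfold P
    rw [Finset.sum_smul]; rfl
  src y n := by
    by_cases hy : y ∈ Br
    · rw [sF_br h N hy, sF_br h N hy]
    · ext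
      rw [sF_nbr h N hy, sF_nbr h N hy, h.s_eq y hy]
      exact f_s y n.1
  tgt y n := by
    by_cases hy : y ∈ Br
    · rw [sF_br h N hy, map_zero]
    · ext
      change e k D (T.t y) • (sF k D T N y n).1 = _
      rw [sF_nbr h N hy, h.t_eq y hy]
      exact f_t y n.1
  rel p hp n := by
    ext
    have := act_map (fun y => sF k D T N y) (fun y (n : N) => f k D y • n) Subtype.val p
      (fun y hy n => sF_nbr h N (h.rel_br p hp y hy) n) n
    rw [f_r (h.rel p hp)] at this
    exact this

def SM : ModuleCat.{0} (Alg k T) := ModuleCat.of _ (RepMod (sub_isRep h N))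

def val : SM h N →+ N := (psub k D T N).subtype.toAddMonoidHom.comp
  (RepMod.inj (sub_isRep h N)).symm.toAddMonoidHom

def mkS (n : N) (hn : P k D T • n = n) : SM h N := RepMod.inj (sub_isRep h N) ⟨n, hn⟩

theorem val_mkS (n : N) (hn : P k D T • n = n) : val h N (mkS h N n hn) = n := rfl
theorem val_inj : Function.Injective (val h N) := fun a b hab => Subtype.ext hab
theorem val_mem (m : SM h N) : P k D T • val h N m = val h N m := Subtype.prop (p := fun n => n ∈ psub k D T N) m
theorem val_e (y : ℕ) (m : SM h N) : val h N (e k T y • m) = e k D y • val h N m := by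
  exact congrArg (val h N) (RepMod.e_smul' (sub_isRep h N) y m)
theorem val_f (y : ℕ) (m : SM h N) : val h N (f k T y • m) = P k D T • f k D y • val h N m := by
  exact congrArg (val h N) (RepMod.f_smul' (sub_isRep h N) y m)
theorem val_k (c : k) (m : SM h N) : val h N (c • m) = c • val h N m := by
  exact congrArg (val h N) (RepMod.k_smul' (sub_isRep h N) c m)

end
end Half

namespace Split
open Alg Half
variable {k : Type} [Field k] {D DS DR : QD} {Br : Finset ℕ} (hs : Split D DS DR Br)
variable (N : ModuleCat.{0} (Alg k D))

include hs in
theorem P_add : P k D DS + P k D DR = 1 := by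
  unfold P
  rw [← e_unit, ← Finset.sum_union]
  · congr 1
    ext x
    simp only [Finset.mem_union]
    exact ⟨fun h => h.elim (fun h => hs.h1.sub h) (fun h => hs.h2.sub h), hs.cov x⟩
  · rw [Finset.disjoint_left]; exact hs.disj

include hs in
theorem PQ : P k D DS * P k D DR = 0 := by
  have := hs.P_add (k := k)
  rw [eq_sub_of_add_eq' this, mul_sub, P_P, mul_one, sub_self]
include hs in
theorem QP : P k D DR * P k D DS = 0 := by
  have := hs.P_add (k := k)
  rw [eq_sub_of_add_eq' this, sub_mul, P_P, one_mul, sub_self]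

def dA (y : ℕ) : SM hs.h1 N →ₗ[k] SM hs.h2 N where
  toFun m := mkS hs.h2 N (P k D DR • f k D y • val hs.h1 N m) (by rw [← mul_smul, P_P])
  map_add' := by intro a b; apply val_inj; simp [val_mkS]
  map_smul' := by
    intro c a; apply val_inj
    rw [val_mkS, val_k, RingHom.id_apply, val_k, val_mkS, smul_comm c, smul_comm c]

def dB (y : ℕ) : SM hs.h2 N →ₗ[k] SM hs.h1 N where
  toFun m := mkS hs.h1 N (P k D DS • f k D y • val hs.h2 N m) (by rw [← mul_smul, P_P])
  map_add' := by intro a b; apply val_inj; simp [val_mkS]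
  map_smul' := by
    intro c a; apply val_inj
    rw [val_mkS, val_k, RingHom.id_apply, val_k, val_mkS, smul_comm c, smul_comm c]

def th : SM hs.h1 N × SM hs.h2 N →+ N :=
  AddMonoidHom.coprod (val hs.h1 N) (val hs.h2 N)

theorem th_apply (m : SM hs.h1 N) (r : SM hs.h2 N) :
    th hs N (m, r) = val hs.h1 N m + val hs.h2 N r := rfl

theorem th_e (y : ℕ) (m : SM hs.h1 N) (r : SM hs.h2 N) :
    th hs N (e k DS y • m, e k DR y • r) = e k D y • th hs N (m, r) := by
  rw [th_apply, th_apply, val_e, val_e, smul_add]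

theorem th_f (x : SM hs.h1 N × SM hs.h2 N) (y : ℕ) :
    th hs N (twF (dA hs N) (dB hs N) y x) = f k D y • th hs N x := by
  obtain ⟨m, r⟩ := x
  have h1 : ∀ z, z = P k D DS • z + P k D DR • (z : N) := by
    intro z; rw [← add_smul, hs.P_add, one_smul]
  rw [twF_apply, th_apply, th_apply, h1 (f k D y • _), map_add, map_add, val_f, val_f]
  change _ + P k D DS • f k D y • val hs.h2 N r + (_ + P k D DR • f k D y • val hs.h1 N m) = _
  simp only [smul_add]
  abel

theorem th_inj : Function.Injective (th hs N) := by
  rw [injective_iff_map_eq_zero]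
  rintro ⟨m, r⟩ hx
  rw [th_apply] at hx
  have h1 := congrArg (fun z => P k D DS • z) hx
  have h2 := congrArg (fun z => P k D DR • z) hx
  simp only [smul_add, smul_zero, val_mem] at h1 h2
  rw [← val_mem hs.h2 N r, ← mul_smul, hs.PQ, zero_smul, add_zero] at h1
  rw [← val_mem hs.h1 N m, ← mul_smul, hs.QP, zero_smul, zero_add] at h2
  ext
  · exact val_inj _ _ (h1.trans (map_zero _).symm)
  · exact val_inj _ _ (h2.trans (map_zero _).symm)

theorem th_surj : Function.Surjective (th hs N) := by
  intro n
  refine ⟨(mkS hs.h1 N (P k D DS • n) (by rw [← mul_smul, P_P]),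
    mkS hs.h2 N (P k D DR • n) (by rw [← mul_smul, P_P])), ?_⟩
  rw [th_apply, val_mkS, val_mkS, ← add_smul, hs.P_add, one_smul]

theorem decTwD : TwD D Br (dA hs N) (dB hs N) where
  A0 y hy m := by
    apply val_inj
    rw [map_zero]
    change P k D DR • f k D y • val hs.h1 N m = 0
    rw [← mul_smul, ← f_P hs.h2 hy, mul_smul, ← val_mem hs.h1 N m, ← mul_smul (P k D DR), hs.QP]
    simp
  B0 y hy m := by
    apply val_inj
    rw [map_zero]
    change P k D DS • f k D y • val hs.h2 N m = 0
    rw [← mul_smul, ← f_P hs.h1 hy, mul_smul, ← val_mem hs.h2 N m, ← mul_smul (P k D DS), hs.PQ]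
    simp
  As y hy m := by
    apply val_inj
    change P k D DR • f k D y • val hs.h1 N (_) = P k D DR • f k D y • val hs.h1 N m
    rw [val_e, f_s]
  Bs y hy m := by
    apply val_inj
    change P k D DS • f k D y • val hs.h2 N (_) = P k D DS • f k D y • val hs.h2 N m
    rw [val_e, f_s]
  At y hy m := by
    apply val_inj
    rw [val_e]
    change _ • P k D DR • f k D y • val hs.h1 N m = P k D DR • f k D y • val hs.h1 N m
    by_cases h : D.t y ∈ DR.L
    · rw [← mul_smul, e_P h, f_t, ← f_t, ← mul_smul (P k D DR), P_e h]
    · rw [← mul_smul, e_P' h, zero_smul, ← f_t, ← mul_smul (P k D DR), P_e' h, zero_smul]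
  Bt y hy m := by
    apply val_inj
    rw [val_e]
    change _ • P k D DS • f k D y • val hs.h2 N m = P k D DS • f k D y • val hs.h2 N m
    by_cases h : D.t y ∈ DS.L
    · rw [← mul_smul, e_P h, f_t, ← f_t, ← mul_smul (P k D DS), P_e h]
    · rw [← mul_smul, e_P' h, zero_smul, ← f_t, ← mul_smul (P k D DS), P_e' h, zero_smul]
  rel p hp x := by
    apply th_inj hs N
    rw [act_map (fun y => twF (dA hs N) (dB hs N) y) (fun y (n : N) => f k D y • n)
      (th hs N) p (fun y hy n => th_f hs N n y), f_r hp, map_zero]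

def dec : Tw hs (decTwD hs N) →ₗ[Alg k D] N :=
  Alg.hom ((th hs N).comp (twInj hs (decTwD hs N)).symm.toAddMonoidHom)
    (by
      intro c x
      obtain ⟨⟨m, r⟩, rfl⟩ := (twInj hs (decTwD hs N)).surjective x
      rw [tw_k]
      simp only [AddMonoidHom.comp_apply, AddEquiv.coe_toAddMonoidHom, AddEquiv.symm_apply_apply]
      rw [th_apply, th_apply, val_k, val_k, ← smul_add]; rfl)
    (by
      intro c x
      obtain ⟨⟨m, r⟩, rfl⟩ := (twInj hs (decTwD hs N)).surjective x
      rw [tw_e]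
      simp only [AddMonoidHom.comp_apply, AddEquiv.coe_toAddMonoidHom, AddEquiv.symm_apply_apply]
      rw [th_e])
    (by
      intro c x
      obtain ⟨⟨m, r⟩, rfl⟩ := (twInj hs (decTwD hs N)).surjective x
      rw [tw_f]
      simp only [AddMonoidHom.comp_apply, AddEquiv.coe_toAddMonoidHom, AddEquiv.symm_apply_apply]
      exact th_f hs N (m, r) c)

theorem dec_bij : Function.Bijective (dec hs N) :=
  ⟨(th_inj hs N).comp (twInj hs (decTwD hs N)).symm.injective,
   (th_surj hs N).comp (twInj hs (decTwD hs N)).symm.surjective⟩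

/-- `N` is isomorphic to its twisted decomposition. -/
noncomputable def decIso : Tw hs (decTwD hs N) ≅ N :=
  (LinearEquiv.ofBijective (dec hs N) (dec_bij hs N)).toModuleIso

end Split

set_option linter.unusedSectionVars false
set_option linter.unusedVariables false
open CategoryTheory
open scoped ModuleCat

/-- the list `c-i+1, …, c` -/
def chl (c : ℕ) : ℕ → List ℕ
  | 0 => []
  | (i + 1) => (c - i) :: chl c i

structure FlipD (Dp Dm DS DR : QD) (Br : Finset ℕ) (b c : ℕ) (u : ℕ → ℕ) : Prop where
  hp : Split Dp DS DR Br
  hm : Split Dm DS DR Br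
  bc : b ≤ c
  chain : ∀ x, b ≤ x → x ≤ c → x ∈ DS.L
  ch_s : ∀ y, b < y → y ≤ c → DS.s y = y - 1
  ch_t : ∀ y, b < y → y ≤ c → DS.t y = y
  p_s : ∀ a ∈ Br, Dp.s a = c
  p_t : ∀ a ∈ Br, Dp.t a = u a
  m_s : ∀ a ∈ Br, Dm.s a = u a
  m_t : ∀ a ∈ Br, Dm.t a = b
  into : ∀ y, ¬ (b < y ∧ y ≤ c) → b ≤ DS.t y → DS.t y ≤ c → DS.s y ∈ DS.L →
    DS.t y = b ∧ ∀ a ∈ Br, y :: (chl c (c - b) ++ [a]) ∈ Dp.Rel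
  outof : ∀ y, ¬ (b < y ∧ y ≤ c) → b ≤ DS.s y → DS.s y ≤ c → DS.t y ∉ DS.L
  relp : ∀ p ∈ Dp.Rel, (p ∈ DS.Rel ∧ p ∈ DR.Rel) ∨
    ∃ y a, a ∈ Br ∧ y ∉ Br ∧ ¬ (b < y ∧ y ≤ c) ∧ p = y :: (chl c (c - b) ++ [a])
  relm : ∀ p ∈ Dm.Rel, p ∈ DS.Rel ∧ p ∈ DR.Rel
  rel_ch : ∀ p ∈ DS.Rel, ∃ y ∈ p, ¬ (b < y ∧ y ≤ c)

namespace FlipD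
open Alg
variable {k : Type} [Field k] {Dp Dm DS DR : QD} {Br : Finset ℕ} {b c : ℕ} {u : ℕ → ℕ}

section G0
variable (k DR Br b c u) (R : ModuleCat.{0} (Alg k DR))

def gsub : Submodule k (ℕ → ℕ → R) where
  carrier := {v | (∀ x a, e k DR (u a) • v x a = v x a) ∧
    ∀ x a, ¬ (b ≤ x ∧ x ≤ c ∧ a ∈ Br) → v x a = 0}
  add_mem' := by
    rintro v w ⟨h1, h2⟩ ⟨h3, h4⟩
    refine ⟨fun x a => ?_, fun x a h => ?_⟩
    · simp [h1, h3]
    · simp [h2 x a h, h4 x a h]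
  zero_mem' := by
    refine ⟨fun x a => ?_, fun x a h => ?_⟩ <;> simp
  smul_mem' := by
    rintro d v ⟨h1, h2⟩
    refine ⟨fun x a => ?_, fun x a h => ?_⟩
    · simp only [Pi.smul_apply]; rw [smul_comm, h1]
    · simp [h2 x a h]

def gE (y : ℕ) : Module.End k (gsub k DR Br b c u R) where
  toFun v := ⟨fun x a => if x = y then v.1 x a else 0, by
    obtain ⟨v, h1, h2⟩ := v
    refine ⟨fun x a => ?_, fun x a h => ?_⟩
    · dsimp only; split_ifs; exacts [h1 x a, smul_zero _]
    · dsimp only; split_ifs; exacts [h2 x a h, rfl]⟩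
  map_add' := by intro v w; ext x a; simp only [Submodule.coe_add, Pi.add_apply]; split_ifs <;> simp
  map_smul' := by
    intro d v; ext x a
    simp only [Submodule.coe_smul, Pi.smul_apply, RingHom.id_apply]; split_ifs <;> simp

def gF (y : ℕ) : Module.End k (gsub k DR Br b c u R) where
  toFun v := ⟨fun x a => if x = y ∧ b < y ∧ y ≤ c then v.1 (y - 1) a else 0, by
    obtain ⟨v, h1, h2⟩ := v
    refine ⟨fun x a => ?_, fun x a h => ?_⟩
    · dsimp only; split_ifs; exacts [h1 _ a, smul_zero _]
    · dsimp only
      split_ifs with h3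
      · apply h2
        rintro ⟨_, _, h4⟩
        apply h
        refine ⟨?_, ?_, h4⟩ <;> omega
      · rfl⟩
  map_add' := by intro v w; ext x a; simp only [Submodule.coe_add, Pi.add_apply]; split_ifs <;> simp
  map_smul' := by
    intro d v; ext x a
    simp only [Submodule.coe_smul, Pi.smul_apply, RingHom.id_apply]; split_ifs <;> simp
end G0

section G1
variable (hf : FlipD Dp Dm DS DR Br b c u) (R : ModuleCat.{0} (Alg k DR))
include hf

theorem g_isRep : IsRep k DS (gE k DR Br b c u R) (gF k DR Br b c u R) where
  idem y v := by
    ext x a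
    change (if x = y then (if x = y then v.1 x a else 0) else 0) = (if x = y then v.1 x a else 0)
    split_ifs <;> rfl
  orth x y hxy v := by
    ext z a
    change (if z = x then (if z = y then v.1 z a else 0) else 0) = 0
    split_ifs with h1 h2
    · exact absurd (h1.symm.trans h2) hxy
    · rfl
    · rfl
  out y hy v := by
    ext z a
    change (if z = y then v.1 z a else 0) = 0
    split_ifs with h1
    · subst h1
      exact v.2.2 _ _ fun h => hy (hf.chain _ h.1 h.2.1)
    · rfl
  unit v := by
    ext z a
    rw [AddSubmonoidClass.coe_finsetSum, Finset.sum_apply, Finset.sum_apply]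
    change ∑ y ∈ DS.L, (if z = y then v.1 z a else 0) = _
    rw [Finset.sum_ite_eq]
    split_ifs with h
    · rfl
    · exact (v.2.2 _ _ fun h' => h (hf.chain _ h'.1 h'.2.1)).symm
  src y v := by
    ext z a
    change (if z = y ∧ b < y ∧ y ≤ c then (if y - 1 = DS.s y then v.1 (y - 1) a else 0) else 0) =
      (if z = y ∧ b < y ∧ y ≤ c then v.1 (y - 1) a else 0)
    split_ifs with h1 h2
    · rfl
    · exact absurd (hf.ch_s y h1.2.1 h1.2.2).symm h2
    · rfl
  tgt y v := by
    ext z a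
    change (if z = DS.t y then (if z = y ∧ b < y ∧ y ≤ c then v.1 (y - 1) a else 0) else 0) =
      (if z = y ∧ b < y ∧ y ≤ c then v.1 (y - 1) a else 0)
    split_ifs with h1 h2 h2
    · rfl
    · rfl
    · exact absurd (h2.1.trans (hf.ch_t y h2.2.1 h2.2.2).symm) h1
    · rfl
  rel p hp v := by
    obtain ⟨y, hy, hy'⟩ := hf.rel_ch p hp
    refine act_zero_of_mem _ (fun y => map_zero _) p y hy ?_ v
    intro w
    ext z a
    change (if z = y ∧ b < y ∧ y ≤ c then w.1 (y - 1) a else 0) = 0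
    rw [if_neg fun h => hy' h.2]

def gobj : ModuleCat.{0} (Alg k DS) := ModuleCat.of _ (RepMod (g_isRep hf R))

def ev (x a : ℕ) : gobj hf R →+ R :=
  (Pi.evalAddMonoidHom (fun _ => R) a).comp ((Pi.evalAddMonoidHom (fun _ => ℕ → R) x).comp
    ((gsub k DR Br b c u R).subtype.toAddMonoidHom.comp
      (RepMod.inj (g_isRep hf R)).symm.toAddMonoidHom))

def mkG (v : ℕ → ℕ → R) (h1 : ∀ x a, e k DR (u a) • v x a = v x a)
    (h2 : ∀ x a, ¬ (b ≤ x ∧ x ≤ c ∧ a ∈ Br) → v x a = 0) : gobj hf R :=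
  RepMod.inj (g_isRep hf R) ⟨v, h1, h2⟩

theorem ev_mkG (v : ℕ → ℕ → R) (h1 h2) (x a : ℕ) : ev hf R x a (mkG hf R v h1 h2) = v x a := rfl
variable {R} in
theorem g_ext {v w : gobj hf R} (h : ∀ x a, ev hf R x a v = ev hf R x a w) : v = w :=
  Subtype.ext (funext fun x => funext fun a => h x a)
theorem ev_u (x a : ℕ) (v : gobj hf R) : e k DR (u a) • ev hf R x a v = ev hf R x a v :=
  (Subtype.prop (p := fun n => n ∈ gsub k DR Br b c u R) v).1 x a
theorem ev_out (x a : ℕ) (v : gobj hf R) (h : ¬ (b ≤ x ∧ x ≤ c ∧ a ∈ Br)) : ev hf R x a v = 0 :=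
  (Subtype.prop (p := fun n => n ∈ gsub k DR Br b c u R) v).2 x a h
theorem ev_e (x a y : ℕ) (v : gobj hf R) :
    ev hf R x a (e k DS y • v) = if x = y then ev hf R x a v else 0 :=
  congrArg (ev hf R x a) (RepMod.e_smul' (g_isRep hf R) y v)
theorem ev_f (x a y : ℕ) (v : gobj hf R) :
    ev hf R x a (f k DS y • v) = if x = y ∧ b < y ∧ y ≤ c then ev hf R (y - 1) a v else 0 :=
  congrArg (ev hf R x a) (RepMod.f_smul' (g_isRep hf R) y v)
theorem ev_k (x a : ℕ) (d : k) (v : gobj hf R) :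
    ev hf R x a (d • v) = d • ev hf R x a v :=
  congrArg (ev hf R x a) (RepMod.k_smul' (g_isRep hf R) d v)

variable {R} {R' : ModuleCat.{0} (Alg k DR)}

def gmap0 (g : R →ₗ[Alg k DR] R') : gobj hf R →+ gobj hf R' where
  toFun v := mkG hf R' (fun x a => g (ev hf R x a v))
    (fun x a => by rw [← map_smul, ev_u]) (fun x a h => by rw [ev_out hf R x a v h, map_zero])
  map_zero' := by apply g_ext; intro x a; simp [ev_mkG]
  map_add' := by intro v w; apply g_ext; intro x a; simp [ev_mkG]

theorem ev_gmap0 (g : R →ₗ[Alg k DR] R') (x a : ℕ) (v : gobj hf R) :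
    ev hf R' x a (gmap0 hf g v) = g (ev hf R x a v) := rfl

def gmap (g : R →ₗ[Alg k DR] R') : gobj hf R →ₗ[Alg k DS] gobj hf R' :=
  Alg.hom (gmap0 hf g)
    (by
      intro d v; apply g_ext; intro x a
      rw [ev_gmap0]
      change g (ev hf R x a (d • v)) = ev hf R' x a (d • _)
      rw [ev_k, ev_k, ev_gmap0, Split.hom_k])
    (by
      intro d v; apply g_ext; intro x a
      rw [ev_gmap0, ev_e, ev_e, ev_gmap0]
      split_ifs <;> simp)
    (by
      intro d v; apply g_ext; intro x a
      rw [ev_gmap0, ev_f, ev_f, ev_gmap0]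
      split_ifs <;> simp)

theorem ev_gmap (g : R →ₗ[Alg k DR] R') (x a : ℕ) (v : gobj hf R) :
    ev hf R' x a (gmap hf g v) = g (ev hf R x a v) := rfl

variable (k) in
def G : ModuleCat.{0} (Alg k DR) ⥤ ModuleCat.{0} (Alg k DS) where
  obj R := gobj hf R
  map g := ModuleCat.ofHom (gmap hf g.hom)
  map_id R := by ext v; apply g_ext hf; intro x a; rfl
  map_comp g h := by ext v; apply g_ext hf; intro x a; rfl

theorem ev_Gmap (g : R ⟶ R') (x a : ℕ) (v : gobj hf R) :
    ev hf R' x a (((G k hf).map g).hom v) = g.hom (ev hf R x a v) := rfl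

theorem G_ex : Ex (G k hf) := by
  have : (G k hf).Additive := ⟨by
    intro X Y g h
    ext v
    refine g_ext hf fun x a => ?_
    exact ((ev hf Y x a).map_add (((G k hf).map g).hom v) (((G k hf).map h).hom v)).symm⟩
  have h := ((Functor.exact_tfae (G k hf)).out 1 3).1 (by
    intro S hS
    rw [ShortComplex.moduleCat_exact_iff] at hS ⊢
    intro v hv
    change gobj hf S.X₂ at v
    have h1 : ∀ x a, ∃ w : S.X₁, S.f.hom w = ev hf S.X₂ x a v := by
      intro x a
      apply hS
      have := congrArg (ev hf S.X₃ x a) hv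
      exact this.trans (map_zero (ev hf S.X₃ x a))
    choose w hw using h1
    refine ⟨mkG hf S.X₁ (fun x a => if b ≤ x ∧ x ≤ c ∧ a ∈ Br then e k DR (u a) • w x a else 0)
      ?_ ?_, ?_⟩
    · intro x a
      split_ifs
      · exact e_e _ _
      · exact smul_zero _
    · intro x a h
      rw [if_neg h]
    · apply g_ext
      intro x a
      change S.f.hom (if b ≤ x ∧ x ≤ c ∧ a ∈ Br then e k DR (u a) • w x a else 0) = _
      split_ifs with h
      · rw [map_smul, hw, ev_u]
      · rw [map_zero, ev_out hf _ x a v h])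
  have := h.1
  have := h.2
  exact Ex.mk' _

end G1
end FlipD

set_option linter.unusedSectionVars false
set_option linter.unusedVariables false
open CategoryTheory
open scoped ModuleCat

theorem mem_chl {c b : ℕ} (hb : b ≤ c) : ∀ i, i ≤ c - b → ∀ y ∈ chl c i, b < y ∧ y ≤ c := by
  intro i
  induction i with
  | zero => intro _ y hy; simp [chl] at hy
  | succ i ih =>
    intro hi y hy
    rcases List.mem_cons.1 hy with rfl | h
    · omega
    · exact ih (by omega) y h

namespace Split
open Alg
variable {k : Type} [Field k] {D DS DR : QD} {Br : Finset ℕ} (hs : Split D DS DR Br)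
variable {M : ModuleCat.{0} (Alg k DS)} {R : ModuleCat.{0} (Alg k DR)}
variable {A : ℕ → M →ₗ[k] R} {B : ℕ → R →ₗ[k] M}

theorem act_nbr (A0 : ∀ y, y ∉ Br → ∀ m, A y m = 0) (B0 : ∀ y, y ∉ Br → ∀ r, B y r = 0)
    (p : List ℕ) (hp : ∀ y ∈ p, y ∉ Br) (x : M × R) :
    act (fun y => twF A B y) p x =
      (act (fun y (n : M) => f k DS y • n) p x.1, act (fun y (n : R) => f k DR y • n) p x.2) := by
  ext
  · apply act_map _ _ Prod.fst
    intro y hy n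
    change f k DS y • n.1 + B y n.2 = _
    rw [B0 y (hp y hy), add_zero]
  · apply act_map _ _ Prod.snd
    intro y hy n
    change f k DR y • n.2 + A y n.1 = _
    rw [A0 y (hp y hy), add_zero]

include hs in
theorem rel_common (A0 : ∀ y, y ∉ Br → ∀ m, A y m = 0) (B0 : ∀ y, y ∉ Br → ∀ r, B y r = 0)
    (p : List ℕ) (h1 : p ∈ DS.Rel) (h2 : p ∈ DR.Rel) (x : M × R) :
    act (fun y => twF A B y) p x = 0 := by
  rw [act_nbr A0 B0 p (hs.h1.rel_br p h1), f_r h1, f_r h2]; rfl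

theorem twIso {A' : ℕ → M →ₗ[k] R} {B' : ℕ → R →ₗ[k] M} (h : TwD D Br A B) (h' : TwD D Br A' B')
    (hA : ∀ y m, A y m = A' y m) (hB : ∀ y r, B y r = B' y r) : Nonempty (Tw hs h ≅ Tw hs h') := by
  obtain rfl : A = A' := funext fun y => LinearMap.ext (hA y)
  obtain rfl : B = B' := funext fun y => LinearMap.ext (hB y)
  exact ⟨Iso.refl _⟩
end Split

namespace FlipD
open Alg Split
variable {k : Type} [Field k] {Dp Dm DS DR : QD} {Br : Finset ℕ} {b c : ℕ} {u : ℕ → ℕ}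
variable (k DS c) in
def W (i : ℕ) : Alg k DS := ((chl c i).map (f k DS)).reverse.prod

theorem W_succ (i : ℕ) : W k DS c (i + 1) = W k DS c i * f k DS (c - i) := by
  simp [W, chl]

variable (hf : FlipD Dp Dm DS DR Br b c u)
include hf

theorem ch_nbr {y : ℕ} (h1 : b < y) (h2 : y ≤ c) : y ∉ Br := by
  intro hy
  rcases hf.hp.h1.dead y hy with h | h
  · rw [hf.ch_s y h1 h2] at h
    exact h (hf.chain _ (by omega) (by omega))
  · rw [hf.ch_t y h1 h2] at h
    exact h (hf.chain _ (by omega) (by omega))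

variable {M : ModuleCat.{0} (Alg k DS)} {R : ModuleCat.{0} (Alg k DR)}

theorem ev_act (a : ℕ) : ∀ i, i ≤ c - b → ∀ v : gobj hf R,
    ev hf R c a (act (fun y (n : gobj hf R) => f k DS y • n) (chl c i) v) = ev hf R (c - i) a v := by
  intro i
  induction i with
  | zero => intro _ v; rfl
  | succ i ih =>
    intro hi v
    rw [chl, act_cons, ih (by omega), ev_f, if_pos ⟨rfl, by omega, by omega⟩]
    congr 2

theorem act_special (A : ℕ → M →ₗ[k] R) (A0 : ∀ y, y ∉ Br → ∀ m, A y m = 0)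
    (y a : ℕ) (hy : y ∉ Br) (ha : a ∈ Br) (m : M) (r : R) :
    act (fun y => twF A (0 : ℕ → R →ₗ[k] M) y) (y :: (chl c (c - b) ++ [a])) (m, r) =
      (0, A a (act (fun y (n : M) => f k DS y • n) (chl c (c - b)) (f k DS y • m))) := by
  have hz : ∀ z ∈ y :: chl c (c - b), z ∉ Br := by
    intro z hz
    rcases List.mem_cons.1 hz with rfl | h
    · exact hy
    · have := mem_chl hf.bc _ le_rfl z h
      exact hf.ch_nbr this.1 this.2
  have h1 := act_nbr (B := 0) A0 (fun _ _ _ => rfl) (y :: chl c (c - b)) hz (m, r)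
  rw [← List.cons_append, act_append, h1]
  refine (twF_apply A 0 a _ _).trans ?_
  rw [f_d (hf.hp.h1.dead a ha), f_d (hf.hp.h2.dead a ha), zero_add, zero_add]
  rfl

def pA (α : M →ₗ[Alg k DS] gobj hf R) (y : ℕ) : M →ₗ[k] R where
  toFun m := ev hf R c y (α m)
  map_add' := by intros; simp
  map_smul' := by intro d m; rw [hom_k, ev_k]; rfl

theorem pA_apply (α : M →ₗ[Alg k DS] gobj hf R) (y : ℕ) (m : M) :
    pA hf α y m = ev hf R c y (α m) := rfl

theorem act_lin {M M' : ModuleCat.{0} (Alg k DS)} (α : M →ₗ[Alg k DS] M') (p : List ℕ) (m : M) :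
    α (act (fun y (n : M) => f k DS y • n) p m) = act (fun y (n : M') => f k DS y • n) p (α m) :=
  act_map (fun y (n : M) => f k DS y • n) (fun y (n : M') => f k DS y • n) α p
    (fun y _ n => map_smul _ _ _) m

theorem pTwD (α : M →ₗ[Alg k DS] gobj hf R) : TwD Dp Br (pA hf α) (0 : ℕ → R →ₗ[k] M) := by
  have A0 : ∀ y, y ∉ Br → ∀ m, pA hf α y m = 0 := fun y hy m => ev_out _ _ _ _ _ fun h => hy h.2.2
  constructor
  · exact A0
  · intros; rfl
  · intro y hy m
    rw [pA_apply, map_smul, ev_e, hf.p_s y hy, if_pos rfl]; rfl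
  · intro y hy m
    rw [pA_apply, hf.p_t y hy, ev_u]
  · intros; rfl
  · intros; simp
  · intro p hp x
    rcases hf.relp p hp with h | ⟨y, a, ha, hy, hyc, rfl⟩
    · exact rel_common hf.hp A0 (fun _ _ _ => rfl) p h.1 h.2 x
    · obtain ⟨m, r⟩ := x
      rw [act_special hf _ A0 y a hy ha, pA_apply, act_lin hf, ev_act hf a _ le_rfl, map_smul, ev_f,
        if_neg fun h => hyc h.2]
      rfl

section full
variable {M' : ModuleCat.{0} (Alg k DS)} {R' : ModuleCat.{0} (Alg k DR)}

theorem p_nat (α : M →ₗ[Alg k DS] gobj hf R) (α' : M' →ₗ[Alg k DS] gobj hf R')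
    (g : M →ₗ[Alg k DS] M') (h : R →ₗ[Alg k DR] R')
    (hA : ∀ y m, h (pA hf α y m) = pA hf α' y (g m)) (m : M) : α' (g m) = gmap hf h (α m) := by
  apply g_ext
  intro x a
  rw [ev_gmap]
  by_cases hx : b ≤ x ∧ x ≤ c ∧ a ∈ Br
  · have e1 := fun v : gobj hf R => ev_act hf a (c - x) (by omega) v
    have e2 := fun v : gobj hf R' => ev_act hf a (c - x) (by omega) v
    rw [show c - (c - x) = x by omega] at e1 e2
    rw [← e1, ← e2, ← act_lin hf, ← act_lin hf, ← act_lin hf, ← pA_apply, ← pA_apply, hA]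
  · rw [ev_out hf _ _ _ _ hx, ev_out hf _ _ _ _ hx, map_zero]
end full

def pa (X : Comma (𝟭 (ModuleCat.{0} (Alg k DS))) (G k hf)) :
    X.left →ₗ[Alg k DS] gobj hf X.right := X.hom.hom

theorem pa_w {X Y : Comma (𝟭 (ModuleCat.{0} (Alg k DS))) (G k hf)} (φ : X ⟶ Y) (m : X.left) :
    pa hf Y (φ.left.hom m) = gmap hf φ.right.hom (pa hf X m) :=
  congrArg (fun q => q.hom m) φ.w

theorem p_hA {X Y : Comma (𝟭 (ModuleCat.{0} (Alg k DS))) (G k hf)} (φ : X ⟶ Y) (y : ℕ)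
    (m : X.left) : φ.right.hom (pA hf (pa hf X) y m) = pA hf (pa hf Y) y (φ.left.hom m) := by
  rw [pA_apply, pA_apply, pa_w, ev_gmap]

theorem p_hB {X Y : Comma (𝟭 (ModuleCat.{0} (Alg k DS))) (G k hf)} (φ : X ⟶ Y) (y : ℕ)
    (r : X.right) : φ.left.hom ((0 : ℕ → X.right →ₗ[k] X.left) y r) =
      (0 : ℕ → Y.right →ₗ[k] Y.left) y (φ.right.hom r) := by simp

def pmap {X Y : Comma (𝟭 (ModuleCat.{0} (Alg k DS))) (G k hf)} (φ : X ⟶ Y) :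
    Tw hf.hp (pTwD hf (pa hf X)) →ₗ[Alg k Dp] Tw hf.hp (pTwD hf (pa hf Y)) :=
  twMap hf.hp (pTwD hf (pa hf X)) (pTwD hf (pa hf Y))
    φ.left.hom φ.right.hom (p_hA hf φ) (p_hB hf φ)

theorem pmap_apply {X Y : Comma (𝟭 (ModuleCat.{0} (Alg k DS))) (G k hf)} (φ : X ⟶ Y) (m : X.left)
    (r : X.right) : pmap hf φ (twInj hf.hp (pTwD hf (pa hf X)) (m, r)) =
      twInj hf.hp (pTwD hf (pa hf Y)) (φ.left.hom m, φ.right.hom r) :=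
  twMap_apply hf.hp (pTwD hf (pa hf X)) (pTwD hf (pa hf Y))
    φ.left.hom φ.right.hom (p_hA hf φ) (p_hB hf φ) m r

variable (k) in
def Tp : Comma (𝟭 (ModuleCat.{0} (Alg k DS))) (G k hf) ⥤ ModuleCat.{0} (Alg k Dp) where
  obj X := Tw hf.hp (pTwD hf (pa hf X))
  map {X Y} φ := ModuleCat.ofHom (pmap hf φ)
  map_id X := by
    apply ModuleCat.hom_ext
    apply LinearMap.ext
    intro x
    obtain ⟨⟨m, r⟩, rfl⟩ := (twInj hf.hp (pTwD hf (pa hf X))).surjective x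
    exact pmap_apply hf (𝟙 X) m r
  map_comp {X Y Z} φ ψ := by
    apply ModuleCat.hom_ext
    apply LinearMap.ext
    intro x
    obtain ⟨⟨m, r⟩, rfl⟩ := (twInj hf.hp (pTwD hf (pa hf X))).surjective x
    refine (pmap_apply hf (φ ≫ ψ) m r).trans (Eq.symm ?_)
    exact (congrArg (pmap hf ψ) (pmap_apply hf φ m r)).trans (pmap_apply hf ψ _ _)

theorem Tp_map {X Y : Comma (𝟭 (ModuleCat.{0} (Alg k DS))) (G k hf)} (φ : X ⟶ Y) (m : X.left)
    (r : X.right) : ((Tp k hf).map φ).hom (twInj hf.hp (pTwD hf (pa hf X)) (m, r)) =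
      twInj hf.hp (pTwD hf (pa hf Y)) (φ.left.hom m, φ.right.hom r) :=
  pmap_apply hf φ m r

theorem Tp_faithful : (Tp k hf).Faithful := ⟨by
  intro X Y φ ψ h
  have key : ∀ m r, (φ.left.hom m, φ.right.hom r) = (ψ.left.hom m, ψ.right.hom r) := by
    intro m r
    apply (twInj hf.hp (pTwD hf (pa hf Y))).injective
    rw [← Tp_map, ← Tp_map, h]
  ext m
  · exact congrArg Prod.fst (key m 0)
  · exact congrArg Prod.snd (key 0 m)⟩

theorem Tp_full : (Tp k hf).Full := ⟨by
  intro X Y φ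
  obtain ⟨g, h, h1, h2, h3⟩ := tw_full hf.hp (pTwD hf (pa hf X)) (pTwD hf (pa hf Y)) φ.hom
  refine ⟨{ left := ModuleCat.ofHom g, right := ModuleCat.ofHom h, w := ?_ }, ?_⟩
  · apply ModuleCat.hom_ext
    apply LinearMap.ext
    intro m
    exact p_nat hf (pa hf X) (pa hf Y) g h h2 m
  · apply ModuleCat.hom_ext
    apply LinearMap.ext
    intro x
    obtain ⟨⟨m, r⟩, rfl⟩ := (twInj hf.hp (pTwD hf (pa hf X))).surjective x
    rw [Tp_map]
    exact (h1 m r).symm⟩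

section ess
variable (A : ℕ → M →ₗ[k] R) (B : ℕ → R →ₗ[k] M) (h : TwD Dp Br A B)
include h

theorem p_B0 : B = 0 := by
  funext y
  ext r
  by_cases hy : y ∈ Br
  · rw [← h.Bs y hy, hf.p_s y hy, e_o (hf.hp.disj _ (hf.chain _ hf.bc le_rfl))]; simp
  · rw [h.B0 y hy]; rfl

def pal0 : M →+ gobj hf R where
  toFun m := mkG hf R
    (fun x a => if b ≤ x ∧ x ≤ c ∧ a ∈ Br then A a (W k DS c (c - x) • e k DS x • m) else 0)
    (by
      intro x a
      split_ifs with hx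
      · rw [← hf.p_t a hx.2.2, h.At a hx.2.2]
      · simp)
    (by intro x a hx; rw [if_neg hx])
  map_zero' := by apply g_ext; intro x a; rw [ev_mkG]; simp
  map_add' := by
    intro m m'; apply g_ext; intro x a; rw [map_add, ev_mkG, ev_mkG, ev_mkG]
    split_ifs <;> simp

theorem ev_pal0 (x a : ℕ) (m : M) : ev hf R x a (pal0 hf A B h m) =
    if b ≤ x ∧ x ≤ c ∧ a ∈ Br then A a (W k DS c (c - x) • e k DS x • m) else 0 := rfl

def pal : M →ₗ[Alg k DS] gobj hf R := Alg.hom (pal0 hf A B h)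
  (by
    intro d m; apply g_ext; intro x a
    change ev hf R x a (pal0 hf A B h (d • m)) = ev hf R x a (d • _)
    rw [ev_k, ev_pal0, ev_pal0]
    split_ifs
    · rw [smul_comm _ d, smul_comm _ d, map_smul]
    · simp)
  (by
    intro y m; apply g_ext; intro x a
    rw [ev_e, ev_pal0, ev_pal0]
    by_cases hxy : x = y
    · subst hxy; rw [e_e, if_pos rfl]
    · rw [e_ne hxy, if_neg hxy]; simp)
  (by
    intro y m; apply g_ext; intro x a
    rw [ev_f, ev_pal0]
    by_cases hc : x = y ∧ b < y ∧ y ≤ c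
    · obtain ⟨rfl, h1, h2⟩ := hc
      rw [if_pos (⟨rfl, h1, h2⟩ : x = x ∧ b < x ∧ x ≤ c), ev_pal0]
      by_cases ha : a ∈ Br
      · rw [if_pos (⟨by omega, by omega, ha⟩ : b ≤ x ∧ x ≤ c ∧ a ∈ Br),
          if_pos (⟨by omega, by omega, ha⟩ : b ≤ x - 1 ∧ x - 1 ≤ c ∧ a ∈ Br)]
        have e1 := f_t (k := k) (D := DS) x m
        have e2 := f_s (k := k) (D := DS) x m
        rw [hf.ch_t x h1 h2] at e1
        rw [hf.ch_s x h1 h2] at e2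
        rw [e1, show c - (x - 1) = (c - x) + 1 by omega, W_succ, show c - (c - x) = x by omega,
          mul_smul, e2]
      · rw [if_neg fun h => ha h.2.2, if_neg fun h => ha h.2.2]
    · rw [if_neg hc]
      split_ifs with hx
      · by_cases hxt : x = DS.t y
        · have hyc : ¬ (b < y ∧ y ≤ c) := by
            rintro ⟨h1, h2⟩
            exact hc ⟨hxt.trans (hf.ch_t y h1 h2), h1, h2⟩
          by_cases hs : DS.s y ∈ DS.L
          · obtain ⟨h1, h2⟩ := hf.into y hyc (hxt ▸ hx.1) (hxt ▸ hx.2.1) hs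
            have hy : y ∉ Br := by
              intro hy
              rcases hf.hp.h1.dead y hy with h' | h'
              · exact h' hs
              · rw [← hxt] at h'; exact h' (hf.chain x hx.1 hx.2.1)
            have := h.rel _ (h2 a hx.2.2) (m, 0)
            rw [p_B0 hf A B h, act_special hf A h.A0 y a hy hx.2.2] at this
            have h3 := congrArg Prod.snd this
            rw [act_f] at h3
            rw [hxt, f_t, h1]
            exact h3
          · rw [f_d (Or.inl hs)]; simp
        · rw [e_f_ne hxt]; simp
      · rfl)

theorem ev_pal (a : ℕ) (m : M) : ev hf R c a (pal hf A B h m) = A a m := by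
  change ev hf R c a (pal0 hf A B h m) = A a m
  rw [ev_pal0]
  by_cases ha : a ∈ Br
  · rw [if_pos ⟨hf.bc, le_rfl, ha⟩, Nat.sub_self]
    simp only [W, chl, List.map_nil, List.reverse_nil, List.prod_nil, one_smul]
    rw [← hf.p_s a ha, h.As a ha]
  · rw [if_neg fun h => ha h.2.2, h.A0 a ha]

theorem Tp_ess0 : ∃ X, Nonempty ((Tp k hf).obj X ≅ Tw hf.hp h) := by
  let X : Comma (𝟭 (ModuleCat.{0} (Alg k DS))) (G k hf) :=
    { left := M, right := R, hom := ModuleCat.ofHom (pal hf A B h) }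
  refine ⟨X, twIso hf.hp (pTwD hf (pa hf X)) h ?_ ?_⟩
  · intro y m
    exact ev_pal hf A B h y m
  · intro y r
    rw [p_B0 hf A B h]
end ess

theorem Tp_ess : (Tp k hf).EssSurj := ⟨by
  intro N
  obtain ⟨X, ⟨i⟩⟩ := Tp_ess0 hf _ _ (decTwD hf.hp N)
  exact ⟨X, ⟨i ≪≫ decIso hf.hp N⟩⟩⟩

theorem Tp_equiv : (Tp k hf).IsEquivalence := by
  have := Tp_faithful (k := k) hf
  have := Tp_full (k := k) hf
  have := Tp_ess (k := k) hf
  exact {}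

end FlipD

set_option linter.unusedSectionVars false
set_option linter.unusedVariables false
open CategoryTheory
open scoped ModuleCat

namespace FlipD
open Alg Split
variable {k : Type} [Field k] {Dp Dm DS DR : QD} {Br : Finset ℕ} {b c : ℕ} {u : ℕ → ℕ}

variable (k DS b) in
/-- the product `f (b+i) ⋯ f (b+1)` -/
def Vw : ℕ → Alg k DS
  | 0 => 1
  | (i + 1) => f k DS (b + i + 1) * Vw i

variable (hf : FlipD Dp Dm DS DR Br b c u)
include hf
variable {M : ModuleCat.{0} (Alg k DS)} {R : ModuleCat.{0} (Alg k DR)}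

theorem e_Vw {m : M} (hm : e k DS b • m = m) (i : ℕ) (hi : b + i ≤ c) :
    e k DS (b + i) • Vw k DS b i • m = Vw k DS b i • m := by
  cases i with
  | zero => simp only [Vw, one_smul, add_zero, hm]
  | succ i =>
    have := f_t (k := k) (D := DS) (b + i + 1) (Vw k DS b i • m)
    rw [hf.ch_t _ (by omega) (by omega)] at this
    simp only [Vw, mul_smul]
    exact this

section dl
variable (R) in
def dl (a : ℕ) (r : R) : gobj hf R := mkG hf R
  (fun x a' => if x = b ∧ a' = a ∧ a ∈ Br then e k DR (u a) • r else 0)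
  (by
    intro x a'
    split_ifs with h
    · rw [h.2.1, e_e]
    · simp)
  (by
    intro x a' h
    rw [if_neg]
    rintro ⟨rfl, rfl, h3⟩
    exact h ⟨le_rfl, hf.bc, h3⟩)

theorem ev_dl (a : ℕ) (r : R) (x a' : ℕ) : ev hf R x a' (dl hf R a r) =
    if x = b ∧ a' = a ∧ a ∈ Br then e k DR (u a) • r else 0 := rfl

theorem ev_Vdl (a : ℕ) (r : R) : ∀ i, b + i ≤ c → ∀ (x a' : ℕ),
    ev hf R x a' (Vw k DS b i • dl hf R a r) =
    if x = b + i ∧ a' = a ∧ a ∈ Br then e k DR (u a) • r else 0 := by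
  intro i
  induction i with
  | zero => intro _ x a'; simp only [Vw, one_smul, add_zero, ev_dl]
  | succ i ih =>
    intro hi x a'
    simp only [Vw, mul_smul]
    rw [ev_f, ih (by omega)]
    by_cases hx : x = b + i + 1
    · rw [if_pos ⟨hx, by omega, by omega⟩]
      congr 1
      apply propext
      constructor
      · rintro ⟨_, h⟩; exact ⟨by omega, h⟩
      · rintro ⟨_, h⟩; exact ⟨by omega, h⟩
    · rw [if_neg fun h => hx h.1, if_neg fun h => hx (by omega)]

theorem g_dec (v : gobj hf R) :
    v = ∑ x ∈ Finset.Icc b c, ∑ a ∈ Br, Vw k DS b (x - b) • dl hf R a (ev hf R x a v) := by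
  apply g_ext
  intro x' a'
  rw [map_sum]
  have h1 : ∀ x ∈ Finset.Icc b c,
      ev hf R x' a' (∑ a ∈ Br, Vw k DS b (x - b) • dl hf R a (ev hf R x a v)) =
      if x' = x then ev hf R x' a' v else 0 := by
    intro x hx
    rw [Finset.mem_Icc] at hx
    rw [map_sum]
    have h2 : ∀ a ∈ Br, ev hf R x' a' (Vw k DS b (x - b) • dl hf R a (ev hf R x a v)) =
        if a' = a then (if x' = x then ev hf R x' a' v else 0) else 0 := by
      intro a ha
      rw [ev_Vdl hf a _ _ (by omega), ev_u]
      by_cases h3 : a' = a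
      · by_cases h4 : x' = x
        · rw [if_pos ⟨by omega, h3, ha⟩, if_pos h3, if_pos h4, h3, h4]
        · rw [if_neg fun h => h4 (by omega), if_pos h3, if_neg h4]
      · rw [if_neg fun h => h3 h.2.1, if_neg h3]
    rw [Finset.sum_congr rfl h2, Finset.sum_ite_eq]
    split_ifs with h3 h4
    · rfl
    · rfl
    · exact (ev_out hf _ _ _ _ fun h => h3 h.2.2).symm
    · rfl
  rw [Finset.sum_congr rfl h1, Finset.sum_ite_eq]
  split_ifs with h3
  · rfl
  · exact ev_out hf _ _ _ _ fun h => h3 (Finset.mem_Icc.2 ⟨h.1, h.2.1⟩)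

theorem dl_add (a : ℕ) (r r' : R) : dl hf R a (r + r') = dl hf R a r + dl hf R a r' := by
  apply g_ext; intro x a'; rw [map_add, ev_dl, ev_dl, ev_dl]; split_ifs <;> simp

theorem dl_k (a : ℕ) (d : k) (r : R) : dl hf R a (d • r) = d • dl hf R a r := by
  apply g_ext; intro x a'; rw [ev_k, ev_dl, ev_dl]
  split_ifs
  · rw [smul_comm]
  · simp

theorem dl_out {a : ℕ} (ha : a ∉ Br) (r : R) : dl hf R a r = 0 := by
  apply g_ext; intro x a'; rw [map_zero, ev_dl, if_neg fun h => ha h.2.2]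

theorem dl_e (a : ℕ) (r : R) : dl hf R a (e k DR (u a) • r) = dl hf R a r := by
  apply g_ext; intro x a'; rw [ev_dl, ev_dl, e_e]

theorem e_dl (a : ℕ) (r : R) : e k DS b • dl hf R a r = dl hf R a r := by
  apply g_ext; intro x a'; rw [ev_e, ev_dl]
  split_ifs with h1 h2 h2
  · rfl
  · rfl
  · exact absurd h2.1 h1
  · rfl
end dl

def mB (β : gobj hf R →ₗ[Alg k DS] M) (y : ℕ) : R →ₗ[k] M where
  toFun r := β (dl hf R y r)
  map_add' := by intro r r'; rw [dl_add, map_add]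
  map_smul' := by intro d r; rw [dl_k, hom_k]; rfl

theorem mB_apply (β : gobj hf R →ₗ[Alg k DS] M) (y : ℕ) (r : R) :
    mB hf β y r = β (dl hf R y r) := rfl

theorem mTwD (β : gobj hf R →ₗ[Alg k DS] M) : TwD Dm Br (0 : ℕ → M →ₗ[k] R) (mB hf β) := by
  have B0 : ∀ y, y ∉ Br → ∀ r, mB hf β y r = 0 := fun y hy r => by
    rw [mB_apply, dl_out hf hy, map_zero]
  constructor
  · intros; rfl
  · exact B0
  · intros; rfl
  · intros; simp
  · intro y hy r
    rw [mB_apply, hf.m_s y hy, dl_e]; rfl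
  · intro y hy r
    rw [mB_apply, hf.m_t y hy, ← map_smul, e_dl]
  · intro p hp x
    have h := hf.relm p hp
    exact rel_common hf.hm (fun _ _ _ => rfl) B0 p h.1 h.2 x

section full
variable {M' : ModuleCat.{0} (Alg k DS)} {R' : ModuleCat.{0} (Alg k DR)}

theorem m_nat (β : gobj hf R →ₗ[Alg k DS] M) (β' : gobj hf R' →ₗ[Alg k DS] M')
    (g : M →ₗ[Alg k DS] M') (h : R →ₗ[Alg k DR] R')
    (hB : ∀ y r, g (mB hf β y r) = mB hf β' y (h r)) (v : gobj hf R) :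
    g (β v) = β' (gmap hf h v) := by
  conv_lhs => rw [g_dec hf v]
  conv_rhs => rw [g_dec hf (gmap hf h v)]
  simp only [map_sum, map_smul, ev_gmap]
  refine Finset.sum_congr rfl fun x _ => Finset.sum_congr rfl fun a _ => ?_
  exact congrArg _ (hB a _)

theorem dl_gmap (h : R →ₗ[Alg k DR] R') (y : ℕ) (r : R) :
    gmap hf h (dl hf R y r) = dl hf R' y (h r) := by
  apply g_ext; intro x a; rw [ev_gmap, ev_dl, ev_dl]; split_ifs <;> simp
end full

def ma (X : Comma (G k hf) (𝟭 (ModuleCat.{0} (Alg k DS)))) :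
    gobj hf X.left →ₗ[Alg k DS] X.right := X.hom.hom

theorem ma_w {X Y : Comma (G k hf) (𝟭 (ModuleCat.{0} (Alg k DS)))} (φ : X ⟶ Y) (v : gobj hf X.left) :
    ma hf Y (gmap hf φ.left.hom v) = φ.right.hom (ma hf X v) :=
  congrArg (fun q => q.hom v) φ.w

theorem m_hB {X Y : Comma (G k hf) (𝟭 (ModuleCat.{0} (Alg k DS)))} (φ : X ⟶ Y) (y : ℕ)
    (r : X.left) : φ.right.hom (mB hf (ma hf X) y r) = mB hf (ma hf Y) y (φ.left.hom r) := by
  rw [mB_apply, mB_apply, ← ma_w, dl_gmap]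

theorem m_hA {X Y : Comma (G k hf) (𝟭 (ModuleCat.{0} (Alg k DS)))} (φ : X ⟶ Y) (y : ℕ)
    (m : X.right) : φ.left.hom ((0 : ℕ → X.right →ₗ[k] X.left) y m) =
      (0 : ℕ → Y.right →ₗ[k] Y.left) y (φ.right.hom m) := by simp

def mmap {X Y : Comma (G k hf) (𝟭 (ModuleCat.{0} (Alg k DS)))} (φ : X ⟶ Y) :
    Tw hf.hm (mTwD hf (ma hf X)) →ₗ[Alg k Dm] Tw hf.hm (mTwD hf (ma hf Y)) :=
  twMap hf.hm (mTwD hf (ma hf X)) (mTwD hf (ma hf Y))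
    φ.right.hom φ.left.hom (m_hA hf φ) (m_hB hf φ)

theorem mmap_apply {X Y : Comma (G k hf) (𝟭 (ModuleCat.{0} (Alg k DS)))} (φ : X ⟶ Y) (m : X.right)
    (r : X.left) : mmap hf φ (twInj hf.hm (mTwD hf (ma hf X)) (m, r)) =
      twInj hf.hm (mTwD hf (ma hf Y)) (φ.right.hom m, φ.left.hom r) :=
  twMap_apply hf.hm (mTwD hf (ma hf X)) (mTwD hf (ma hf Y))
    φ.right.hom φ.left.hom (m_hA hf φ) (m_hB hf φ) m r

variable (k) in
def Tm : Comma (G k hf) (𝟭 (ModuleCat.{0} (Alg k DS))) ⥤ ModuleCat.{0} (Alg k Dm) where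
  obj X := Tw hf.hm (mTwD hf (ma hf X))
  map {X Y} φ := ModuleCat.ofHom (mmap hf φ)
  map_id X := by
    apply ModuleCat.hom_ext
    apply LinearMap.ext
    intro x
    obtain ⟨⟨m, r⟩, rfl⟩ := (twInj hf.hm (mTwD hf (ma hf X))).surjective x
    exact mmap_apply hf (𝟙 X) m r
  map_comp {X Y Z} φ ψ := by
    apply ModuleCat.hom_ext
    apply LinearMap.ext
    intro x
    obtain ⟨⟨m, r⟩, rfl⟩ := (twInj hf.hm (mTwD hf (ma hf X))).surjective x
    refine (mmap_apply hf (φ ≫ ψ) m r).trans (Eq.symm ?_)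
    exact (congrArg (mmap hf ψ) (mmap_apply hf φ m r)).trans (mmap_apply hf ψ _ _)

theorem Tm_map {X Y : Comma (G k hf) (𝟭 (ModuleCat.{0} (Alg k DS)))} (φ : X ⟶ Y) (m : X.right)
    (r : X.left) : ((Tm k hf).map φ).hom (twInj hf.hm (mTwD hf (ma hf X)) (m, r)) =
      twInj hf.hm (mTwD hf (ma hf Y)) (φ.right.hom m, φ.left.hom r) :=
  mmap_apply hf φ m r

theorem Tm_faithful : (Tm k hf).Faithful := ⟨by
  intro X Y φ ψ h
  have key : ∀ m r, (φ.right.hom m, φ.left.hom r) = (ψ.right.hom m, ψ.left.hom r) := by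
    intro m r
    apply (twInj hf.hm (mTwD hf (ma hf Y))).injective
    rw [← Tm_map, ← Tm_map, h]
  ext m
  · exact congrArg Prod.snd (key 0 m)
  · exact congrArg Prod.fst (key m 0)⟩

theorem Tm_full : (Tm k hf).Full := ⟨by
  intro X Y φ
  obtain ⟨g, h, h1, h2, h3⟩ := tw_full hf.hm (mTwD hf (ma hf X)) (mTwD hf (ma hf Y)) φ.hom
  refine ⟨{ left := ModuleCat.ofHom h, right := ModuleCat.ofHom g, w := ?_ }, ?_⟩
  · apply ModuleCat.hom_ext
    apply LinearMap.ext
    intro m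
    exact (m_nat hf (ma hf X) (ma hf Y) g h h3 m).symm
  · apply ModuleCat.hom_ext
    apply LinearMap.ext
    intro x
    obtain ⟨⟨m, r⟩, rfl⟩ := (twInj hf.hm (mTwD hf (ma hf X))).surjective x
    rw [Tm_map]
    exact (h1 m r).symm⟩

section ess
variable (A : ℕ → M →ₗ[k] R) (B : ℕ → R →ₗ[k] M)

def mal0 : gobj hf R →+ M where
  toFun v := ∑ x ∈ Finset.Icc b c, ∑ a ∈ Br, Vw k DS b (x - b) • B a (ev hf R x a v)
  map_zero' := by simp
  map_add' := by intro v w; simp [Finset.sum_add_distrib]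

theorem mal0_apply (v : gobj hf R) : mal0 hf B v =
  ∑ x ∈ Finset.Icc b c, ∑ a ∈ Br, Vw k DS b (x - b) • B a (ev hf R x a v) := rfl

variable (h : TwD Dm Br A B)
include h

theorem m_A0 : A = 0 := by
  funext y
  ext m
  by_cases hy : y ∈ Br
  · rw [← h.At y hy, hf.m_t y hy, e_o (hf.hm.disj _ (hf.chain _ le_rfl hf.bc))]; simp
  · rw [h.A0 y hy]; rfl

theorem e_VB {a : ℕ} (ha : a ∈ Br) (r : R) {x : ℕ} (hx : x ∈ Finset.Icc b c) :
    e k DS x • Vw k DS b (x - b) • B a r = Vw k DS b (x - b) • B a r := by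
  rw [Finset.mem_Icc] at hx
  have h1 := h.Bt a ha r
  rw [hf.m_t a ha] at h1
  have := e_Vw hf h1 (x - b) (by omega)
  rwa [show b + (x - b) = x by omega] at this

def mal : gobj hf R →ₗ[Alg k DS] M := Alg.hom (mal0 hf B)
  (by
    intro d v
    change mal0 hf B (d • v) = d • mal0 hf B v
    rw [mal0_apply, mal0_apply, Finset.smul_sum]
    refine Finset.sum_congr rfl fun x _ => ?_
    rw [Finset.smul_sum]
    refine Finset.sum_congr rfl fun a _ => ?_
    rw [ev_k, map_smul, smul_comm])
  (by
    intro y v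
    rw [mal0_apply, mal0_apply, Finset.smul_sum]
    refine Finset.sum_congr rfl fun x hx => ?_
    rw [Finset.smul_sum]
    refine Finset.sum_congr rfl fun a ha => ?_
    rw [ev_e, ← e_VB hf A B h ha _ hx, ← e_VB hf A B h ha (ev hf R x a v) hx]
    by_cases hxy : x = y
    · subst hxy
      rw [if_pos rfl, e_e]
    · rw [if_neg hxy, e_ne (Ne.symm hxy)]; simp)
  (by
    intro y v
    rw [mal0_apply, mal0_apply, Finset.smul_sum]
    by_cases hy : b < y ∧ y ≤ c
    · refine (Finset.sum_eq_single y ?_ ?_).trans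
        (Eq.trans ?_ (Finset.sum_eq_single (y - 1) ?_ ?_).symm)
      · intro x hx hxy
        refine Finset.sum_eq_zero fun a ha => ?_
        rw [ev_f, if_neg fun h => hxy h.1]; simp
      · intro hx
        exact absurd (Finset.mem_Icc.2 (by omega)) hx
      · rw [Finset.smul_sum]
        refine Finset.sum_congr rfl fun a ha => ?_
        rw [ev_f, if_pos ⟨rfl, hy⟩, show y - b = (y - 1 - b) + 1 by omega, Vw,
          show b + (y - 1 - b) + 1 = y by omega, mul_smul]
      · intro x hx hxy
        rw [Finset.smul_sum]
        refine Finset.sum_eq_zero fun a ha => ?_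
        rw [← e_VB hf A B h ha _ hx]
        exact f_e_ne (by rwa [hf.ch_s y hy.1 hy.2]) _
      · intro hx
        exact absurd (Finset.mem_Icc.2 (by omega)) hx
    · refine Finset.sum_congr rfl fun x hx => ?_
      rw [Finset.smul_sum]
      refine Finset.sum_congr rfl fun a ha => ?_
      rw [ev_f, if_neg fun h => hy h.2, map_zero, smul_zero, ← e_VB hf A B h ha _ hx]
      by_cases hxs : x = DS.s y
      · rw [Finset.mem_Icc] at hx
        rw [f_d (Or.inr (hf.outof y hy (by omega) (by omega)))]
      · rw [f_e_ne hxs])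

theorem mal_dl (a : ℕ) (r : R) : mal hf A B h (dl hf R a r) = B a r := by
  change mal0 hf B _ = _
  rw [mal0_apply, Finset.sum_eq_single b, Nat.sub_self]
  · by_cases ha : a ∈ Br
    · rw [Finset.sum_eq_single a]
      · rw [ev_dl, if_pos ⟨rfl, rfl, ha⟩, ← hf.m_s a ha, h.Bs a ha, Vw, one_smul]
      · intro a' _ h2
        rw [ev_dl, if_neg fun h => h2 h.2.1]; simp
      · intro h2; exact absurd ha h2
    · rw [h.B0 a ha]
      refine Finset.sum_eq_zero fun a' _ => ?_
      rw [ev_dl, if_neg fun h => ha h.2.2]; simp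
  · intro x _ hx
    refine Finset.sum_eq_zero fun a' _ => ?_
    rw [ev_dl, if_neg fun h => hx h.1]; simp
  · intro h2; exact absurd (Finset.mem_Icc.2 ⟨le_rfl, hf.bc⟩) h2

theorem Tm_ess0 : ∃ X, Nonempty ((Tm k hf).obj X ≅ Tw hf.hm h) := by
  let X : Comma (G k hf) (𝟭 (ModuleCat.{0} (Alg k DS))) :=
    { left := R, right := M, hom := ModuleCat.ofHom (mal hf A B h) }
  refine ⟨X, twIso hf.hm (mTwD hf (ma hf X)) h ?_ ?_⟩
  · intro y r
    rw [m_A0 hf A B h]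
  · intro y m
    exact mal_dl hf A B h y m
end ess

theorem Tm_ess : (Tm k hf).EssSurj := ⟨by
  intro N
  obtain ⟨X, ⟨i⟩⟩ := Tm_ess0 hf _ _ (decTwD hf.hm N)
  exact ⟨X, ⟨i ≪≫ decIso hf.hm N⟩⟩⟩

theorem Tm_equiv : (Tm k hf).IsEquivalence := by
  have := Tm_faithful (k := k) hf
  have := Tm_full (k := k) hf
  have := Tm_ess (k := k) hf
  exact {}

variable (k) in
theorem flipDEq : DEq (ModuleCat.{0} (Alg k Dp)) (ModuleCat.{0} (Alg k Dm)) := by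
  have := Tp_equiv (k := k) hf
  have := Tm_equiv (k := k) hf
  have := G_ex (k := k) hf
  exact ((DEq.of_equiv (Tp k hf)).symm.trans (flip_thm (G k hf))).trans (DEq.of_equiv (Tm k hf))

end FlipD

set_option linter.unusedSectionVars false
set_option linter.unusedVariables false
open CategoryTheory
open scoped ModuleCat

/-- tree quiver with parent function `P`; edges across the cut `m` are reversed -/
def tree (n : ℕ) (P : ℕ → ℕ) (m : ℕ) (Rel : Set (List ℕ)) : QD where
  L := Finset.range n
  s y := if P y < m ∧ m ≤ y ∧ y < n then y else P y
  t y := if P y < m ∧ m ≤ y ∧ y < n then P y else y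
  Rel := Rel

theorem tree_top (n : ℕ) (P : ℕ → ℕ) (Rel : Set (List ℕ)) : tree n P n Rel = tree n P 0 Rel := by
  have h : ∀ y, ¬ (P y < n ∧ n ≤ y ∧ y < n) := by intro y; omega
  have h' : ∀ y, ¬ (P y < 0 ∧ 0 ≤ y ∧ y < n) := by intro y; omega
  unfold tree
  simp only [h, h', if_false]

theorem srcFlip {n m : ℕ} {P : ℕ → ℕ} {Rel : Set (List ℕ)} (h0 : P 0 = n)
    (hP : ∀ y, 1 ≤ y → P y < y) (h1 : 1 ≤ m) (hm : m < n)
    (hrel : ∀ p ∈ Rel, p ≠ [] ∧ ∀ y ∈ p, y < m) :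
    FlipD (tree n P m Rel) (tree n P (m + 1) Rel)
      ⟨{m}, (tree n P m Rel).s, (tree n P m Rel).t, Rel⟩
      ⟨(Finset.range n).erase m, (tree n P m Rel).s, (tree n P m Rel).t, Rel⟩
      ((Finset.range n).filter fun y => y = m ∨ P y = m) m m
      (fun y => if y = m then P y else y) := by
  have hP' : ∀ y, (y = 0 ∧ P y = n) ∨ (1 ≤ y ∧ P y < y) := by
    intro y
    rcases Nat.eq_zero_or_pos y with rfl | h
    · exact Or.inl ⟨rfl, h0⟩
    · exact Or.inr ⟨h, hP y h⟩
  have hr : ∀ p ∈ Rel, ∀ y ∈ p, y ∉ (Finset.range n).filter fun y => y = m ∨ P y = m := by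
    intro p hp y hy
    have := (hrel p hp).2 y hy
    have := hP' y
    simp only [Finset.mem_filter, Finset.mem_range]
    omega
  constructor
  case hp =>
    constructor
    case h1 =>
      constructor
      case rel => exact fun p hp => hp
      case rel_br => exact hr
      all_goals
        intro y
        have := hP' y
        simp only [tree, Finset.mem_filter, Finset.mem_range, Finset.mem_singleton]
        (try split_ifs) <;> (first | omega | (simp; done))
    case h2 =>
      constructor
      case rel => exact fun p hp => hp
      case rel_br => exact hr
      all_goals
        intro y
        have := hP' y
        simp only [tree, Finset.mem_filter, Finset.mem_range, Finset.mem_erase]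
        (try split_ifs) <;> (first | omega | (simp; done))
    all_goals
      intro x
      simp only [tree, Finset.mem_range, Finset.mem_singleton, Finset.mem_erase]
      omega
  case hm =>
    constructor
    case h1 =>
      constructor
      case rel => exact fun p hp => hp
      case rel_br => exact hr
      all_goals
        intro y
        have := hP' y
        simp only [tree, Finset.mem_filter, Finset.mem_range, Finset.mem_singleton]
        (try split_ifs) <;> (first | omega | (simp; done))
    case h2 =>
      constructor
      case rel => exact fun p hp => hp
      case rel_br => exact hr
      all_goals
        intro y
        have := hP' y
        simp only [tree, Finset.mem_filter, Finset.mem_range, Finset.mem_erase]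
        (try split_ifs) <;> (first | omega | (simp; done))
    all_goals
      intro x
      simp only [tree, Finset.mem_range, Finset.mem_singleton, Finset.mem_erase]
      omega
  case bc => exact le_rfl
  case relp => exact fun p hp => Or.inl ⟨hp, hp⟩
  case relm => exact fun p hp => ⟨hp, hp⟩
  case rel_ch =>
    intro p hp
    obtain ⟨y, hy⟩ := List.exists_mem_of_ne_nil p (hrel p hp).1
    exact ⟨y, hy, by omega⟩
  case into =>
    intro y h2 h3 h4 h5
    exfalso
    revert h2 h3 h4 h5
    have := hP' y
    simp only [tree, Finset.mem_singleton]
    (try split_ifs) <;> (first | omega | (simp; done))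
  all_goals
    intro y
    have := hP' y
    simp only [tree, Finset.mem_filter, Finset.mem_range, Finset.mem_singleton]
    (try split_ifs) <;> (first | omega | (simp; done))

theorem relFlip {n b r : ℕ} {P : ℕ → ℕ} {Rel : Set (List ℕ)} (h0 : P 0 = n)
    (hP : ∀ y, 1 ≤ y → P y < y) (hb : b < r) (hr : r < n)
    (hch : ∀ y, b < y → y ≤ r → P y = y - 1) (hcr : ∀ y, r < y → y < n → r ≤ P y)
    (hrel : ∀ p ∈ Rel, p ≠ [] ∧ ∀ y ∈ p, y ≤ b) :
    FlipD (tree n P 0 (insert (b :: (chl (r - 1) (r - 1 - b) ++ [r])) Rel))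
      (tree n (Function.update P r b) r Rel)
      ⟨Finset.range r, P, fun y => y, Rel⟩
      ⟨Finset.Ico r n, P, fun y => y, Rel⟩
      {r} b (r - 1) (fun y => r) := by
  have hP' : ∀ y, (y = 0 ∧ P y = n) ∨ (1 ≤ y ∧ P y < y) := by
    intro y
    rcases Nat.eq_zero_or_pos y with rfl | h
    · exact Or.inl ⟨rfl, h0⟩
    · exact Or.inr ⟨h, hP y h⟩
  have hPr := hch r hb le_rfl
  have hrb : ∀ p ∈ Rel, ∀ y ∈ p, y ∉ ({r} : Finset ℕ) := by
    intro p hp y hy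
    have := (hrel p hp).2 y hy
    simp only [Finset.mem_singleton]
    omega
  constructor
  case hp =>
    constructor
    case h1 =>
      constructor
      case rel => exact fun p hp => Set.mem_insert_of_mem _ hp
      case rel_br => exact hrb
      all_goals
        intro y
        have := hP' y
        have := hcr y
        simp only [tree, Finset.mem_range, Finset.mem_singleton]
        by_cases hyr : y = r
        · subst hyr; (try split_ifs) <;> (first | omega | (simp; done))
        (try split_ifs) <;> (first | omega | (simp; done))
    case h2 =>
      constructor
      case rel => exact fun p hp => Set.mem_insert_of_mem _ hp
      case rel_br => exact hrb
      case sub => intro y; simp only [tree, Finset.mem_range, Finset.mem_Ico]; omega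
      all_goals
        intro y
        have := hP' y
        have := hcr y
        simp only [tree, Finset.mem_range, Finset.mem_singleton, Finset.mem_Ico]
        by_cases hyr : y = r
        · subst hyr; (try split_ifs) <;> (first | omega | (simp; done))
        (try split_ifs) <;> (first | omega | (simp; done))
    all_goals
      intro x
      simp only [tree, Finset.mem_range, Finset.mem_Ico]
      omega
  case hm =>
    constructor
    case h1 =>
      constructor
      case rel => exact fun p hp => hp
      case rel_br => exact hrb
      all_goals
        intro y
        have := hP' y
        have := hcr y
        simp only [tree, Finset.mem_range, Finset.mem_singleton]
        by_cases hyr : y = r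
        · subst hyr; (try simp only [Function.update_self]); (try split_ifs) <;> (first | omega | (simp; done))
        try simp only [Function.update_of_ne hyr]
        (try split_ifs) <;> (first | omega | (simp; done))
    case h2 =>
      constructor
      case rel => exact fun p hp => hp
      case rel_br => exact hrb
      all_goals
        intro y
        have := hP' y
        have := hcr y
        simp only [tree, Finset.mem_range, Finset.mem_singleton, Finset.mem_Ico]
        by_cases hyr : y = r
        · subst hyr; (try simp only [Function.update_self]); (try split_ifs) <;> (first | omega | (simp; done))
        try simp only [Function.update_of_ne hyr]
        (try split_ifs) <;> (first | omega | (simp; done))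
    all_goals
      intro x
      simp only [tree, Finset.mem_range, Finset.mem_Ico]
      omega
  case relp =>
    intro p hp
    rcases Set.mem_insert_iff.1 hp with rfl | h
    · exact Or.inr ⟨b, r, by simp, by simp; omega, by omega, rfl⟩
    · exact Or.inl ⟨h, h⟩
  case relm => exact fun p hp => ⟨hp, hp⟩
  case rel_ch =>
    intro p hp
    obtain ⟨y, hy⟩ := List.exists_mem_of_ne_nil p (hrel p hp).1
    have := (hrel p hp).2 y hy
    exact ⟨y, hy, by omega⟩
  case into =>
    intro y h2 h3 h4 h5
    dsimp only at h3 h4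
    obtain rfl : y = b := by omega
    refine ⟨rfl, fun a ha => ?_⟩
    obtain rfl := Finset.mem_singleton.1 ha
    exact Set.mem_insert _ _
  case bc => omega
  case m_s => intro y hy; rw [Finset.mem_singleton] at hy; subst hy; simp [tree, hb, hr]
  case m_t => intro y hy; rw [Finset.mem_singleton] at hy; subst hy; simp [tree, hb, hr]
  all_goals
    intro y
    have := hP' y
    have := hcr y
    have := hch y
    simp only [tree, Finset.mem_range, Finset.mem_singleton]
    by_cases hyr : y = r
    · subst hyr; (try split_ifs) <;> (first | omega | (simp; done))
    (try split_ifs) <;> (first | omega | (simp; done))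

set_option linter.unusedSectionVars false
set_option linter.unusedVariables false
open CategoryTheory
open scoped ModuleCat

theorem srcFlips (k : Type) [Field k] {n m : ℕ} {P : ℕ → ℕ} {Rel : Set (List ℕ)} (h0 : P 0 = n)
    (hP : ∀ y, 1 ≤ y → P y < y) (h1 : 1 ≤ m) (hm : m ≤ n)
    (hrel : ∀ p ∈ Rel, p ≠ [] ∧ ∀ y ∈ p, y < m) :
    DEq (ModuleCat.{0} (Alg k (tree n P m Rel))) (ModuleCat.{0} (Alg k (tree n P 0 Rel))) := by
  obtain ⟨d, rfl⟩ : ∃ d, n = m + d := ⟨n - m, by omega⟩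
  induction d generalizing m with
  | zero =>
    have := tree_top (m + 0) P Rel
    rw [Nat.add_zero] at this
    rw [Nat.add_zero, this]
    exact DEq.refl
  | succ d ih =>
    refine DEq.trans (FlipD.flipDEq k (srcFlip h0 hP h1 (by omega) hrel)) ?_
    rw [show m + (d + 1) = (m + 1) + d by omega] at h0 ⊢
    refine ih (by omega) (fun p hp => ⟨(hrel p hp).1, fun y hy => ?_⟩) h0 (by omega)
    have := (hrel p hp).2 y hy
    omega

/-- the special path -/
def spc (b r : ℕ) : List ℕ := b :: (chl (r - 1) (r - 1 - b) ++ [r])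

theorem fullFlip (k : Type) [Field k] {n b r : ℕ} {P : ℕ → ℕ} {Rel : Set (List ℕ)} (h0 : P 0 = n)
    (hP : ∀ y, 1 ≤ y → P y < y) (hb : b < r) (hr : r < n)
    (hch : ∀ y, b < y → y ≤ r → P y = y - 1) (hcr : ∀ y, r < y → y < n → r ≤ P y)
    (hrel : ∀ p ∈ Rel, p ≠ [] ∧ ∀ y ∈ p, y ≤ b) :
    DEq (ModuleCat.{0} (Alg k (tree n P 0 (insert (spc b r) Rel))))
      (ModuleCat.{0} (Alg k (tree n (Function.update P r b) 0 Rel))) := by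
  refine (FlipD.flipDEq k (relFlip h0 hP hb hr hch hcr hrel)).trans (srcFlips k ?_ ?_ ?_ ?_ ?_)
  · rw [Function.update_of_ne (by omega), h0]
  · intro y hy
    by_cases h : y = r
    · subst h; simpa using hb
    · rw [Function.update_of_ne h]; exact hP y hy
  · omega
  · omega
  · intro p hp
    refine ⟨(hrel p hp).1, fun y hy => ?_⟩
    have := (hrel p hp).2 y hy
    omega

structure AS (n T : ℕ) (b r : ℕ → ℕ) : Prop where
  pos : ∀ i < T, 1 ≤ b i
  lt : ∀ i < T, b i < r i
  le : ∀ i < T, r i < n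
  sep : ∀ i j, i < j → j < T → r i ≤ b j

/-- parent function with the last `d` relations flipped -/
def stP (n T : ℕ) (b r : ℕ → ℕ) : ℕ → ℕ → ℕ
  | 0 => fun y => if y = 0 then n else y - 1
  | (d + 1) => Function.update (stP n T b r d) (r (T - (d + 1))) (b (T - (d + 1)))

def stR (b r : ℕ → ℕ) (j : ℕ) : Set (List ℕ) := {p | ∃ i < j, p = spc (b i) (r i)}

section
variable {n T : ℕ} {b r : ℕ → ℕ} (h : AS n T b r)
include h

theorem AS.mono {i j : ℕ} (hij : i < j) (hj : j < T) : r i < r j :=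
  lt_of_le_of_lt (h.sep i j hij hj) (h.lt j hj)

theorem stP_zero : ∀ d, d ≤ T → stP n T b r d 0 = n := by
  intro d
  induction d with
  | zero => intro _; rfl
  | succ d ih =>
    intro hd
    rw [stP, Function.update_of_ne, ih (by omega)]
    have := h.lt (T - (d + 1)) (by omega)
    omega

theorem stP_ne {y : ℕ} (hy : 1 ≤ y) : ∀ d, d ≤ T → (∀ i, T - d ≤ i → i < T → y ≠ r i) →
    stP n T b r d y = y - 1 := by
  intro d
  induction d with
  | zero => intro _ _; exact if_neg (by omega)
  | succ d ih =>
    intro hd hi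
    rw [stP, Function.update_of_ne (hi _ le_rfl (by omega)),
      ih (by omega) fun i h1 h2 => hi i (by omega) h2]

theorem stP_eq (i : ℕ) (hi : i < T) : ∀ d, d ≤ T → T - d ≤ i → stP n T b r d (r i) = b i := by
  intro d
  induction d with
  | zero => intro _ _; omega
  | succ d ih =>
    intro hd hi'
    rw [stP]
    by_cases h1 : i = T - (d + 1)
    · subst h1; simp
    · rw [Function.update_of_ne, ih (by omega) (by omega)]
      have := h.mono (i := T - (d + 1)) (j := i) (by omega) hi
      omega

theorem stP_cases {y : ℕ} (hy : 1 ≤ y) (d : ℕ) (hd : d ≤ T) :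
    (stP n T b r d y = y - 1 ∧ ∀ i, T - d ≤ i → i < T → y ≠ r i) ∨
      ∃ i, T - d ≤ i ∧ i < T ∧ y = r i ∧ stP n T b r d y = b i := by
  by_cases h1 : ∀ i, T - d ≤ i → i < T → y ≠ r i
  · exact Or.inl ⟨stP_ne h hy d hd h1, h1⟩
  · push Not at h1
    obtain ⟨i, h2, h3, rfl⟩ := h1
    exact Or.inr ⟨i, h2, h3, rfl, stP_eq h i h3 d hd h2⟩

theorem stP_lt (d : ℕ) (hd : d ≤ T) (y : ℕ) (hy : 1 ≤ y) : stP n T b r d y < y := by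
  rcases stP_cases h hy d hd with h1 | ⟨i, h1, h2, h3, h4⟩
  · omega
  · have := h.lt i h2; omega

theorem spc_mem {b r : ℕ} (hb : b < r) : ∀ y ∈ spc b r, y ≤ r := by
  intro y hy
  rcases List.mem_cons.1 hy with rfl | hy
  · omega
  · rcases List.mem_append.1 hy with hy | hy
    · have := mem_chl (by omega : b ≤ r - 1) _ le_rfl y hy; omega
    · rw [List.mem_singleton] at hy; omega

theorem stR_succ (j : ℕ) : stR b r (j + 1) = insert (spc (b j) (r j)) (stR b r j) := by
  ext p
  simp only [stR, Set.mem_ofPred_eq, Set.mem_insert_iff]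
  constructor
  · rintro ⟨i, hi, rfl⟩
    by_cases hij : i = j
    · subst hij; exact Or.inl rfl
    · exact Or.inr ⟨i, by omega, rfl⟩
  · rintro (rfl | ⟨i, hi, rfl⟩)
    · exact ⟨j, by omega, rfl⟩
    · exact ⟨i, by omega, rfl⟩

theorem stStep (k : Type) [Field k] (d : ℕ) (hd : d < T) :
    DEq (ModuleCat.{0} (Alg k (tree n (stP n T b r d) 0 (stR b r (T - d)))))
      (ModuleCat.{0} (Alg k (tree n (stP n T b r (d + 1)) 0 (stR b r (T - (d + 1)))))) := by
  rw [show T - d = (T - (d + 1)) + 1 by omega, stR_succ h, stP]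
  refine fullFlip k (stP_zero h d (by omega)) (stP_lt h d (by omega)) (h.lt _ (by omega))
    (h.le _ (by omega)) ?_ ?_ ?_
  · intro y h1 h2
    refine stP_ne h (by omega) d (by omega) fun i h3 h4 => ?_
    have := h.mono (i := T - (d + 1)) (j := i) (by omega) h4
    omega
  · intro y h1 h2
    rcases stP_cases h (y := y) (by omega) d (by omega) with h3 | ⟨i, h3, h4, h5, h6⟩
    · omega
    · rw [h6]; exact h.sep _ _ (by omega) h4
  · rintro p ⟨i, hi, rfl⟩
    refine ⟨by simp [spc], fun y hy => ?_⟩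
    have h1 := spc_mem h (h.lt i (by omega)) y hy
    have h2 := h.sep i (T - (d + 1)) hi (by omega)
    omega

theorem stAll (k : Type) [Field k] (d : ℕ) (hd : d ≤ T) :
    DEq (ModuleCat.{0} (Alg k (tree n (stP n T b r 0) 0 (stR b r T))))
      (ModuleCat.{0} (Alg k (tree n (stP n T b r d) 0 (stR b r (T - d))))) := by
  induction d with
  | zero => exact DEq.refl
  | succ d ih => exact (ih (by omega)).trans (stStep h k d (by omega))

theorem stMain (k : Type) [Field k] :
    DEq (ModuleCat.{0} (Alg k (tree n (stP n T b r 0) 0 (stR b r T))))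
      (ModuleCat.{0} (Alg k (tree n (stP n T b r T) 0 ∅))) := by
  have h1 := stAll h k T le_rfl
  have h2 : stR b r (T - T) = ∅ := by
    rw [Nat.sub_self]; ext p; simp [stR]
  rwa [h2] at h1
end

set_option linter.unusedSectionVars false
set_option linter.unusedVariables false
open CategoryTheory
open scoped ModuleCat

structure QMatch (Q : PreQuiver) (R : Set (List Q.A)) (D : QD) (φ : Q.V → ℕ) (ψ : Q.A → ℕ) :
    Prop where
  φ_inj : Function.Injective φ
  φ_mem : ∀ v, φ v ∈ D.L
  φ_surj : ∀ x ∈ D.L, ∃ v, φ v = x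
  ψ_inj : Function.Injective ψ
  src : ∀ a, D.s (ψ a) = φ (Q.s a)
  tgt : ∀ a, D.t (ψ a) = φ (Q.t a)
  dead : ∀ y, (¬ ∃ a, ψ a = y) → D.s y ∉ D.L ∨ D.t y ∉ D.L
  rel1 : ∀ p ∈ R, p.map ψ ∈ D.Rel
  rel2 : ∀ p ∈ D.Rel, ∃ q ∈ R, q.map ψ = p

namespace QMatch
theorem op_sum' {ι M : Type*} [AddCommMonoid M] (s : Finset ι) (f : ι → M) :
    MulOpposite.op (∑ i ∈ s, f i) = ∑ i ∈ s, MulOpposite.op (f i) :=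
  map_sum (MulOpposite.opAddEquiv (α := M)) f s

variable {k : Type} [Field k] {Q : PreQuiver} {R : Set (List Q.A)} {D : QD} {φ : Q.V → ℕ}
  {ψ : Q.A → ℕ}

variable (k R) in
def pmk : FreeAlgebra k (Q.V ⊕ Q.A) →ₐ[k] PathAlgebraRel k Q R :=
  RingQuot.mkAlgHom k (PathAlgRel k Q R)

theorem pmk_rel {x y : FreeAlgebra k (Q.V ⊕ Q.A)} (h : PathAlgRel k Q R x y) :
    pmk k R x = pmk k R y := RingQuot.mkAlgHom_rel k h

variable (k R) in
def pe (v : Q.V) : PathAlgebraRel k Q R := pmk k R (FreeAlgebra.ι k (Sum.inl v))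
variable (k R) in
def pf (a : Q.A) : PathAlgebraRel k Q R := pmk k R (FreeAlgebra.ι k (Sum.inr a))

theorem pe_idem (v : Q.V) : pe k R v * pe k R v = pe k R v := by
  simpa [pe] using pmk_rel (k := k) (R := R) (.idem v)
theorem pe_orth (v w : Q.V) (h : v ≠ w) : pe k R v * pe k R w = 0 := by
  simpa [pe] using pmk_rel (k := k) (R := R) (.orth v w h)
theorem pe_unit : ∑ v, pe k R v = 1 := by
  simpa [pe] using pmk_rel (k := k) (R := R) .unit
theorem pf_src (a : Q.A) : pe k R (Q.s a) * pf k R a = pf k R a := by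
  simpa [pe, pf] using pmk_rel (k := k) (R := R) (.source a)
theorem pf_tgt (a : Q.A) : pf k R a * pe k R (Q.t a) = pf k R a := by
  simpa [pe, pf] using pmk_rel (k := k) (R := R) (.target a)
theorem pf_rel (p : List Q.A) (h : p ∈ R) : (p.map (pf k R)).prod = 0 := by
  have := pmk_rel (k := k) (R := R) (.zeroRel p h)
  rw [map_list_prod, map_zero, List.map_map] at this
  exact this

open MulOpposite

variable (k R φ) in
noncomputable def qE (y : ℕ) : (PathAlgebraRel k Q R)ᵐᵒᵖ :=
  Function.extend φ (fun v => op (pe k R v)) 0 y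
variable (k R ψ) in
noncomputable def qF (y : ℕ) : (PathAlgebraRel k Q R)ᵐᵒᵖ :=
  Function.extend ψ (fun a => op (pf k R a)) 0 y

variable (h : QMatch Q R D φ ψ)
include h

theorem qE_φ (v : Q.V) : qE k R φ (φ v) = op (pe k R v) := h.φ_inj.extend_apply _ _ _
theorem qF_ψ (a : Q.A) : qF k R ψ (ψ a) = op (pf k R a) := h.ψ_inj.extend_apply _ _ _
theorem qE_out {y : ℕ} (hy : ¬ ∃ v, φ v = y) : qE k R φ y = 0 :=
  Function.extend_apply' _ _ _ hy
theorem qF_out {y : ℕ} (hy : ¬ ∃ a, ψ a = y) : qF k R ψ y = 0 :=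
  Function.extend_apply' _ _ _ hy

theorem L_eq : D.L = Finset.univ.map ⟨φ, h.φ_inj⟩ := by
  ext x
  simp only [Finset.mem_map, Finset.mem_univ, true_and, Function.Embedding.coeFn_mk]
  constructor
  · exact h.φ_surj x
  · rintro ⟨v, rfl⟩; exact h.φ_mem v

variable (k) in
noncomputable def fwd : Alg k D →ₐ[k] (PathAlgebraRel k Q R)ᵐᵒᵖ :=
  RingQuot.liftAlgHom k ⟨FreeAlgebra.lift k (Sum.elim (qE k R φ) (qF k R ψ)), by
    intro x y hxy
    induction hxy with
    | idem y =>
      simp only [map_mul, FreeAlgebra.lift_ι_apply, Sum.elim_inl]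
      by_cases hy : ∃ v, φ v = y
      · obtain ⟨v, rfl⟩ := hy
        rw [qE_φ h, ← op_mul, pe_idem]
      · rw [qE_out h hy, mul_zero]
    | orth x y hxy =>
      simp only [map_mul, FreeAlgebra.lift_ι_apply, Sum.elim_inl, map_zero]
      by_cases hy : ∃ v, φ v = y
      · by_cases hx : ∃ v, φ v = x
        · obtain ⟨v, rfl⟩ := hy
          obtain ⟨w, rfl⟩ := hx
          rw [qE_φ h, qE_φ h, ← op_mul, pe_orth, op_zero]
          rintro rfl; exact hxy rfl
        · rw [qE_out h hx, zero_mul]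
      · rw [qE_out h hy, mul_zero]
    | out y hy =>
      simp only [FreeAlgebra.lift_ι_apply, Sum.elim_inl, map_zero]
      apply qE_out h
      rintro ⟨v, rfl⟩
      exact hy (h.φ_mem v)
    | unit =>
      simp only [map_sum, FreeAlgebra.lift_ι_apply, Sum.elim_inl, map_one]
      rw [L_eq h, Finset.sum_map]
      simp only [Function.Embedding.coeFn_mk, qE_φ h]
      rw [← op_sum', pe_unit, op_one]
    | src y =>
      simp only [map_mul, FreeAlgebra.lift_ι_apply, Sum.elim_inl, Sum.elim_inr]
      by_cases hy : ∃ v, ψ v = y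
      · obtain ⟨v, rfl⟩ := hy
        rw [qF_ψ h, h.src, qE_φ h, ← op_mul, pf_src]
      · rw [qF_out h hy, zero_mul]
    | tgt y =>
      simp only [map_mul, FreeAlgebra.lift_ι_apply, Sum.elim_inl, Sum.elim_inr]
      by_cases hy : ∃ v, ψ v = y
      · obtain ⟨v, rfl⟩ := hy
        rw [qF_ψ h, h.tgt, qE_φ h, ← op_mul, pf_tgt]
      · rw [qF_out h hy, mul_zero]
    | rel p hp =>
      obtain ⟨q, hq, rfl⟩ := h.rel2 p hp
      rw [map_list_prod, List.map_reverse, List.map_map, map_zero, List.map_map, ← op_zero,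
        ← pf_rel q hq, op_list_prod, List.map_map]
      congr 2
      apply List.map_congr_left
      intro a _
      simp only [Function.comp_apply, FreeAlgebra.lift_ι_apply, Sum.elim_inr]
      exact qF_ψ h a⟩

theorem fwd_e (y : ℕ) : fwd k h (Alg.e k D y) = qE k R φ y := by
  unfold Alg.e Alg.mk fwd
  erw [RingQuot.liftAlgHom_mkAlgHom_apply]
  simp
theorem fwd_f (y : ℕ) : fwd k h (Alg.f k D y) = qF k R ψ y := by
  unfold Alg.f Alg.mk fwd
  erw [RingQuot.liftAlgHom_mkAlgHom_apply]
  simp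

variable (k) in
noncomputable def bwd : PathAlgebraRel k Q R →ₐ[k] (Alg k D)ᵐᵒᵖ :=
  RingQuot.liftAlgHom k ⟨FreeAlgebra.lift k
      (Sum.elim (fun v => op (Alg.e k D (φ v))) (fun a => op (Alg.f k D (ψ a)))), by
    intro x y hxy
    induction hxy with
    | idem y =>
      simp only [map_mul, FreeAlgebra.lift_ι_apply, Sum.elim_inl]
      rw [← op_mul, Alg.e_idem]
    | orth x y hxy =>
      simp only [map_mul, FreeAlgebra.lift_ι_apply, Sum.elim_inl, map_zero]
      rw [← op_mul, Alg.e_orth _ _ _ _ (fun e => hxy (h.φ_inj e).symm), op_zero]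
    | unit =>
      simp only [map_sum, FreeAlgebra.lift_ι_apply, Sum.elim_inl, map_one]
      rw [← op_one, ← Alg.e_unit, L_eq h, Finset.sum_map, op_sum']
      rfl
    | source y =>
      simp only [map_mul, FreeAlgebra.lift_ι_apply, Sum.elim_inl, Sum.elim_inr]
      rw [← op_mul, ← h.src, Alg.f_src]
    | target y =>
      simp only [map_mul, FreeAlgebra.lift_ι_apply, Sum.elim_inl, Sum.elim_inr]
      rw [← op_mul, ← h.tgt, Alg.f_tgt]
    | zeroRel p hp =>
      rw [map_list_prod, List.map_map, map_zero, ← op_zero,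
        ← Alg.f_rel k D _ (h.rel1 p hp), op_list_prod, List.map_reverse, List.reverse_reverse,
        List.map_map, List.map_map]
      congr 1
      apply List.map_congr_left
      intro a _
      simp only [Function.comp_apply, FreeAlgebra.lift_ι_apply, Sum.elim_inr]⟩

theorem bwd_e (v : Q.V) : bwd k h (pe k R v) = op (Alg.e k D (φ v)) := by
  unfold pe pmk bwd
  erw [RingQuot.liftAlgHom_mkAlgHom_apply]
  simp
theorem bwd_f (a : Q.A) : bwd k h (pf k R a) = op (Alg.f k D (ψ a)) := by
  unfold pf pmk bwd
  erw [RingQuot.liftAlgHom_mkAlgHom_apply]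
  simp

theorem bwd_fwd (x : Alg k D) : unop (bwd k h (unop (fwd k h x))) = x := by
  have key : ((AlgHom.opComm (bwd k h)).comp (fwd k h)).comp (Alg.mk k D) = Alg.mk k D := by
    apply FreeAlgebra.hom_ext
    funext y
    rcases y with y | y
    · change unop (bwd k h (unop (fwd k h (Alg.e k D y)))) = Alg.e k D y
      rw [fwd_e]
      by_cases hy : ∃ v, φ v = y
      · obtain ⟨v, rfl⟩ := hy
        rw [qE_φ h, unop_op, bwd_e, unop_op]
      · rw [qE_out h hy, Alg.e_out _ _ _ fun h' => hy (h.φ_surj y h')]; simp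
    · change unop (bwd k h (unop (fwd k h (Alg.f k D y)))) = Alg.f k D y
      rw [fwd_f]
      by_cases hy : ∃ v, ψ v = y
      · obtain ⟨v, rfl⟩ := hy
        rw [qF_ψ h, unop_op, bwd_f, unop_op]
      · rw [qF_out h hy, Alg.f_dead _ _ _ (h.dead y hy)]; simp
  obtain ⟨x, rfl⟩ := Alg.mk_surj k D x
  exact DFunLike.congr_fun key x

theorem fwd_bwd (x : PathAlgebraRel k Q R) : fwd k h (unop (bwd k h x)) = op x := by
  have key : ((AlgHom.op (fwd k h)).comp (bwd k h)).comp (pmk k R) =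
      (AlgEquiv.opOp k (PathAlgebraRel k Q R)).toAlgHom.comp (pmk k R) := by
    apply FreeAlgebra.hom_ext
    funext y
    rcases y with y | y
    · change op (fwd k h (unop (bwd k h (pe k R y)))) = op (op (pe k R y))
      rw [bwd_e, unop_op, fwd_e, qE_φ h]
    · change op (fwd k h (unop (bwd k h (pf k R y)))) = op (op (pf k R y))
      rw [bwd_f, unop_op, fwd_f, qF_ψ h]
  obtain ⟨x, rfl⟩ := RingQuot.mkAlgHom_surjective k (PathAlgRel k Q R) x
  exact op_injective (DFunLike.congr_fun key x)

variable (k) in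
noncomputable def ringEquiv : Alg k D ≃+* (PathAlgebraRel k Q R)ᵐᵒᵖ :=
  RingEquiv.ofBijective (fwd k h) ⟨fun x y hxy => by
      rw [← bwd_fwd h x, ← bwd_fwd h y, hxy],
    fun y => ⟨unop (bwd k h (unop y)), by rw [fwd_bwd, op_unop]⟩⟩

variable (k) in
theorem deq : DEq (ModuleCat.{0} (PathAlgebraRel k Q R)ᵐᵒᵖ) (ModuleCat.{0} (Alg k D)) :=
  DEq.of_equiv (ModuleCat.restrictScalarsEquivalenceOfRingEquiv (ringEquiv k h)).functor

end QMatch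

set_option linter.unusedSectionVars false
set_option linter.unusedVariables false
open CategoryTheory
open scoped ModuleCat

/-- start of the `p`-th block -/
def blk (c : ℕ → ℕ) (p : ℕ) : ℕ := p + ∑ q ∈ Finset.range p, c q

theorem blk_succ (c : ℕ → ℕ) (p : ℕ) : blk c (p + 1) = blk c p + 1 + c p := by
  unfold blk; rw [Finset.sum_range_succ]; omega

theorem blk_zero (c : ℕ → ℕ) : blk c 0 = 0 := by simp [blk]

theorem blk_lt (c : ℕ → ℕ) {p q : ℕ} (h : p < q) : blk c p + c p < blk c q := by
  induction q with
  | zero => omega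
  | succ q ih =>
    rw [blk_succ]
    rcases Nat.lt_succ_iff_lt_or_eq.mp h with h | rfl
    · have := ih h; omega
    · omega

theorem blk_uniq (c : ℕ → ℕ) {p q i j : ℕ} (hi : i ≤ c p) (hj : j ≤ c q)
    (h : blk c p + i = blk c q + j) : p = q ∧ i = j := by
  rcases lt_trichotomy p q with h' | rfl | h'
  · have := blk_lt c h'; omega
  · exact ⟨rfl, by omega⟩
  · have := blk_lt c h'; omega

theorem blk_ex (c : ℕ → ℕ) (L x : ℕ) (hx : x < blk c L) :
    ∃ p < L, ∃ i ≤ c p, x = blk c p + i := by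
  induction L with
  | zero => rw [blk_zero] at hx; omega
  | succ L ih =>
    rw [blk_succ] at hx
    by_cases h : x < blk c L
    · obtain ⟨p, hp, r⟩ := ih h
      exact ⟨p, by omega, r⟩
    · exact ⟨L, by omega, x - blk c L, by omega, by omega⟩

theorem tree_s (n : ℕ) (P : ℕ → ℕ) (Rel : Set (List ℕ)) (y : ℕ) : (tree n P 0 Rel).s y = P y := by
  simp [tree]
theorem tree_t (n : ℕ) (P : ℕ → ℕ) (Rel : Set (List ℕ)) (y : ℕ) : (tree n P 0 Rel).t y = y := by
  simp [tree]

def qphi (L : ℕ) (c : ℕ → ℕ) : (quipuQuiver L (fun v => c v.1)).V → ℕ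
  | Sum.inl p => blk c p.1
  | Sum.inr ⟨v, j⟩ => blk c v.1 + (1 + j.1)

def qpsi (L : ℕ) (c : ℕ → ℕ) : (quipuQuiver L (fun v => c v.1)).A → ℕ
  | Sum.inl p => blk c (p.1 + 1)
  | Sum.inr ⟨v, j⟩ => blk c v.1 + (1 + j.1)

theorem qphi_inj (L : ℕ) (c : ℕ → ℕ) : Function.Injective (qphi L c) := by
  rintro (⟨p, hp⟩ | ⟨⟨p, hp⟩, ⟨i, hi⟩⟩) (⟨q, hq⟩ | ⟨⟨q, hq⟩, ⟨j, hj⟩⟩) h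
  · obtain ⟨rfl, -⟩ := blk_uniq c (p := p) (q := q) (i := 0) (j := 0) (Nat.zero_le _) (Nat.zero_le _) h
    rfl
  · exact absurd (blk_uniq c (p := p) (q := q) (i := 0) (j := 1 + j) (Nat.zero_le _)
      (by change j < c q at hj; omega) h).2 (by omega)
  · exact absurd (blk_uniq c (p := p) (q := q) (i := 1 + i) (j := 0)
      (by change i < c p at hi; omega) (Nat.zero_le _) h).2 (by omega)
  · obtain ⟨rfl, h'⟩ := blk_uniq c (p := p) (q := q) (i := 1 + i) (j := 1 + j)
      (by change i < c p at hi; omega) (by change j < c q at hj; omega) h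
    obtain rfl : i = j := by omega
    rfl

theorem qpsi_eq (L : ℕ) (c : ℕ → ℕ) (a) :
    qpsi L c a = qphi L c ((quipuQuiver L (fun v => c v.1)).t a) := by
  rcases a with a | ⟨v, j⟩ <;> rfl

theorem qmatch {n L : ℕ} (c : ℕ → ℕ) (P : ℕ → ℕ) (hn : blk c L = n) (P0 : P 0 = n)
    (P1 : ∀ p, p + 1 < L → P (blk c (p + 1)) = blk c p)
    (P2 : ∀ p < L, ∀ j < c p, P (blk c p + (1 + j)) = blk c p + j) :
    QMatch (quipuQuiver L (fun v => c v.1)) ∅ (tree n P 0 ∅) (qphi L c) (qpsi L c) where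
  φ_inj := qphi_inj L c
  φ_mem v := by
    show _ ∈ Finset.range n
    rw [Finset.mem_range, ← hn]
    rcases v with ⟨p, hp⟩ | ⟨⟨p, hp⟩, ⟨i, hi⟩⟩
    · have := blk_lt c hp
      show blk c p < _
      omega
    · have := blk_lt c hp
      show blk c p + (1 + i) < _
      change i < c p at hi
      omega
  φ_surj x hx := by
    have hx' : x < blk c L := by rw [hn]; exact Finset.mem_range.mp hx
    obtain ⟨p, hp, i, hi, rfl⟩ := blk_ex c L x hx'
    rcases Nat.eq_zero_or_pos i with rfl | h
    · exact ⟨Sum.inl ⟨p, hp⟩, rfl⟩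
    · refine ⟨Sum.inr ⟨⟨p, hp⟩, ⟨i - 1, (by omega : i - 1 < c p)⟩⟩, ?_⟩
      show blk c p + (1 + (i - 1)) = _
      omega
  ψ_inj a a' h := by
    rw [qpsi_eq, qpsi_eq] at h
    have := qphi_inj L c h
    rcases a with ⟨a, ha⟩ | a <;> rcases a' with ⟨a', ha'⟩ | a'
    · have h2 := congrArg Fin.val (Sum.inl.inj this)
      change a + 1 = a' + 1 at h2
      obtain rfl : a = a' := by omega
      rfl
    · exact absurd this (by rintro ⟨⟩)
    · exact absurd this (by rintro ⟨⟩)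
    · exact congrArg Sum.inr (Sum.inr.inj this)
  src a := by
    rw [tree_s]
    rcases a with ⟨p, hp⟩ | ⟨⟨p, hp⟩, ⟨i, hi⟩⟩
    · exact P1 p (by omega)
    · refine (P2 p hp i hi).trans ?_
      by_cases h : i = 0
      · subst h; rfl
      · simp only [quipuQuiver, h, dif_neg, not_false_eq_true]
        show _ = blk c p + (1 + (i - 1))
        omega
  tgt a := by rw [tree_t, qpsi_eq]
  dead y hy := by
    rw [tree_s, tree_t]
    show _ ∉ Finset.range n ∨ _ ∉ Finset.range n
    simp only [Finset.mem_range]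
    by_contra hc
    have hx' : y < blk c L := by omega
    obtain ⟨p, hp, i, hi, rfl⟩ := blk_ex c L y hx'
    rcases Nat.eq_zero_or_pos i with rfl | h
    · rcases Nat.eq_zero_or_pos p with rfl | h'
      · rw [blk_zero, Nat.add_zero, P0] at hc; omega
      · refine hy ⟨Sum.inl ⟨p - 1, by omega⟩, ?_⟩
        show blk c (p - 1 + 1) = _
        rw [Nat.sub_add_cancel h']; rfl
    · refine hy ⟨Sum.inr ⟨⟨p, hp⟩, ⟨i - 1, (by omega : i - 1 < c p)⟩⟩, ?_⟩
      show blk c p + (1 + (i - 1)) = _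
      omega
  rel1 p hp := hp.elim
  rel2 p hp := hp.elim

/-! Nakayama end -/

theorem chl_range' (c i : ℕ) (h : i ≤ c) : chl c i = List.range' (c - i + 1) i := by
  induction i with
  | zero => rfl
  | succ i ih =>
    rw [chl, ih (by omega), List.range'_succ]
    congr 1
    · omega
    · congr 1; omega

theorem spc_range' {b r : ℕ} (hb : b < r) : spc b r = List.range' b (r + 1 - b) := by
  rw [spc, chl_range' _ _ (by omega)]
  obtain ⟨d, rfl⟩ : ∃ d, r = b + d + 1 := ⟨r - b - 1, by omega⟩
  rw [show b + d + 1 + 1 - b = d + 1 + 1 by omega, List.range'_succ, List.range'_1_concat,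
    show b + d + 1 - 1 - b = d by omega, show b + d + 1 - 1 - d + 1 = b + 1 by omega,
    show b + 1 + d = b + d + 1 by omega]

def npsi (n : ℕ) : (linQuiver n).A → ℕ := fun a => a.1 + 1
def nphi (n : ℕ) : (linQuiver n).V → ℕ := fun a => a.1

theorem linPath_map {n v l : ℕ} (hv : 1 ≤ v) (h : v + l ≤ n) :
    (linPath n v l).map (npsi n) = List.range' v l := by
  unfold linPath
  rw [List.map_filterMap, List.range'_eq_map_range, ← List.filterMap_eq_map]
  apply List.filterMap_congr
  intro j hj
  rw [List.mem_range] at hj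
  rw [dif_pos (by omega)]
  show some (v - 1 + j + 1) = some (v + j)
  congr 1
  omega

theorem nmatch {n : ℕ} (P : ℕ → ℕ) (R : Set (List (linQuiver n).A)) (R' : Set (List ℕ))
    (P0 : P 0 = n) (P1 : ∀ y, 1 ≤ y → P y = y - 1)
    (r1 : ∀ p ∈ R, p.map (npsi n) ∈ R') (r2 : ∀ p ∈ R', ∃ q ∈ R, q.map (npsi n) = p) :
    QMatch (linQuiver n) R (tree n P 0 R') (nphi n) (npsi n) where
  φ_inj a b h := Fin.ext h
  φ_mem v := Finset.mem_range.mpr v.2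
  φ_surj x hx := ⟨⟨x, Finset.mem_range.mp hx⟩, rfl⟩
  ψ_inj a b h := Fin.ext (by simp only [npsi] at h; omega)
  src a := by rw [tree_s]; exact P1 (a.1 + 1) (by omega)
  tgt a := by rw [tree_t]; rfl
  dead y hy := by
    rw [tree_s, tree_t]
    show _ ∉ Finset.range n ∨ _ ∉ Finset.range n
    simp only [Finset.mem_range]
    rcases Nat.eq_zero_or_pos y with rfl | h
    · omega
    · right
      intro hn
      exact hy ⟨⟨y - 1, by omega⟩, (by omega : y - 1 + 1 = y)⟩
  rel1 := r1
  rel2 := r2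

set_option linter.unusedSectionVars false
set_option linter.unusedVariables false
open CategoryTheory
open scoped ModuleCat

/-- extension of a finite sequence by zero -/
def ext0 {t : ℕ} (f : Fin t → ℕ) (i : ℕ) : ℕ := if h : i < t then f ⟨i, h⟩ else 0

theorem ext0_fin {t : ℕ} (f : Fin t → ℕ) (i : Fin t) : ext0 f i.1 = f i := by
  simp [ext0]

theorem ext0_lt {t : ℕ} (f : Fin t → ℕ) (i : ℕ) (h : i < t) : ext0 f i = f ⟨i, h⟩ := by
  simp [ext0, h]

section
variable {n t : ℕ} {ns ls : Fin (t + 1) → ℕ} (h : IsASNakayama n (t + 1) ns ls)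
include h

theorem nakAS : AS n (t + 1) (ext0 ns) (fun i => ext0 ns i + ext0 ls i - 1) where
  pos i hi := by rw [ext0_lt _ _ hi]; exact h.one_le _
  lt i hi := by
    simp only [ext0_lt _ _ hi]
    have := h.two_le ⟨i, hi⟩
    omega
  le i hi := by
    simp only [ext0_lt _ _ hi]
    have := h.two_le ⟨i, hi⟩
    have := h.end_le ⟨i, hi⟩
    omega
  sep i j hij hj := by
    have hi : i < t + 1 := by omega
    simp only [ext0_lt _ _ hi, ext0_lt _ _ hj]
    have := h.almost_separate ⟨i, hi⟩ ⟨j, hj⟩ hij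
    omega

theorem nakMatch : QMatch (linQuiver n) {p | ∃ i : Fin (t + 1), p = linPath n (ns i) (ls i)}
    (tree n (stP n (t + 1) (ext0 ns) (fun i => ext0 ns i + ext0 ls i - 1) 0) 0
      (stR (ext0 ns) (fun i => ext0 ns i + ext0 ls i - 1) (t + 1))) (nphi n) (npsi n) := by
  have key : ∀ i : Fin (t + 1), (linPath n (ns i) (ls i)).map (npsi n) =
      spc (ext0 ns i.1) (ext0 ns i.1 + ext0 ls i.1 - 1) := by
    intro i
    have h2 := h.two_le i
    rw [linPath_map (h.one_le i) (h.end_le i), ext0_fin, ext0_fin, spc_range' (by omega)]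
    congr 1
    omega
  refine nmatch _ _ _ ?_ ?_ ?_ ?_
  · simp [stP]
  · intro y hy
    simp only [stP]
    rw [if_neg (by omega)]
  · rintro p ⟨i, rfl⟩
    exact ⟨i.1, i.2, key i⟩
  · rintro p ⟨i, hi, rfl⟩
    exact ⟨_, ⟨⟨i, hi⟩, rfl⟩, key ⟨i, hi⟩⟩

end

/-- branch positions -/
def bp (kN : ℕ → ℕ) (i : ℕ) : ℕ := i + ∑ j ∈ Finset.range (i + 1), kN j

theorem bp_succ (kN : ℕ → ℕ) (i : ℕ) : bp kN (i + 1) = bp kN i + 1 + kN (i + 1) := by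
  unfold bp; rw [Finset.sum_range_succ _ (i + 1)]; omega

theorem bp_mono (kN : ℕ → ℕ) : StrictMono (bp kN) :=
  strictMono_nat_of_lt_succ fun i => by rw [bp_succ]; omega

/-- cord lengths -/
def crd (T : ℕ) (kN m : ℕ → ℕ) (q : ℕ) : ℕ := ∑ i ∈ Finset.range T, if bp kN i = q then m i else 0

theorem crd_bp {T : ℕ} {kN m : ℕ → ℕ} {i : ℕ} (hi : i < T) : crd T kN m (bp kN i) = m i := by
  unfold crd
  simp only [(bp_mono kN).injective.eq_iff]
  rw [Finset.sum_ite_eq' (Finset.range T) i m, if_pos (Finset.mem_range.mpr hi)]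

theorem crd_ne {T : ℕ} {kN m : ℕ → ℕ} {q : ℕ} (hq : ∀ i < T, bp kN i ≠ q) : crd T kN m q = 0 :=
  Finset.sum_eq_zero fun i hi => if_neg (hq i (Finset.mem_range.mp hi))

theorem blk_crd (T : ℕ) (kN m : ℕ → ℕ) (p : ℕ) :
    blk (crd T kN m) p = p + ∑ i ∈ Finset.range T, if bp kN i < p then m i else 0 := by
  unfold blk crd
  rw [Finset.sum_comm]
  congr 1
  apply Finset.sum_congr rfl
  intro i _
  rw [Finset.sum_ite_eq (Finset.range p) (bp kN i) (fun _ => m i)]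
  simp only [Finset.mem_range]

theorem blk_bp {T : ℕ} {kN m : ℕ → ℕ} {i : ℕ} (hi : i < T) :
    blk (crd T kN m) (bp kN i) = bp kN i + ∑ j ∈ Finset.range i, m j := by
  rw [blk_crd]
  simp only [(bp_mono kN).lt_iff_lt]
  rw [← Finset.sum_filter]
  congr 2
  ext j
  simp only [Finset.mem_filter, Finset.mem_range]
  omega

section
variable {n t : ℕ} {b l kN : ℕ → ℕ} (k0 : kN 0 = b 0)
  (hl : ∀ i ≤ t, 2 ≤ l i)
  (hs : ∀ i < t, b i + l i ≤ b (i + 1) + 1) (he : b t + l t ≤ n)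
  (k1 : ∀ i < t, kN (i + 1) = b (i + 1) + 1 - b i - l i)
  (k2 : kN (t + 1) = n + 1 - b t - l t)

include k0 hl hs k1 in
theorem blk_bp_eq (i : ℕ) (hi : i ≤ t) :
    blk (crd (t + 1) kN (fun i => l i - 2)) (bp kN i) = b i := by
  rw [blk_bp (by omega)]
  induction i with
  | zero => simp [bp, k0]
  | succ i ih =>
    have := ih (by omega)
    have := hl i (by omega)
    have := hs i (by omega)
    rw [bp_succ, Finset.sum_range_succ, k1 i (by omega)]
    omega

include k0 hl hs k1 in
theorem blk_bp_succ (i : ℕ) (hi : i ≤ t) :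
    blk (crd (t + 1) kN (fun i => l i - 2)) (bp kN i + 1) = b i + l i - 1 := by
  have := hl i hi
  rw [blk_succ, blk_bp_eq k0 hl hs k1 i hi, crd_bp (by omega)]
  omega

include k0 hl hs k1 he k2 in
theorem blk_top : blk (crd (t + 1) kN (fun i => l i - 2))
    (t + 1 + ∑ j ∈ Finset.range (t + 2), kN j) = n := by
  have h1 := blk_bp_eq k0 hl hs k1 t le_rfl
  rw [blk_bp (by omega)] at h1
  have h2 : t + 1 + ∑ j ∈ Finset.range (t + 2), kN j = bp kN (t + 1) := rfl
  have := hl t le_rfl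
  rw [blk_crd, h2]
  simp only [(bp_mono kN).lt_iff_lt]
  rw [Finset.sum_congr rfl (g := fun i => l i - 2)
    (fun i hi => if_pos (Finset.mem_range.mp hi)), bp_succ, Finset.sum_range_succ, k2]
  omega

include k0 hl hs k1 he k2 in
theorem kmMatchAux (hAS : AS n (t + 1) b (fun i => b i + l i - 1)) :
    QMatch (quipuQuiver (t + 1 + ∑ j ∈ Finset.range (t + 2), kN j)
        (fun v => crd (t + 1) kN (fun i => l i - 2) v.1)) ∅
      (tree n (stP n (t + 1) b (fun i => b i + l i - 1) (t + 1)) 0 ∅)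
      (qphi _ (crd (t + 1) kN (fun i => l i - 2))) (qpsi _ (crd (t + 1) kN (fun i => l i - 2))) := by
  refine qmatch _ _ (blk_top k0 hl hs he k1 k2) (stP_zero hAS _ le_rfl) ?_ ?_
  · intro p hp
    by_cases hc : ∃ i < t + 1, bp kN i = p
    · obtain ⟨i, hi, rfl⟩ := hc
      rw [blk_bp_succ k0 hl hs k1 i (by omega), blk_bp_eq k0 hl hs k1 i (by omega)]
      exact stP_eq hAS i hi _ le_rfl (by omega)
    · push Not at hc
      have h1 := blk_succ (crd (t + 1) kN (fun i => l i - 2)) p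
      rw [crd_ne hc] at h1
      rw [stP_ne hAS (by omega) _ le_rfl, h1]
      · omega
      · intro i _ hi he
        rw [← blk_bp_succ k0 hl hs k1 i (by omega)] at he
        have := (blk_uniq _ (i := 0) (j := 0) (Nat.zero_le _) (Nat.zero_le _) he).1
        exact hc i hi (by omega)
  · intro p hp j hj
    rw [stP_ne hAS (by omega) _ le_rfl]
    · omega
    · intro i _ hi he
      rw [← blk_bp_succ k0 hl hs k1 i (by omega)] at he
      have := (blk_uniq _ (i := 1 + j) (j := 0) (by omega) (Nat.zero_le _) he).2
      omega
end

theorem sum_ext0 {t : ℕ} (f : Fin t → ℕ) : ∑ i, f i = ∑ i ∈ Finset.range t, ext0 f i := by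
  rw [← Fin.sum_univ_eq_sum_range]
  exact Finset.sum_congr rfl fun i _ => (ext0_fin f i).symm

theorem bpos_eq (t : ℕ) (kk : Fin (t + 2) → ℕ) (i : Fin (t + 1)) :
    bpos t kk i = bp (ext0 kk) i.1 := by
  unfold bpos bp
  congr 1
  have : ∀ j : Fin (t + 2), (if j.1 ≤ i.1 then kk j else 0) =
      (fun j : ℕ => if j ≤ i.1 then ext0 kk j else 0) j.1 := by
    intro j; simp only [ext0_fin]
  simp only [this]
  rw [Fin.sum_univ_eq_sum_range (fun j : ℕ => if j ≤ i.1 then ext0 kk j else 0),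
    ← Finset.sum_filter]
  congr 1
  ext j
  have := i.2
  simp only [Finset.mem_filter, Finset.mem_range]
  omega

theorem km_eq (t : ℕ) (kk : Fin (t + 2) → ℕ) (ls : Fin (t + 1) → ℕ) :
    kmQuiver t kk (fun i => ls i - 2) =
      quipuQuiver (t + 1 + ∑ j ∈ Finset.range (t + 2), ext0 kk j)
        (fun v => crd (t + 1) (ext0 kk) (fun i => ext0 ls i - 2) v.1) := by
  unfold kmQuiver
  have : ∀ v : ℕ, (∑ i : Fin (t + 1), if bpos t kk i = v then ls i - 2 else 0) =
      crd (t + 1) (ext0 kk) (fun i => ext0 ls i - 2) v := by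
    intro v
    unfold crd
    rw [← Fin.sum_univ_eq_sum_range
      (fun i : ℕ => if bp (ext0 kk) i = v then ext0 ls i - 2 else 0)]
    apply Finset.sum_congr rfl
    intro i _
    rw [bpos_eq, ext0_fin]
  simp only [this]
  rw [sum_ext0]

theorem nakayama_derivedEquivalent_quipu (k : Type) [Field k] (n t : ℕ)
    (ns ls : Fin (t + 1) → ℕ) (h : IsASNakayama n (t + 1) ns ls) :
    DerivedEquivalent k (NakayamaAlgebra k n (t + 1) ns ls)
      (PathAlgebra k (kmQuiver t (nakK n t ns ls) (fun i => ls i - 2))) := by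
  have h2 := kmMatchAux (n := n) (t := t) (b := ext0 ns) (l := ext0 ls)
    (kN := ext0 (nakK n t ns ls)) ?_ ?_ ?_ ?_ ?_ ?_ (nakAS h)
  · rw [km_eq]
    exact (QMatch.deq k (nakMatch h)).trans ((stMain (nakAS h) k).trans (QMatch.deq k h2).symm)
  · simp [ext0, nakK]
  · intro i hi
    rw [ext0_lt _ _ (by omega)]; exact h.two_le _
  · intro i hi
    have h1 : i < t + 1 := by omega
    have h2 : i + 1 < t + 1 := by omega
    rw [ext0_lt _ _ h1, ext0_lt _ _ h1, ext0_lt _ _ h2]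
    exact h.almost_separate ⟨i, h1⟩ ⟨i + 1, h2⟩ (by simp [Fin.lt_def])
  · rw [ext0_lt _ _ (by omega), ext0_lt _ _ (by omega)]; exact h.end_le _
  · intro i hi
    have h1 : i < t + 1 := by omega
    have h2 : i + 1 < t + 1 := by omega
    have h3 : i + 1 < t + 2 := by omega
    rw [ext0_lt _ _ h1, ext0_lt _ _ h1, ext0_lt _ _ h2, ext0_lt _ _ h3]
    simp only [nakK, Nat.add_sub_cancel]
    rw [dif_neg (by omega), dif_pos (by omega)]
  · rw [ext0_lt _ t (by omega), ext0_lt _ t (by omega), ext0_lt _ (t + 1) (by omega)]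
    simp only [nakK]
    rw [dif_neg (by omega), dif_neg (by omega)]
    rfl
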